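/- \textbf{Setting.} A \emph{data schema} $\mathcal D=\langle Cat,CType,Repo,X\rangle$ consists of a read-only catalog $Cat$ (relations with a single-column primary key of an id type and foreign keys), a case identifier type $CType$, a read-write repository $Repo$, and typed case variables $X$ including $\mathtt{self}$. A \emph{DAB} $\mathcal M=\langle\mathcal D,\mathcal P\rangle$ is a data schema with a block-structured process $\mathcal P$ over it: nested blocks (tasks, events, subprocesses, sequence, parallel, exclusive, inclusive, deferred and event-driven choice, loop, possible completion, exception handling), whose tasks and events carry a precondition (a union of conjunctive queries with negated atoms over catalog, repository and case variables) and an effect (setting case variables; inserting, deleting or conditionally updating repository tuples). For a catalog instance, that is, finitely many tuples satisfying primary and foreign keys, $\mathcal M$ is executed from the snapshot with no cases and an empty repository; each step introduces a fresh case (as long as a given limit $N\in\mathbb N\cup\{\infty\}$ on the number of cases permits it) or lets one case progress by a lifecycle rule of one of its blocks. Insertion follows either the \emph{multiset} semantics (the tuple is added) or the \emph{set} semantics (it replaces the tuples that agree with it on the key). $\mathcal M$ is \emph{case-bounded} by $k$ if in all executions over all catalog instances at most $k$ cases are introduced, and \emph{repo-bounded} by $m$ if in all of them each repository relation holds at most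 $m$ tuples. The \emph{characteristic graph} of $Cat$ has the pairs $\langle R,a\rangle$ ($a$ an attribute of $R$) as nodes and an edge $\langle R_1,a_1\rangle\to\langle R_2,a_2\rangle$ iff $R_1=R_2$, $a_2\ne a_1$ and $a_1$ is the primary key of $R_1$, or $a_2$ is the primary key of $R_2$ and $a_1$ is a foreign key referring to $R_2$; $\mathcal M$ is \emph{acyclic} if this graph is acyclic. A \emph{property} $\upsilon=\bigwedge_i G_i[i]$ is a conjunction of guards about pairwise distinct cases; $\mathcal M$ is \emph{unsafe} for $\upsilon$ if some execution over some catalog instance reaches a snapshot satisfying $\upsilon$. $\mathsf{BackReach}$ translates $\mathcal M$, with the bounds $k$ and $m$, into an artifact system with finitely many variables over the DB theory $T$ of the catalog (identifiers and unary functions for the attributes, with $f(x)=\mathtt{undef}\leftrightarrow x=\mathtt{undef}$), and $\upsilon$ into a formula $\varphi$. With $B=\bot$ it then repeats: if $\varphi\wedge\neg B$ is $T$-unsatisfiable, answer no; if $\varphi$ is $T$-satisfiable together with the initial formula, answer yes; otherwise replace $B$ by $\varphi\vee B$, and $\varphi$ by the result of quantifier elimination, in the model completion of $T$, applied to the preimage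 of $\varphi$ under the transitions. \textbf{Theorem.} Let $\mathcal M$ be a DAB executed under the multiset or under the set insertion semantics and with a limit $N$ on the number of cases, such that $\mathcal M$ is case-bounded by $k$, repo-bounded by $m$, and acyclic, and let $\upsilon$ be a property over $\mathcal M$. Then $\mathsf{BackReach}$, run with any correct procedures for $T$-satisfiability and quantifier elimination, terminates on $(\mathcal M,\upsilon)$, and it answers yes if and only if $\mathcal M$ is unsafe for $\upsilon$. Moreover, an explicit executable pair of procedures for $T$-satisfiability and quantifier elimination (search over labellings of the finitely many terms by objects) is correct for every such $\mathcal M$; hence unsafety of such DABs is decidable. -/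

import Mathlib

namespace DataAwareBPMN

/-! ## Types, objects, data schemas -/

/-- Semantic types. `enum a n` is a primitive type with the finite domain of `n` proper objects,
`prim a` a primitive type with an infinite domain, `ident a` an id type (infinite domain). -/
inductive Ty
  | enum (name size : ℕ)
  | prim (name : ℕ)
  | ident (name : ℕ)
  deriving DecidableEq

/-- Objects of a domain: `none` is `undef`, `some k` is the `k`-th proper object. -/
abbrev Val := Option ℕ

/-- `k` is a proper object of the domain of the type. -/
def Ty.hasObj : Ty → ℕ → Bool
  | .enum _ n, k => decide (k < n)
  | .prim _, _ => true
  | .ident _, _ => true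

/-- A catalog relation schema: a primary key of id type `ident idTy`, followed by the
other attributes. -/
structure CatRel where
  idTy : ℕ
  attrs : List Ty

/-- The types of all attributes; position `0` is the primary key. -/
def CatRel.row (R : CatRel) : List Ty := .ident R.idTy :: R.attrs

/-- A repository relation schema. `key` lists the positions of the key that is used by the set
insertion semantics (all positions, when no explicit key is given). -/
structure RepoRel where
  attrs : List Ty
  key : List ℕ

/-- A data schema. `cvars` are the types of the case variables other than `self`. `idConsts`
collects the constant objects of catalog id types that specifications over the schema may
mention, as pairs (name of the id type, object). -/
structure Schema where
  cat : List CatRel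
  ctype : ℕ
  repo : List RepoRel
  cvars : List Ty
  idConsts : List (ℕ × ℕ)

def Schema.isCatId (D : Schema) (s : ℕ) : Bool := D.cat.any fun R => R.idTy == s

/-- Primitive types, id types of catalog relations, and the case identifier type. -/
def Schema.knownTy (D : Schema) : Ty → Bool
  | .ident s => D.isCatId s || s == D.ctype
  | _ => true

/-- The proper object `k` of type `τ` may be mentioned as a constant. -/
def Schema.constOk (D : Schema) : Ty → ℕ → Bool
  | .ident s, k => !D.isCatId s || D.idConsts.contains (s, k)
  | τ, k => τ.hasObj k

structure Schema.WF (D : Schema) : Prop where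
  /-- non-ambiguity of primary keys -/
  keys_nodup : (D.cat.map CatRel.idTy).Nodup
  /-- every non-key attribute of id type is a foreign key to a catalog relation -/
  foreign : ∀ R ∈ D.cat, ∀ s, Ty.ident s ∈ R.attrs → D.isCatId s = true
  ctype_new : D.isCatId D.ctype = false
  repo_attrs : ∀ R ∈ D.repo, R.attrs ≠ [] ∧ ∀ τ ∈ R.attrs, D.knownTy τ = true
  repo_key : ∀ R ∈ D.repo, ∀ p ∈ R.key, p < R.attrs.length
  cvars_known : ∀ τ ∈ D.cvars, D.knownTy τ = true
  consts_cat : ∀ p ∈ D.idConsts, D.isCatId p.1 = true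

/-- The type of the node `⟨R, a⟩` of the characteristic graph (`none` if it is not a node);
`R` is given by its position in the catalog, `a` by its position in `R`. -/
def Schema.typeAt (D : Schema) (p : ℕ × ℕ) : Option Ty := (D.cat[p.1]?).bind fun R => R.row[p.2]?

/-- The edges of the characteristic graph of the catalog: from a primary key to the other
attributes of its relation, and from a foreign key to the primary key that it refers to. -/
def Schema.Edge (D : Schema) (p q : ℕ × ℕ) : Prop :=
  (D.typeAt p).isSome ∧ (D.typeAt q).isSome ∧
    ((p.1 = q.1 ∧ q.2 ≠ p.2 ∧ p.2 = 0) ∨ (q.2 = 0 ∧ p.2 ≠ 0 ∧ D.typeAt p = D.typeAt q))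

def Schema.Acyclic (D : Schema) : Prop := ∀ p, ¬ Relation.TransGen D.Edge p p

/-! ## Lifecycle states, queries, updates -/

/-- Lifecycle states of blocks; `active2` is the state of an inclusive choice both of whose
branches have been taken. -/
inductive LState
  | idle | enabled | active | active2 | compl | error
  deriving DecidableEq

def LState.code : LState → ℕ
  | .idle => 0 | .enabled => 1 | .active => 2 | .active2 => 3 | .compl => 4 | .error => 5

/-- The enumerated type of the lifecycle states. -/
def lifeTy : Ty := .enum 0 6

/-- Normal (typed) variables. -/
abbrev Var := ℕ × Ty

/-- Terms of queries: case variables (`self`, the declared ones, and the control variable of the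
block with a given number), normal variables, constant objects. -/
inductive Term
  | self
  | cvar (i : ℕ)
  | ctl (b : ℕ)
  | var (v : Var)
  | const (τ : Ty) (c : Val)

/-- The type of a well-typed term. Control variables are allowed for blocks `b < nb`; with
`nb = 0` there are none. -/
def Term.ty (D : Schema) (nb : ℕ) : Term → Option Ty
  | .self => some (.ident D.ctype)
  | .cvar i => D.cvars[i]?
  | .ctl b => if b < nb then some lifeTy else none
  | .var v => if D.knownTy v.2 then some v.2 else none
  | .const τ none => if D.knownTy τ then some τ else none
  | .const τ (some k) => if D.knownTy τ && D.constOk τ k then some τ else none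

def Term.vars : Term → List Var
  | .var v => [v]
  | _ => []

/-- Conditions. -/
inductive Cond
  | eq (a b : Term)
  | not (φ : Cond)
  | and (φ ψ : Cond)

/-- Conditions of choice points are over case variables and constants. -/
def Cond.WF (D : Schema) : Cond → Prop
  | .eq a b => a.vars = [] ∧ b.vars = [] ∧ ∃ τ, a.ty D 0 = some τ ∧ b.ty D 0 = some τ
  | .not φ => φ.WF D
  | .and φ ψ => φ.WF D ∧ ψ.WF D

inductive RelName
  | cat (r : ℕ)
  | repo (r : ℕ)

def Schema.relTypes (D : Schema) : RelName → Option (List Ty)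
  | .cat r => (D.cat[r]?).map CatRel.row
  | .repo r => (D.repo[r]?).map RepoRel.attrs

/-- Literals: `pos = false` marks a negated atom. -/
inductive Lit
  | eq (pos : Bool) (a b : Term)
  | rel (pos : Bool) (R : RelName) (ts : List Term)

/-- Conjunctive queries with filters: conjunctions of literals. -/
abbrev CQ := List Lit

def Lit.WF (D : Schema) (nb : ℕ) : Lit → Prop
  | .eq _ a b => ∃ τ, a.ty D nb = some τ ∧ b.ty D nb = some τ
  | .rel _ R ts => ∃ τs, D.relTypes R = some τs ∧ ts.map (Term.ty D nb) = τs.map some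

def Lit.vars : Lit → List Var
  | .eq _ a b => a.vars ++ b.vars
  | .rel _ _ ts => ts.flatMap Term.vars

def Lit.RepoFree : Lit → Prop
  | .rel _ (.repo _) _ => False
  | _ => True

/-- A guard `q(head) ← ⋁ body`. The variables outside the head are existentially quantified. -/
structure Guard where
  head : List Var
  body : List CQ

def Guard.WF (D : Schema) (nb : ℕ) (G : Guard) : Prop :=
  (∀ v ∈ G.head, D.knownTy v.2 = true) ∧ ∀ Q ∈ G.body, ∀ l ∈ Q, l.WF D nb

/-- The nested `IF filter THEN .. ELSE ..` part of a conditional update. -/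
inductive Ite
  | leaf (us : List Term)
  | ite (filter : List CQ) (yes no : Ite)

/-- Effect rules; `sets` is the list of assignments `x_i = v_i` of the SET part. `set` is
the rule without INSERT part, and a pure insert or delete rule has `sets = []`. -/
inductive Effect
  | set (sets : List (ℕ × Term))
  | insert (r : ℕ) (us : List Term) (sets : List (ℕ × Term))
  | delete (r : ℕ) (us : List Term) (sets : List (ℕ × Term))
  | update (r : ℕ) (vs : List Var) (body : Ite)

/-- `t` has type `τ`, and its normal variables are among `vs`. -/
def Term.TypedIn (D : Schema) (vs : List Var) (t : Term) (τ : Ty) : Prop :=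
  t.ty D 0 = some τ ∧ ∀ v ∈ t.vars, v ∈ vs

/-- Such a term whose value may be written into a case variable or a repository tuple: case
identifiers come into being at run time, so a written one is never given by a constant. -/
def Term.Storable (D : Schema) (vs : List Var) (t : Term) (τ : Ty) : Prop :=
  t.TypedIn D vs τ ∧ ∀ k, t ≠ .const (.ident D.ctype) (some k)

def SetsWF (D : Schema) (vs : List Var) (sets : List (ℕ × Term)) : Prop :=
  (sets.map Prod.fst).Nodup ∧
    ∀ p ∈ sets, ∃ τ, D.cvars[p.1]? = some τ ∧ p.2.Storable D vs τ

def Ite.WF (D : Schema) (vs : List Var) (τs : List Ty) : Ite → Prop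
  | .leaf us => List.Forall₂ (fun t τ => Term.Storable D vs t τ) us τs
  | .ite ψ a b => (∀ Q ∈ ψ, ∀ l ∈ Q, l.WF D 0 ∧ l.RepoFree ∧ ∀ v ∈ l.vars, v ∈ vs) ∧
      a.WF D vs τs ∧ b.WF D vs τs

def Effect.WF (D : Schema) (head : List Var) : Effect → Prop
  | .set ss => SetsWF D head ss
  | .insert r us ss => (∃ R, D.repo[r]? = some R ∧
      List.Forall₂ (fun t τ => Term.Storable D head t τ) us R.attrs) ∧ SetsWF D head ss
  | .delete r us ss => (∃ R, D.repo[r]? = some R ∧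
      List.Forall₂ (fun t τ => Term.TypedIn D head t τ) us R.attrs) ∧ SetsWF D head ss
  | .update r vs body => ∃ R, D.repo[r]? = some R ∧ vs.map Prod.snd = R.attrs ∧ vs.Nodup ∧
      (∀ v ∈ vs, v ∉ head) ∧ body.WF D (head ++ vs) R.attrs

/-- Update specifications: precondition and effect rule. -/
structure UpdateSpec where
  pre : Guard
  eff : Effect

def UpdateSpec.WF (D : Schema) (u : UpdateSpec) : Prop := u.pre.WF D 0 ∧ u.eff.WF D u.pre.head

/-! ## Blocks and their lifecycle rules -/

/-- End events of a possible completion: a plain one (message or none), or an error with a label. -/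
inductive EndKind
  | plain
  | error (label : ℕ)

/-- Boundary events: an external one (message or timer), which is triggered nondeterministically,
or the error with a given label, which is triggered by an error end event. -/
inductive Boundary
  | external
  | error (label : ℕ)

/-- Blocks. `longTask` is a nonatomic task, whose effect only sets case variables. -/
inductive Block
  | empty
  | task (u : UpdateSpec)
  | longTask (g : Guard) (sets : List (ℕ × Term))
  | event (u : UpdateSpec)
  | proc (start : UpdateSpec) (b : Block) (finish : UpdateSpec)
  | sub (p : Block)
  | seq (b₁ b₂ : Block)
  | possibleCompl (φ₁ φ₂ : Cond) (e : EndKind)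
  | deferred (b₁ b₂ : Block)
  | par (b₁ b₂ : Block)
  | xor (φ₁ φ₂ : Cond) (b₁ b₂ : Block)
  | incl (φ₁ φ₂ : Cond) (b₁ b₂ : Block)
  | loop (φ₁ φ₂ : Cond) (b₁ b₂ : Block)
  | eventChoice (e₁ e₂ : UpdateSpec) (b₁ b₂ : Block)
  | backExc (e : Boundary) (a b : Block)
  | fwdExc (e : Boundary) (a b₁ b₂ : Block)
  | nonInterrupting (a b₁ b₂ : Block)

def Block.IsProc : Block → Prop
  | .proc _ _ _ => True
  | _ => False

def Block.IsSub : Block → Prop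
  | .sub _ => True
  | _ => False

/-- Number of blocks, events included. Blocks are numbered in preorder. -/
def Block.size : Block → ℕ
  | .empty | .task _ | .longTask _ _ | .event _ | .possibleCompl _ _ _ => 1
  | .proc _ b _ => b.size + 3
  | .sub p => p.size + 1
  | .seq b₁ b₂ | .deferred b₁ b₂ | .par b₁ b₂ | .xor _ _ b₁ b₂ | .incl _ _ b₁ b₂
  | .loop _ _ b₁ b₂ | .backExc _ b₁ b₂ => b₁.size + b₂.size + 1
  | .eventChoice _ _ b₁ b₂ => b₁.size + b₂.size + 3
  | .fwdExc _ a b₁ b₂ | .nonInterrupting a b₁ b₂ => a.size + b₁.size + b₂.size + 1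

def Block.WF (D : Schema) : Block → Prop
  | .empty => True
  | .task u | .event u => u.WF D
  | .longTask g ss => g.WF D 0 ∧ SetsWF D g.head ss
  | .proc s b f => s.WF D ∧ b.WF D ∧ f.WF D
  | .sub p => p.IsProc ∧ p.WF D
  | .possibleCompl φ₁ φ₂ _ => φ₁.WF D ∧ φ₂.WF D
  | .seq b₁ b₂ | .deferred b₁ b₂ | .par b₁ b₂ => b₁.WF D ∧ b₂.WF D
  | .xor φ₁ φ₂ b₁ b₂ | .incl φ₁ φ₂ b₁ b₂ | .loop φ₁ φ₂ b₁ b₂ =>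
      φ₁.WF D ∧ φ₂.WF D ∧ b₁.WF D ∧ b₂.WF D
  | .eventChoice e₁ e₂ b₁ b₂ => e₁.WF D ∧ e₂.WF D ∧ b₁.WF D ∧ b₂.WF D
  | .backExc _ a b => a.IsSub ∧ a.WF D ∧ b.WF D
  | .fwdExc _ a b₁ b₂ | .nonInterrupting a b₁ b₂ => a.IsSub ∧ a.WF D ∧ b₁.WF D ∧ b₂.WF D

/-- The data part of a lifecycle rule: nothing, the test of a condition, an update specification,
or the start and the end of the nonatomic task number `b`, which binds the answer variables
when it becomes active and applies its effect when it is completed. -/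
inductive Act
  | skip
  | test (φ : Cond)
  | exec (u : UpdateSpec)
  | bind (b : ℕ) (g : Guard)
  | release (b : ℕ) (sets : List (ℕ × Term))

/-- A lifecycle rule: if the blocks are in the states of `pre` and the data part can be
performed, then it is performed and the blocks move to the states of `post`. -/
structure Rule where
  pre : List (ℕ × LState)
  act : Act
  post : List (ℕ × LState)

/-- The surroundings of a block: numbers and sizes of the root and of the innermost enclosing
process block, and label, number and size of the enclosing subprocesses with an error boundary
event, innermost first. -/
structure Ctx where
  root : ℕ × ℕ
  inner : ℕ × ℕ
  handlers : List (ℕ × ℕ × ℕ)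

/-- The block with number `p.1` and size `p.2` moves to `q`, and all its sub-blocks to idle. -/
def interrupt (p : ℕ × ℕ) (q : LState) : List (ℕ × LState) :=
  (p.1, q) :: (List.range (p.2 - 1)).map fun i => (p.1 + 1 + i, .idle)

/-- Where an end event leads: a plain one completes the innermost enclosing process block,
an error moves the innermost subprocess that catches it to the state `error`; an uncaught error
terminates the case. -/
def Ctx.leave (C : Ctx) : EndKind → List (ℕ × LState)
  | .plain => interrupt C.inner .compl
  | .error l => match C.handlers.lookup l with
    | some p => interrupt p .error
    | none => interrupt C.root .error

def Ctx.guardWith (C : Ctx) (e : Boundary) (p : ℕ × ℕ) : Ctx :=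
  match e with
  | .external => C
  | .error l => { C with handlers := (l, p) :: C.handlers }

/-- An external boundary event interrupts the subprocess `p`. -/
def trigger (e : Boundary) (p : ℕ × ℕ) : List Rule :=
  match e with
  | .external => [⟨[(p.1, .enabled)], .skip, interrupt p .error⟩,
      ⟨[(p.1, .active)], .skip, interrupt p .error⟩]
  | .error _ => []

/-- The lifecycle rules of the block with number `n` and of its sub-blocks. -/
def Block.rules (C : Ctx) (n : ℕ) : Block → List Rule
  | .empty => [⟨[(n, .enabled)], .skip, [(n, .compl)]⟩]
  | .task u | .event u => [⟨[(n, .enabled)], .exec u, [(n, .compl)]⟩]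
  | .longTask g ss => [⟨[(n, .enabled)], .bind n g, [(n, .active)]⟩,
      ⟨[(n, .active)], .release n ss, [(n, .compl)]⟩]
  | .proc s b f =>
      let e := n + 2 + b.size
      [⟨[(n, .enabled)], .skip, [(n, .active), (n + 1, .enabled)]⟩,
        ⟨[(n + 1, .enabled)], .exec s, [(n + 1, .compl)]⟩,
        ⟨[(n + 1, .compl)], .skip, [(n + 1, .idle), (n + 2, .enabled)]⟩,
        ⟨[(n + 2, .compl)], .skip, [(n + 2, .idle), (e, .enabled)]⟩,
        ⟨[(e, .enabled)], .exec f, [(e, .compl)]⟩,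
        ⟨[(e, .compl)], .skip, [(e, .idle), (n, .compl)]⟩] ++
      b.rules { C with inner := (n, b.size + 3) } (n + 2)
  | .sub p =>
      [⟨[(n, .enabled)], .skip, [(n, .active), (n + 1, .enabled)]⟩,
        ⟨[(n + 1, .compl)], .skip, [(n + 1, .idle), (n, .compl)]⟩] ++ p.rules C (n + 1)
  | .seq b₁ b₂ =>
      let m := n + 1 + b₁.size
      [⟨[(n, .enabled)], .skip, [(n, .active), (n + 1, .enabled)]⟩,
        ⟨[(n + 1, .compl)], .skip, [(n + 1, .idle), (m, .enabled)]⟩,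
        ⟨[(m, .compl)], .skip, [(m, .idle), (n, .compl)]⟩] ++
      b₁.rules C (n + 1) ++ b₂.rules C m
  | .possibleCompl φ₁ φ₂ e =>
      [⟨[(n, .enabled)], .test φ₁, [(n, .compl)]⟩,
        ⟨[(n, .enabled)], .test φ₂, C.leave e⟩]
  | .deferred b₁ b₂ =>
      let m := n + 1 + b₁.size
      [⟨[(n, .enabled)], .skip, [(n, .active), (n + 1, .enabled)]⟩,
        ⟨[(n, .enabled)], .skip, [(n, .active), (m, .enabled)]⟩,
        ⟨[(n + 1, .compl)], .skip, [(n + 1, .idle), (n, .compl)]⟩,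
        ⟨[(m, .compl)], .skip, [(m, .idle), (n, .compl)]⟩] ++
      b₁.rules C (n + 1) ++ b₂.rules C m
  | .par b₁ b₂ =>
      let m := n + 1 + b₁.size
      [⟨[(n, .enabled)], .skip, [(n, .active), (n + 1, .enabled), (m, .enabled)]⟩,
        ⟨[(n + 1, .compl), (m, .compl)], .skip, [(n + 1, .idle), (m, .idle), (n, .compl)]⟩] ++
      b₁.rules C (n + 1) ++ b₂.rules C m
  | .xor φ₁ φ₂ b₁ b₂ =>
      let m := n + 1 + b₁.size
      [⟨[(n, .enabled)], .test φ₁, [(n, .active), (n + 1, .enabled)]⟩,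
        ⟨[(n, .enabled)], .test φ₂, [(n, .active), (m, .enabled)]⟩,
        ⟨[(n + 1, .compl)], .skip, [(n + 1, .idle), (n, .compl)]⟩,
        ⟨[(m, .compl)], .skip, [(m, .idle), (n, .compl)]⟩] ++
      b₁.rules C (n + 1) ++ b₂.rules C m
  | .incl φ₁ φ₂ b₁ b₂ =>
      let m := n + 1 + b₁.size
      [⟨[(n, .enabled)], .test (.and φ₁ (.not φ₂)), [(n, .active), (n + 1, .enabled)]⟩,
        ⟨[(n, .enabled)], .test (.and φ₂ (.not φ₁)), [(n, .active), (m, .enabled)]⟩,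
        ⟨[(n, .enabled)], .test (.and φ₁ φ₂),
          [(n, .active2), (n + 1, .enabled), (m, .enabled)]⟩,
        ⟨[(n, .active), (n + 1, .compl)], .skip, [(n + 1, .idle), (n, .compl)]⟩,
        ⟨[(n, .active), (m, .compl)], .skip, [(m, .idle), (n, .compl)]⟩,
        ⟨[(n + 1, .compl), (m, .compl)], .skip, [(n + 1, .idle), (m, .idle), (n, .compl)]⟩] ++
      b₁.rules C (n + 1) ++ b₂.rules C m
  | .loop φ₁ φ₂ b₁ b₂ =>
      let m := n + 1 + b₁.size
      [⟨[(n, .enabled)], .skip, [(n, .active), (n + 1, .enabled)]⟩,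
        ⟨[(n + 1, .compl)], .test φ₁, [(n + 1, .idle), (n, .compl)]⟩,
        ⟨[(n + 1, .compl)], .test φ₂, [(n + 1, .idle), (m, .enabled)]⟩,
        ⟨[(m, .compl)], .skip, [(m, .idle), (n + 1, .enabled)]⟩] ++
      b₁.rules C (n + 1) ++ b₂.rules C m
  | .eventChoice e₁ e₂ b₁ b₂ =>
      let m := n + 3 + b₁.size
      [⟨[(n, .enabled)], .skip, [(n, .active), (n + 1, .enabled), (n + 2, .enabled)]⟩,
        ⟨[(n + 1, .enabled)], .exec e₁, [(n + 1, .compl), (n + 2, .idle)]⟩,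
        ⟨[(n + 2, .enabled)], .exec e₂, [(n + 2, .compl), (n + 1, .idle)]⟩,
        ⟨[(n + 1, .compl)], .skip, [(n + 1, .idle), (n + 3, .enabled)]⟩,
        ⟨[(n + 2, .compl)], .skip, [(n + 2, .idle), (m, .enabled)]⟩,
        ⟨[(n + 3, .compl)], .skip, [(n + 3, .idle), (n, .compl)]⟩,
        ⟨[(m, .compl)], .skip, [(m, .idle), (n, .compl)]⟩] ++
      b₁.rules C (n + 3) ++ b₂.rules C m
  | .backExc e a b =>
      let m := n + 1 + a.size
      [⟨[(n, .enabled)], .skip, [(n, .active), (n + 1, .enabled)]⟩,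
        ⟨[(n + 1, .compl)], .skip, [(n + 1, .idle), (n, .compl)]⟩,
        ⟨[(n + 1, .error)], .skip, [(n + 1, .idle), (m, .enabled)]⟩,
        ⟨[(m, .compl)], .skip, [(m, .idle), (n + 1, .enabled)]⟩] ++
      trigger e (n + 1, a.size) ++
      a.rules (C.guardWith e (n + 1, a.size)) (n + 1) ++ b.rules C m
  | .fwdExc e a b₁ b₂ =>
      let m₁ := n + 1 + a.size
      let m₂ := m₁ + b₁.size
      [⟨[(n, .enabled)], .skip, [(n, .active), (n + 1, .enabled)]⟩,
        ⟨[(n + 1, .compl)], .skip, [(n + 1, .idle), (m₁, .enabled)]⟩,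
        ⟨[(m₁, .compl)], .skip, [(m₁, .idle), (n, .compl)]⟩,
        ⟨[(n + 1, .error)], .skip, [(n + 1, .idle), (m₂, .enabled)]⟩,
        ⟨[(m₂, .compl)], .skip, [(m₂, .idle), (n, .compl)]⟩] ++
      trigger e (n + 1, a.size) ++
      a.rules (C.guardWith e (n + 1, a.size)) (n + 1) ++ b₁.rules C m₁ ++ b₂.rules C m₂
  -- The boundary event has occurred iff the handler `b₂` is not idle.
  | .nonInterrupting a b₁ b₂ =>
      let m₁ := n + 1 + a.size
      let m₂ := m₁ + b₁.size
      [⟨[(n, .enabled)], .skip, [(n, .active), (n + 1, .enabled)]⟩,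
        ⟨[(n + 1, .compl)], .skip, [(n + 1, .idle), (m₁, .enabled)]⟩,
        ⟨[(n + 1, .enabled), (m₂, .idle)], .skip, [(m₂, .enabled)]⟩,
        ⟨[(n + 1, .active), (m₂, .idle)], .skip, [(m₂, .enabled)]⟩,
        ⟨[(m₁, .compl), (m₂, .idle)], .skip, [(m₁, .idle), (n, .compl)]⟩,
        ⟨[(m₁, .compl), (m₂, .compl)], .skip, [(m₁, .idle), (m₂, .idle), (n, .compl)]⟩] ++
      a.rules C (n + 1) ++ b₁.rules C m₁ ++ b₂.rules C m₂

/-- A DAB: a data schema and a root process block. -/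
structure DAB where
  schema : Schema
  root : Block

def DAB.WF (M : DAB) : Prop := M.schema.WF ∧ M.root.IsProc ∧ M.root.WF M.schema

def DAB.Acyclic (M : DAB) : Prop := M.schema.Acyclic

/-- All lifecycle rules. The first one starts a new case. -/
def DAB.rules (M : DAB) : List Rule :=
  ⟨[(0, .idle)], .skip, [(0, .enabled)]⟩ ::
    M.root.rules ⟨(0, M.root.size), (0, M.root.size), []⟩ 0

/-- A property `⋀ G_i[i]`: the list of its guards, over case and control variables. -/
abbrev Property := List Guard

def Property.WF (M : DAB) (υ : Property) : Prop := ∀ G ∈ υ, G.WF M.schema M.root.size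

/-! ## Execution semantics -/

/-- The tuples of each catalog relation (relations are given by their positions). -/
abbrev CatInst := ℕ → Set (List Val)

/-- `k` is the primary key of a tuple of the catalog relation with id type `ident s`. -/
def CatInst.HasKey (D : Schema) (I : CatInst) (s k : ℕ) : Prop :=
  ∃ r R, D.cat[r]? = some R ∧ R.idTy = s ∧ ∃ t ∈ I r, t.head? = some (some k)

/-- Catalog instances: finitely many well-typed tuples of proper objects that satisfy the
primary and foreign keys. Constants of catalog id types refer to existing tuples. -/
structure CatInst.Valid (D : Schema) (I : CatInst) : Prop where
  finite : ∀ r, (I r).Finite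
  typed : ∀ r R, D.cat[r]? = some R → ∀ t ∈ I r,
    List.Forall₂ (fun v τ => ∃ k, v = some k ∧ τ.hasObj k = true) t R.row
  primary : ∀ r, ∀ t ∈ I r, ∀ t' ∈ I r, t.head? = t'.head? → t = t'
  foreign : ∀ r R, D.cat[r]? = some R → ∀ t ∈ I r, ∀ (j s k : ℕ),
    R.row[j]? = some (.ident s) → t[j]? = some (some k) → I.HasKey D s k
  consts : ∀ p ∈ D.idConsts, I.HasKey D p.1 p.2

/-- The entry of a case in the case map and the control map; `mem b` holds the binding that
was chosen by the nonatomic task number `b`. -/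
structure CaseEntry where
  vars : ℕ → Val
  ctl : ℕ → LState
  mem : ℕ → Var → Val

def CaseEntry.fresh : CaseEntry := ⟨fun _ => none, fun _ => .idle, fun _ _ => none⟩

/-- Snapshots, without the immutable catalog. `ids` are the identifiers of the cases introduced
so far (values of `entry` outside `ids` mean nothing); the repository holds, for each relation,
a multiset of tuples, as tuples have implicit primary keys. -/
structure Snapshot where
  ids : Finset ℕ
  entry : ℕ → CaseEntry
  repo : ℕ → Multiset (List Val)

def Snapshot.initial : Snapshot := ⟨∅, fun _ => .fresh, fun _ => 0⟩

/-- The objects of a type over which variables range in a snapshot: `undef`, all objects of a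
primitive type, the identifiers of catalog tuples, the identifiers of the existing cases. -/
def InDom (D : Schema) (I : CatInst) (ids : Finset ℕ) : Ty → Val → Prop
  | _, none => True
  | .ident s, some k => if s = D.ctype then k ∈ ids else I.HasKey D s k
  | τ, some k => τ.hasObj k = true

def Assignment (D : Schema) (I : CatInst) (ids : Finset ℕ) (σ : Var → Val) : Prop :=
  ∀ v, InDom D I ids v.2 (σ v)

def Term.eval (id : ℕ) (e : CaseEntry) (σ : Var → Val) : Term → Val
  | .self => some id
  | .cvar i => e.vars i
  | .ctl b => some (e.ctl b).code
  | .var v => σ v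
  | .const _ c => c

def Cond.Holds (ev : Term → Val) : Cond → Prop
  | .eq a b => ev a = ev b
  | .not φ => ¬ φ.Holds ev
  | .and φ ψ => φ.Holds ev ∧ ψ.Holds ev

def Lit.Holds (I : CatInst) (repo : ℕ → Multiset (List Val)) (ev : Term → Val) : Lit → Prop
  | .eq pos a b => pos = true ↔ ev a = ev b
  | .rel pos (.cat r) ts => pos = true ↔ ts.map ev ∈ I r
  | .rel pos (.repo r) ts => pos = true ↔ ts.map ev ∈ repo r

/-- Truth of the union of conjunctive queries. -/
def UCQHolds (I : CatInst) (repo : ℕ → Multiset (List Val)) (ev : Term → Val)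
    (B : List CQ) : Prop := ∃ Q ∈ B, ∀ l ∈ Q, l.Holds I repo ev

inductive InsertionSemantics
  | multisetIns
  | setIns
  deriving DecidableEq

/-- The tuples agree on the positions of the key. -/
def agree (key : List ℕ) (t u : List Val) : Bool := key.all fun p => t[p]? == u[p]?

/-- Insertion of `u` into the current instance `m` of a repository relation with key `key`. -/
def insertTuple (ins : InsertionSemantics) (key : List ℕ) (u : List Val)
    (m : Multiset (List Val)) : Multiset (List Val) :=
  match ins with
  | .multisetIns => u ::ₘ m
  | .setIns => u ::ₘ m.filter fun t => agree key t u = false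

open Classical in
/-- The tuple that a conditional update puts in the place of a given one, which is bound by
`σ`. -/
noncomputable def Ite.result (I : CatInst) (repo : ℕ → Multiset (List Val)) (ev : Term → Val) :
    Ite → List Val
  | .leaf us => us.map ev
  | .ite ψ a b => if UCQHolds I repo ev ψ then a.result I repo ev else b.result I repo ev

/-- Extend `σ` by binding the variables `vs` to the components of a tuple. -/
def bindTuple (σ : Var → Val) (vs : List Var) (t : List Val) : Var → Val :=
  fun v => ((vs.zip t).lookup v).getD (σ v)

def applySets (ev : Term → Val) (sets : List (ℕ × Term)) (x : ℕ → Val) : ℕ → Val :=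
  fun i => ((sets.lookup i).map ev).getD (x i)

/-- The effect rule, grounded by `σ`, leads case `id` from case data `e` and repository `repo`
to the case variables `x'` and the repository `repo'`. -/
def Effect.Apply (D : Schema) (ins : InsertionSemantics) (I : CatInst) (id : ℕ) (e : CaseEntry)
    (repo : ℕ → Multiset (List Val)) (σ : Var → Val) :
    Effect → (ℕ → Val) → (ℕ → Multiset (List Val)) → Prop
  | .set ss, x', repo' => x' = applySets (Term.eval id e σ) ss e.vars ∧ repo' = repo
  | .insert r us ss, x', repo' => x' = applySets (Term.eval id e σ) ss e.vars ∧
      ∃ R, D.repo[r]? = some R ∧ repo' = Function.update repo r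
        (insertTuple ins R.key (us.map (Term.eval id e σ)) (repo r))
  | .delete r us ss, x', repo' => x' = applySets (Term.eval id e σ) ss e.vars ∧
      us.map (Term.eval id e σ) ∈ repo r ∧
      repo' = Function.update repo r ((repo r).erase (us.map (Term.eval id e σ)))
  | .update r vs body, x', repo' => x' = e.vars ∧ repo' = Function.update repo r
      ((repo r).map fun t => body.result I repo (Term.eval id e (bindTuple σ vs t)))

/-- The data part of a rule leads case `id` in snapshot `s` to the case variables `x'`, the
bindings `mem'` and the repository `repo'`. -/
def Act.Apply (D : Schema) (ins : InsertionSemantics) (I : CatInst) (s : Snapshot) (id : ℕ) :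
    Act → (ℕ → Val) → (ℕ → Var → Val) → (ℕ → Multiset (List Val)) → Prop
  | .skip, x', mem', repo' =>
      x' = (s.entry id).vars ∧ mem' = (s.entry id).mem ∧ repo' = s.repo
  | .test φ, x', mem', repo' => φ.Holds (Term.eval id (s.entry id) fun _ => none) ∧
      x' = (s.entry id).vars ∧ mem' = (s.entry id).mem ∧ repo' = s.repo
  | .exec u, x', mem', repo' => ∃ σ, Assignment D I s.ids σ ∧
      UCQHolds I s.repo (Term.eval id (s.entry id) σ) u.pre.body ∧
      u.eff.Apply D ins I id (s.entry id) s.repo σ x' repo' ∧ mem' = (s.entry id).mem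
  | .bind b g, x', mem', repo' => ∃ σ, Assignment D I s.ids σ ∧
      UCQHolds I s.repo (Term.eval id (s.entry id) σ) g.body ∧
      x' = (s.entry id).vars ∧ repo' = s.repo ∧
      mem' = Function.update (s.entry id).mem b
        fun v => if v ∈ g.head then σ v else (s.entry id).mem b v
  | .release b ss, x', mem', repo' =>
      x' = applySets (Term.eval id (s.entry id) ((s.entry id).mem b)) ss (s.entry id).vars ∧
      mem' = (s.entry id).mem ∧ repo' = s.repo

/-- How a DAB is executed: the insertion semantics, and the number of cases that may be
introduced (`none`: no limit). -/
structure Setting where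
  ins : InsertionSemantics
  caseLimit : Option ℕ

/-- Steps between snapshots: creation of a new case, progression of a case. -/
inductive Step (M : DAB) (S : Setting) (I : CatInst) : Snapshot → Snapshot → Prop
  | newCase (s : Snapshot) (id : ℕ) (fresh : id ∉ s.ids)
      (limit : ∀ N, S.caseLimit = some N → s.ids.card < N) :
      Step M S I s ⟨insert id s.ids, Function.update s.entry id .fresh, s.repo⟩
  | progress (s : Snapshot) (id : ℕ) (hid : id ∈ s.ids) (ρ : Rule) (hρ : ρ ∈ M.rules)
      (control : ∀ p ∈ ρ.pre, (s.entry id).ctl p.1 = p.2)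
      (x' : ℕ → Val) (mem' : ℕ → Var → Val) (repo' : ℕ → Multiset (List Val))
      (data : ρ.act.Apply M.schema S.ins I s id x' mem' repo') :
      Step M S I s ⟨s.ids, Function.update s.entry id
        ⟨x', fun b => (ρ.post.lookup b).getD ((s.entry id).ctl b), mem'⟩, repo'⟩

def Reachable (M : DAB) (S : Setting) (I : CatInst) (s : Snapshot) : Prop :=
  Relation.ReflTransGen (Step M S I) .initial s

/-- The property holds in the snapshot: distinct indexes denote distinct cases; the answer
variables of the guards are shared, their other variables are local. -/
def Property.Holds (M : DAB) (I : CatInst) (s : Snapshot) (υ : Property) : Prop :=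
  ∃ (σ : Var → Val) (c : Fin υ.length → ℕ), Assignment M.schema I s.ids σ ∧
    Function.Injective c ∧ ∀ i, c i ∈ s.ids ∧
      ∃ σ', Assignment M.schema I s.ids σ' ∧ (∀ v ∈ υ[i].head, σ' v = σ v) ∧
        UCQHolds I s.repo (Term.eval (c i) (s.entry (c i)) σ') υ[i].body

/-- Some execution over some catalog instance reaches the property. -/
def Unsafe (M : DAB) (S : Setting) (υ : Property) : Prop :=
  ∃ I : CatInst, I.Valid M.schema ∧ ∃ s, Reachable M S I s ∧ υ.Holds M I s

/-- At most `k` cases are introduced, in every execution over every catalog instance. -/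
def CaseBounded (M : DAB) (S : Setting) (k : ℕ) : Prop :=
  ∀ I : CatInst, I.Valid M.schema → ∀ s, Reachable M S I s → s.ids.card ≤ k

/-- At most `m` tuples are in each repository relation at any time, in every execution over
every catalog instance. -/
def RepoBounded (M : DAB) (S : Setting) (m : ℕ) : Prop :=
  ∀ I : CatInst, I.Valid M.schema → ∀ s, Reachable M S I s → ∀ r, (s.repo r).card ≤ m

/-! ## Formulas over the DB signature, the DB theory and its model completion -/

/-- Names of the artifact variables of the target system, for case slots `c` and repository
slots `s`: identifier, case variables, lifecycle states and stored bindings of a case, the flag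
telling that a repository slot is occupied, and the components of its tuple. -/
inductive AVar
  | self (c : ℕ)
  | cvar (c i : ℕ)
  | ctl (c b : ℕ)
  | mem (c b : ℕ) (v : Var)
  | occ (r s : ℕ)
  | cell (r s a : ℕ)
  deriving DecidableEq

/-- Current and next (primed) copies of artifact variables, and existentially quantified data
variables. -/
inductive SName
  | cur (a : AVar)
  | nxt (a : AVar)
  | ex (tag n : ℕ)
  deriving DecidableEq

structure SVar where
  name : SName
  ty : Ty
  deriving DecidableEq

def SVar.isCur (x : SVar) : Bool :=
  match x.name with
  | .cur _ => true
  | _ => false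

/-- Terms over the DB signature of the catalog: `app r j` is the unary function that maps
identifiers of the relation `r` to its attribute at position `j + 1`; `const τ none` is
`undef`. -/
inductive STerm
  | var (x : SVar)
  | const (τ : Ty) (c : Val)
  | app (r j : ℕ) (t : STerm)
  deriving DecidableEq

/-- The sort of a well-sorted term. -/
def STerm.ty (D : Schema) : STerm → Option Ty
  | .var x => some x.ty
  | .const τ none => some τ
  | .const τ (some k) => if D.constOk τ k then some τ else none
  | .app r j t => (D.cat[r]?).bind fun R =>
      if t.ty D = some (.ident R.idTy) then R.attrs[j]? else none

/-- Quantifier-free formulas. -/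
inductive Fml
  | tru
  | fls
  | eq (a b : STerm)
  | neg (φ : Fml)
  | and (φ ψ : Fml)
  | or (φ ψ : Fml)

def Fml.bigAnd (l : List Fml) : Fml := l.foldr .and .tru

def Fml.bigOr (l : List Fml) : Fml := l.foldr .or .fls

def Fml.WF (D : Schema) : Fml → Prop
  | .tru | .fls => True
  | .eq a b => ∃ τ, a.ty D = some τ ∧ b.ty D = some τ
  | .neg φ => φ.WF D
  | .and φ ψ | .or φ ψ => φ.WF D ∧ ψ.WF D

/-- The variables and constants that occur in a term, as terms. -/
def STerm.base : STerm → STerm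
  | .app _ _ t => t.base
  | t => t

def Fml.bases : Fml → List STerm
  | .tru | .fls => []
  | .eq a b => [a.base, b.base]
  | .neg φ => φ.bases
  | .and φ ψ | .or φ ψ => φ.bases ++ ψ.bases

/-- The term contains no variables but current artifact variables. -/
def STerm.isCur (t : STerm) : Bool :=
  match t.base with
  | .var x => x.isCur
  | _ => true

/-- The formula is a state formula: all its variables are current artifact variables. -/
def Fml.IsState (φ : Fml) : Prop := ∀ t ∈ φ.bases, t.isCur = true

/-- Models of the DB theory `T` of the catalog. Besides the axioms
`f(x) = undef ↔ x = undef`, the theory says that distinct constants denote distinct objects and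
that the enumerated types consist of their constants. -/
structure TModel (D : Schema) where
  U : Type
  sort : Ty → U → Prop
  undef : Ty → U
  cst : Ty → ℕ → U
  fn : ℕ → ℕ → U → U
  undef_sort : ∀ τ, sort τ (undef τ)
  cst_sort : ∀ τ k, D.constOk τ k = true → sort τ (cst τ k)
  fn_sort : ∀ r j R τ u, D.cat[r]? = some R → R.attrs[j]? = some τ → sort (.ident R.idTy) u →
    sort τ (fn r j u)
  fn_undef : ∀ r j R τ u, D.cat[r]? = some R → R.attrs[j]? = some τ → sort (.ident R.idTy) u →
    (fn r j u = undef τ ↔ u = undef (.ident R.idTy))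
  cst_ne_undef : ∀ τ k, D.constOk τ k = true → cst τ k ≠ undef τ
  cst_inj : ∀ τ k l, D.constOk τ k = true → D.constOk τ l = true → cst τ k = cst τ l → k = l
  enum_cases : ∀ a n u, sort (.enum a n) u →
    u = undef (.enum a n) ∨ ∃ k < n, u = cst (.enum a n) k

/-- Well-sorted assignments. -/
def TModel.Sorted {D : Schema} (A : TModel D) (α : SVar → A.U) : Prop := ∀ x, A.sort x.ty (α x)

def TModel.eval {D : Schema} (A : TModel D) (α : SVar → A.U) : STerm → A.U
  | .var x => α x
  | .const τ none => A.undef τ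
  | .const τ (some k) => A.cst τ k
  | .app r j t => A.fn r j (A.eval α t)

def TModel.Sat {D : Schema} (A : TModel D) (α : SVar → A.U) : Fml → Prop
  | .tru => True
  | .fls => False
  | .eq a b => A.eval α a = A.eval α b
  | .neg φ => ¬ A.Sat α φ
  | .and φ ψ => A.Sat α φ ∧ A.Sat α ψ
  | .or φ ψ => A.Sat α φ ∨ A.Sat α ψ

/-- `T`-satisfiability. -/
def TSat (D : Schema) (φ : Fml) : Prop :=
  ∃ (A : TModel D) (α : SVar → A.U), A.Sorted α ∧ A.Sat α φ

/-- `h` embeds the model `A` into the model `B`. -/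
structure TModel.Embeds {D : Schema} (A B : TModel D) (h : A.U → B.U) : Prop where
  sort : ∀ τ u, A.sort τ u → B.sort τ (h u)
  inj : ∀ τ u v, A.sort τ u → A.sort τ v → h u = h v → u = v
  undef : ∀ τ, h (A.undef τ) = B.undef τ
  cst : ∀ τ k, D.constOk τ k = true → h (A.cst τ k) = B.cst τ k
  fn : ∀ r j R τ u, D.cat[r]? = some R → R.attrs[j]? = some τ → A.sort (.ident R.idTy) u →
    h (A.fn r j u) = B.fn r j (h u)

/-- Existentially closed models of `T`, that is, the models of the model completion `T*`:
whatever existential formula with parameters in `A` holds in an extension of `A` holds in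
`A`. The variables in `keep` are the parameters, the others are quantified. -/
def TModel.ExClosed {D : Schema} (A : TModel D) : Prop :=
  ∀ (B : TModel D) (h : A.U → B.U), A.Embeds B h →
    ∀ (φ : Fml) (keep : Set SVar) (α : SVar → A.U) (β : SVar → B.U),
      φ.WF D → A.Sorted α → B.Sorted β → (∀ x ∈ keep, β x = h (α x)) → B.Sat β φ →
      ∃ α' : SVar → A.U, A.Sorted α' ∧ (∀ x ∈ keep, α' x = α x) ∧ A.Sat α' φ

/-! ## Backward reachability -/

/-- The two subprocedures of backward search: a satisfiability test, and elimination of all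
variables other than the current artifact variables. -/
structure Backend where
  sat : Fml → Bool
  qe : Fml → Fml

/-- The test decides `T`-satisfiability, and `qe` is quantifier elimination in `T*`. -/
structure Backend.Correct (D : Schema) (be : Backend) : Prop where
  sat_iff : ∀ φ : Fml, φ.WF D → (be.sat φ = true ↔ TSat D φ)
  qe_wf : ∀ φ : Fml, φ.WF D → (be.qe φ).WF D ∧ (be.qe φ).IsState
  qe_iff : ∀ φ : Fml, φ.WF D → ∀ A : TModel D, A.ExClosed → ∀ α : SVar → A.U, A.Sorted α →
    (A.Sat α (be.qe φ) ↔
      ∃ β : SVar → A.U, A.Sorted β ∧ (∀ x, x.isCur = true → β x = α x) ∧ A.Sat β φ)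

/-- Case-defined functions. -/
inductive CTerm
  | tm (t : STerm)
  | ite (φ : Fml) (a b : CTerm)

/-- The formula `y = F`, for a case-defined function `F`. -/
def CTerm.eqF (y : STerm) : CTerm → Fml
  | .tm t => .eq y t
  | .ite φ a b => .or (.and φ (a.eqF y)) (.and (.neg φ) (b.eqF y))

/-- A transition formula `∃ e (guard ∧ ⋀ x' = F)`; variables without update keep their value.
The quantified `e` are the variables with names `ex`. -/
structure Trans where
  guard : Fml
  upd : List (AVar × CTerm)

/-- A simple artifact system over the DB schema of the catalog: the artifact variables with their
sorts and initial constants, and the transition formulas, whose disjunction is `τ`. -/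
structure SAS where
  vars : List (AVar × Ty × Val)
  trans : List Trans

def curT (a : AVar) (τ : Ty) : STerm := .var ⟨.cur a, τ⟩

/-- The initial formula. -/
def SAS.initial (sys : SAS) : Fml :=
  .bigAnd (sys.vars.map fun p => .eq (curT p.1 p.2.1) (.const p.2.1 p.2.2))

def Trans.fml (vars : List (AVar × Ty × Val)) (t : Trans) : Fml :=
  .and t.guard (.bigAnd (vars.map fun p =>
    ((t.upd.lookup p.1).getD (.tm (curT p.1 p.2.1))).eqF (.var ⟨.nxt p.1, p.2.1⟩)))

def SName.prime : SName → SName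
  | .cur a => .nxt a
  | n => n

def STerm.prime : STerm → STerm
  | .var x => .var ⟨x.name.prime, x.ty⟩
  | .const τ c => .const τ c
  | .app r j t => .app r j t.prime

def Fml.prime : Fml → Fml
  | .tru => .tru
  | .fls => .fls
  | .eq a b => .eq a.prime b.prime
  | .neg φ => .neg φ.prime
  | .and φ ψ => .and φ.prime ψ.prime
  | .or φ ψ => .or φ.prime ψ.prime

/-- The matrix of the preimage `∃ x' e (τ(x, e, x') ∧ φ(x'))`. -/
def SAS.pre (sys : SAS) (φ : Fml) : Fml :=
  .and (.bigOr (sys.trans.map (Trans.fml sys.vars))) φ.prime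

/-- The loop of backward search, run for at most the given number of rounds: `some true` is the
answer unsafe, `some false` the answer safe, `none` means that it is still running. -/
def SAS.search (sys : SAS) (be : Backend) : ℕ → Fml → Fml → Option Bool
  | 0, _, _ => none
  | n + 1, φ, B =>
      if be.sat (.and φ (.neg B)) = false then some false
      else if be.sat (.and sys.initial φ) = true then some true
      else sys.search be n (be.qe (sys.pre φ)) (.or φ B)

/-! ## An executable backend

A `T`-model generated by the values of finitely many variables and constants is described by a
labelling of the terms over them by objects. For an acyclic catalog there are finitely many such
terms, of depth at most the number of catalog relations. -/

/-- The terms that apply one function to `t`. -/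
def STerm.children (D : Schema) (t : STerm) : List STerm :=
  D.cat.zipIdx.flatMap fun p =>
    if t.ty D = some (.ident p.1.idTy) then
      (List.range p.1.attrs.length).map fun j => .app p.2 j t
    else []

def closeTerms (D : Schema) : ℕ → List STerm → List STerm
  | 0, ts => ts
  | d + 1, ts => ts ++ closeTerms D d (ts.flatMap (STerm.children D))

abbrev Labelling := List (STerm × Val)

def Labelling.val (l : Labelling) : STerm → Val
  | .const _ c => c
  | t => (l.lookup t).getD none

def allLabellings (vals : List Val) : List STerm → List Labelling
  | [] => [[]]
  | t :: ts => (allLabellings vals ts).flatMap fun l => vals.map fun v => (t, v) :: l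

/-- The labelling respects the domains of the sorts, congruence, and
`f(x) = undef ↔ x = undef`. -/
def Labelling.valid (D : Schema) (ts : List STerm) (l : Labelling) : Bool :=
  ts.all fun t =>
    (match t.ty D, l.val t with
      | some τ, some k => τ.hasObj k
      | _, _ => true) &&
    (match t with
      | .app r j u => (decide (l.val t = none) == decide (l.val u = none)) &&
          ts.all fun t' => match t' with
            | .app r' j' u' => !(decide (r = r' ∧ j = j' ∧ l.val u = l.val u')) ||
                decide (l.val t = l.val t')
            | _ => true
      | _ => true)

def Labelling.sat (l : Labelling) : Fml → Bool
  | .tru => true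
  | .fls => false
  | .eq a b => decide (l.val a = l.val b)
  | .neg φ => !l.sat φ
  | .and φ ψ => l.sat φ && l.sat ψ
  | .or φ ψ => l.sat φ || l.sat ψ

/-- All terms over the variables and constants of `φ` and the declared id constants. -/
def termsOf (D : Schema) (φ : Fml) : List STerm :=
  (closeTerms D D.cat.length
    (φ.bases ++ D.idConsts.map fun p => STerm.const (.ident p.1) (some p.2)).dedup).dedup

/-- The number of proper objects that suffice for labels: those up to the largest constant, and
one more for each term. -/
def labelBound (ts : List STerm) : ℕ :=
  (ts.map fun t => match t with
    | .const _ (some k) => k + 1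
    | _ => 0).foldr max 0 + ts.length

/-- The models of `φ`, up to isomorphism, that are generated by its variables. -/
def modelsOf (D : Schema) (φ : Fml) : List Labelling :=
  (allLabellings (none :: (List.range (labelBound (termsOf D φ))).map some) (termsOf D φ)).filter
    fun l => l.valid D (termsOf D φ) && l.sat φ

/-- The diagram of a labelling: all equalities and inequalities between the terms `ts` and with
`undef`. -/
def Labelling.diagram (D : Schema) (ts : List STerm) (l : Labelling) : Fml :=
  let lit (a b : STerm) : Fml := if l.val a = l.val b then .eq a b else .neg (.eq a b)
  .bigAnd (ts.flatMap fun t => match t.ty D with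
    | some τ => lit t (.const τ none) :: (ts.filter fun t' => t'.ty D = some τ).map (lit t)
    | none => [])

/-- Satisfiability by search for a labelling; elimination by the disjunction of the diagrams, over
the current artifact variables, of all models. -/
def refBackend (D : Schema) : Backend where
  sat φ := !(modelsOf D φ).isEmpty
  qe φ := .bigOr ((modelsOf D φ).map fun l =>
    l.diagram D ((termsOf D φ).filter STerm.isCur))

/-! ## Translation of DABs and properties -/

/-- The type of the flag of a repository slot: `some 0` occupied, `undef` free. -/
def occTy : Ty := .enum 1 1

def selfT (D : Schema) (c : ℕ) : STerm := curT (.self c) (.ident D.ctype)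

def cellTy (D : Schema) (r a : ℕ) : Ty :=
  (((D.repo[r]?).bind fun R => R.attrs[a]?)).getD lifeTy

def cellT (D : Schema) (r s a : ℕ) : STerm := curT (.cell r s a) (cellTy D r a)

def isOcc (r s : ℕ) : Fml := .eq (curT (.occ r s) occTy) (.const occTy (some 0))

def isActive (D : Schema) (c : ℕ) : Fml := .neg (.eq (selfT D c) (.const (.ident D.ctype) none))

/-- Translation of terms for the case in slot `c`; `ρ` says what stands for the normal
variables. -/
def Term.tr (D : Schema) (c : ℕ) (ρ : Var → STerm) : Term → STerm
  | .self => selfT D c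
  | .cvar i => curT (.cvar c i) ((D.cvars[i]?).getD lifeTy)
  | .ctl b => curT (.ctl c b) lifeTy
  | .var v => ρ v
  | .const τ k => .const τ k

def Cond.tr (f : Term → STerm) : Cond → Fml
  | .eq a b => .eq (f a) (f b)
  | .not φ => .neg (φ.tr f)
  | .and φ ψ => .and (φ.tr f) (ψ.tr f)

/-- The tuple in slot `s` of the repository relation `r` is `us`. -/
def rowEq (D : Schema) (r s : ℕ) (us : List STerm) : Fml :=
  .bigAnd (us.zipIdx.map fun p => .eq (cellT D r s p.2) p.1)

/-- `R(t₀, …, tₙ)` is `t₀ ≠ undef ∧ t₁ = f₁(t₀) ∧ …` for a catalog relation, and says that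
some occupied slot holds the tuple, for a repository relation (`m` slots). -/
def relTr (D : Schema) (m : ℕ) : RelName → List STerm → Fml
  | .cat _, [] => .fls
  | .cat r, t :: ts => .and
      (.neg (.eq t (.const (((D.cat[r]?).map fun R => Ty.ident R.idTy).getD lifeTy) none)))
      (.bigAnd (ts.zipIdx.map fun p => .eq p.1 (.app r p.2 t)))
  | .repo r, ts => .bigOr ((List.range m).map fun s => .and (isOcc r s) (rowEq D r s ts))

def signed (pos : Bool) (φ : Fml) : Fml := if pos then φ else .neg φ

def Lit.tr (D : Schema) (m : ℕ) (f : Term → STerm) : Lit → Fml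
  | .eq pos a b => signed pos (.eq (f a) (f b))
  | .rel pos R ts => signed pos (relTr D m R (ts.map f))

def ucqTr (D : Schema) (m : ℕ) (f : Term → STerm) (B : List CQ) : Fml :=
  .bigOr (B.map fun Q => .bigAnd (Q.map (Lit.tr D m f)))

/-- A variable of the case identifier type ranges over the identifiers of the cases in the `nc`
case slots. -/
def caseDom (D : Schema) (nc : ℕ) (ρ : Var → STerm) (v : Var) : Fml :=
  if v.2 = .ident D.ctype then
    .or (.eq (ρ v) (.const v.2 none)) (.bigOr ((List.range nc).map fun c => .eq (ρ v) (selfT D c)))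
  else .tru

def Guard.vars (G : Guard) : List Var := G.head ++ G.body.flatMap fun Q => Q.flatMap Lit.vars

/-- Translation of guards. -/
def Guard.tr (D : Schema) (nc m c : ℕ) (ρ : Var → STerm) (G : Guard) : Fml :=
  .and (.bigAnd (G.vars.map (caseDom D nc ρ))) (ucqTr D m (Term.tr D c ρ) G.body)

def exVar (tag : ℕ) (v : Var) : STerm := .var ⟨.ex tag v.1, v.2⟩

def setsTr (c : ℕ) (f : Term → STerm) (sets : List (ℕ × Term)) : List (AVar × CTerm) :=
  sets.map fun p => (.cvar c p.1, .tm (f p.2))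

/-- Write the tuple `us` into a slot. -/
def fillSlot (r s : ℕ) (us : List STerm) : List (AVar × CTerm) :=
  (.occ r s, .tm (.const occTy (some 0))) :: us.zipIdx.map fun p => (.cell r s p.2, .tm p.1)

/-- Free a slot if `φ` holds. -/
def clearSlot (D : Schema) (r s arity : ℕ) (φ : Fml) : List (AVar × CTerm) :=
  (.occ r s, .ite φ (.tm (.const occTy none)) (.tm (curT (.occ r s) occTy))) ::
    (List.range arity).map fun a =>
      (.cell r s a, .ite φ (.tm (.const (cellTy D r a) none)) (.tm (cellT D r s a)))

/-- The tuple in slot `s` agrees with `us` on the key. -/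
def agreeTr (D : Schema) (r s : ℕ) (key : List ℕ) (us : List STerm) : Fml :=
  .bigAnd (key.map fun p => .eq (cellT D r s p) (us.getD p (.const lifeTy none)))

/-- The component at position `a` of the result of a conditional update. -/
def Ite.tr (D : Schema) (m : ℕ) (f : Term → STerm) (a : ℕ) : Ite → CTerm
  | .leaf us => .tm ((us.map f).getD a (.const lifeTy none))
  | .ite ψ yes no => .ite (ucqTr D m f ψ) (yes.tr D m f a) (no.tr D m f a)

/-- What stands for the variables when the tuple in slot `s` is bound to `vs`. -/
def bindSlot (D : Schema) (r s : ℕ) (ρ : Var → STerm) (vs : List Var) : Var → STerm := fun v =>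
  ((vs.zipIdx).lookup v).elim (ρ v) fun a => cellT D r s a

/-- Translation of effect rules, as guarded updates: one for each choice of a slot. -/
def Effect.tr (D : Schema) (ins : InsertionSemantics) (m c : ℕ) (ρ : Var → STerm) :
    Effect → List Trans
  | .set ss => [⟨.tru, setsTr c (Term.tr D c ρ) ss⟩]
  | .insert r us ss =>
      let f := Term.tr D c ρ
      let R := (D.repo[r]?).getD ⟨[], []⟩
      (List.range m).map fun s => match ins with
        | .multisetIns => ⟨.neg (isOcc r s), fillSlot r s (us.map f) ++ setsTr c f ss⟩
        | .setIns => ⟨.or (.neg (isOcc r s)) (agreeTr D r s R.key (us.map f)),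
            fillSlot r s (us.map f) ++ setsTr c f ss ++
            ((List.range m).filter fun s' => s' ≠ s).flatMap fun s' =>
              clearSlot D r s' R.attrs.length (agreeTr D r s' R.key (us.map f))⟩
  | .delete r us ss =>
      let f := Term.tr D c ρ
      (List.range m).map fun s => ⟨.and (isOcc r s) (rowEq D r s (us.map f)),
        clearSlot D r s us.length .tru ++ setsTr c f ss⟩
  | .update r vs body => [⟨.tru, (List.range m).flatMap fun s =>
      (List.range vs.length).map fun a => (.cell r s a, .ite (isOcc r s)
        (body.tr D m (Term.tr D c (bindSlot D r s ρ vs)) a) (.tm (cellT D r s a)))⟩]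

/-- Translation of the data part of a rule. -/
def Act.tr (D : Schema) (ins : InsertionSemantics) (nc m c : ℕ) : Act → List Trans
  | .skip => [⟨.tru, []⟩]
  | .test φ => [⟨φ.tr (Term.tr D c (exVar 0)), []⟩]
  | .exec u => (u.eff.tr D ins m c (exVar 0)).map fun t =>
      ⟨.and (u.pre.tr D nc m c (exVar 0)) t.guard, t.upd⟩
  | .bind b g => [⟨g.tr D nc m c (exVar 0), g.head.map fun v => (.mem c b v, .tm (exVar 0 v))⟩]
  | .release b ss => [⟨.tru, setsTr c (Term.tr D c fun v => curT (.mem c b v) v.2) ss⟩]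

/-- Translation of a rule for the case in slot `c`. -/
def Rule.tr (D : Schema) (ins : InsertionSemantics) (nc m c : ℕ) (ρ : Rule) : List Trans :=
  (ρ.act.tr D ins nc m c).map fun t =>
    ⟨.and (.and (isActive D c) (.bigAnd (ρ.pre.map fun p =>
        .eq (curT (.ctl c p.1) lifeTy) (.const lifeTy (some p.2.code))))) t.guard,
      ρ.post.map (fun p => (.ctl c p.1, .tm (.const lifeTy (some p.2.code)))) ++ t.upd⟩

/-- Creation of a new case in the free slot `c`. -/
def newCaseTr (D : Schema) (nc c : ℕ) : Trans :=
  let y := exVar 0 (0, .ident D.ctype)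
  ⟨.and (.neg (isActive D c)) (.and (.neg (.eq y (.const (.ident D.ctype) none)))
      (.bigAnd ((List.range nc).map fun c' => .neg (.eq y (selfT D c'))))),
    [(.self c, .tm y)]⟩

/-- The bindings that nonatomic tasks store. -/
def DAB.stored (M : DAB) : List (ℕ × Var) :=
  (M.rules.flatMap fun ρ => match ρ.act with
    | .bind b g => g.head.map fun v => (b, v)
    | _ => []).dedup

/-- The number of case slots, for the a-priori bound `k` on the number of cases. -/
def Setting.caseSlots (S : Setting) (k : ℕ) : ℕ :=
  match S.caseLimit with
  | none => k
  | some N => min N k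

/-- Translation of a DAB with at most `k` cases and at most `m` tuples in each repository
relation. -/
def DAB.toSAS (M : DAB) (S : Setting) (k m : ℕ) : SAS :=
  let D := M.schema
  let nc := S.caseSlots k
  { vars :=
      ((List.range nc).flatMap fun c =>
        (AVar.self c, Ty.ident D.ctype, none) ::
          (D.cvars.zipIdx.map fun p => (AVar.cvar c p.2, p.1, none)) ++
          ((List.range M.root.size).map fun b =>
            (AVar.ctl c b, lifeTy, some LState.idle.code)) ++
          (M.stored.map fun p => (AVar.mem c p.1 p.2, p.2.2, none))) ++
      (D.repo.zipIdx.flatMap fun q => (List.range m).flatMap fun s =>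
        (AVar.occ q.2 s, occTy, none) ::
          (q.1.attrs.zipIdx.map fun p => (AVar.cell q.2 s p.2, p.1, none)))
    trans := (List.range nc).flatMap fun c =>
      newCaseTr D nc c :: M.rules.flatMap (Rule.tr D S.ins nc m c) }

/-- All lists of the given length with entries below `n`. -/
def slotLists (n : ℕ) : ℕ → List (List ℕ)
  | 0 => [[]]
  | i + 1 => (slotLists n i).flatMap fun l => (List.range n).map fun c => c :: l

/-- Translation of a property: its indexes are mapped to distinct active case slots. The answer
variables are shared between the guards, the other ones are renamed apart. -/
def Property.tr (M : DAB) (nc m : ℕ) (υ : Property) : Fml :=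
  .bigOr (((slotLists nc υ.length).filter fun l => l.Nodup).map fun l =>
    .bigAnd ((υ.zip l).zipIdx.map fun p =>
      .and (isActive M.schema p.1.2) (p.1.1.tr M.schema nc m p.1.2
        fun v => if v ∈ p.1.1.head then exVar 0 v else exVar (p.2 + 1) v)))

/-- `BackReach`, run for at most the given number of rounds on a DAB and a property, for the
insertion semantics of `S`, a bound `k` on the number of cases and a bound `m` on the number of
tuples of the repository relations: translate, make the property quantifier-free, and run
backward search. The answer `some true` is yes, `some false` is no. -/
def backReach (be : Backend) (M : DAB) (S : Setting) (k m : ℕ) (υ : Property) (rounds : ℕ) :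
    Option Bool :=
  (M.toSAS S k m).search be rounds (be.qe (υ.tr M (S.caseSlots k) m)) .fls

end DataAwareBPMN

namespace DataAwareBPMN

/-! ## Propositional evaluation of formulas -/

/-- Truth of a formula when `v` tells which equations hold. -/
def Fml.Holds (v : STerm → STerm → Prop) : Fml → Prop
  | .tru => True
  | .fls => False
  | .eq a b => v a b
  | .neg φ => ¬ φ.Holds v
  | .and φ ψ => φ.Holds v ∧ ψ.Holds v
  | .or φ ψ => φ.Holds v ∨ ψ.Holds v

theorem TModel.sat_iff_holds {D : Schema} (A : TModel D) (α : SVar → A.U) (φ : Fml) :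
    A.Sat α φ ↔ φ.Holds fun a b => A.eval α a = A.eval α b := by
  induction φ <;> simp_all [TModel.Sat, Fml.Holds]

theorem Labelling.sat_iff_holds (l : Labelling) (φ : Fml) :
    l.sat φ = true ↔ φ.Holds fun a b => l.val a = l.val b := by
  induction φ with
  | neg φ ih => simp [Labelling.sat, Fml.Holds, ← ih]
  | _ => simp_all [Labelling.sat, Fml.Holds]

theorem Fml.holds_congr {D : Schema} {v w : STerm → STerm → Prop} {φ : Fml} (hφ : φ.WF D)
    (h : ∀ a b τ, a.ty D = some τ → b.ty D = some τ → a.base ∈ φ.bases → b.base ∈ φ.bases →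
      (v a b ↔ w a b)) : φ.Holds v ↔ φ.Holds w := by
  induction φ with
  | tru => simp [Fml.Holds]
  | fls => simp [Fml.Holds]
  | eq a b =>
    obtain ⟨τ, ha, hb⟩ := hφ
    exact h a b τ ha hb (by simp [Fml.bases]) (by simp [Fml.bases])
  | neg φ ih => exact not_congr (ih hφ h)
  | and φ ψ ih₁ ih₂ =>
    refine and_congr (ih₁ hφ.1 fun a b τ ha hb h₁ h₂ => h a b τ ha hb ?_ ?_)
      (ih₂ hφ.2 fun a b τ ha hb h₁ h₂ => h a b τ ha hb ?_ ?_) <;> simp [Fml.bases, *]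
  | or φ ψ ih₁ ih₂ =>
    refine or_congr (ih₁ hφ.1 fun a b τ ha hb h₁ h₂ => h a b τ ha hb ?_ ?_)
      (ih₂ hφ.2 fun a b τ ha hb h₁ h₂ => h a b τ ha hb ?_ ?_) <;> simp [Fml.bases, *]

@[simp] theorem TModel.sat_bigAnd {D : Schema} (A : TModel D) (α : SVar → A.U) (l : List Fml) :
    A.Sat α (.bigAnd l) ↔ ∀ φ ∈ l, A.Sat α φ := by
  induction l with
  | nil => simp [Fml.bigAnd, TModel.Sat]
  | cons φ l ih =>
    simp only [Fml.bigAnd, List.foldr_cons, TModel.Sat, List.mem_cons, forall_eq_or_imp] at ih ⊢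
    rw [ih]

@[simp] theorem TModel.sat_bigOr {D : Schema} (A : TModel D) (α : SVar → A.U) (l : List Fml) :
    A.Sat α (.bigOr l) ↔ ∃ φ ∈ l, A.Sat α φ := by
  induction l with
  | nil => simp [Fml.bigOr, TModel.Sat]
  | cons φ l ih =>
    simp only [Fml.bigOr, List.foldr_cons, TModel.Sat, List.mem_cons, exists_eq_or_imp] at ih ⊢
    rw [ih]

@[simp] theorem Fml.wf_bigAnd {D : Schema} (l : List Fml) :
    (Fml.bigAnd l).WF D ↔ ∀ φ ∈ l, φ.WF D := by
  induction l with
  | nil => simp [Fml.bigAnd, Fml.WF]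
  | cons φ l ih =>
    simp only [Fml.bigAnd, List.foldr_cons, Fml.WF, List.mem_cons, forall_eq_or_imp] at ih ⊢
    rw [ih]

@[simp] theorem Fml.wf_bigOr {D : Schema} (l : List Fml) :
    (Fml.bigOr l).WF D ↔ ∀ φ ∈ l, φ.WF D := by
  induction l with
  | nil => simp [Fml.bigOr, Fml.WF]
  | cons φ l ih =>
    simp only [Fml.bigOr, List.foldr_cons, Fml.WF, List.mem_cons, forall_eq_or_imp] at ih ⊢
    rw [ih]

@[simp] theorem Fml.mem_bases_bigAnd (l : List Fml) (t : STerm) :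
    t ∈ (Fml.bigAnd l).bases ↔ ∃ φ ∈ l, t ∈ φ.bases := by
  induction l with
  | nil => simp [Fml.bigAnd, Fml.bases]
  | cons φ l ih =>
    simp only [Fml.bigAnd, List.foldr_cons, Fml.bases, List.mem_append, List.mem_cons,
      exists_eq_or_imp] at ih ⊢
    rw [ih]

@[simp] theorem Fml.mem_bases_bigOr (l : List Fml) (t : STerm) :
    t ∈ (Fml.bigOr l).bases ↔ ∃ φ ∈ l, t ∈ φ.bases := by
  induction l with
  | nil => simp [Fml.bigOr, Fml.bases]
  | cons φ l ih =>
    simp only [Fml.bigOr, List.foldr_cons, Fml.bases, List.mem_append, List.mem_cons,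
      exists_eq_or_imp] at ih ⊢
    rw [ih]

/-! ## Sorts of terms -/

theorem STerm.ty_app_iff {D : Schema} {r j : ℕ} {t : STerm} {τ : Ty} :
    (STerm.app r j t).ty D = some τ ↔
      ∃ R, D.cat[r]? = some R ∧ t.ty D = some (.ident R.idTy) ∧ R.attrs[j]? = some τ := by
  simp only [STerm.ty, Option.bind_eq_some_iff]
  constructor
  · rintro ⟨R, hR, h⟩
    split_ifs at h with h'
    exact ⟨R, hR, h', h⟩
  · rintro ⟨R, hR, h', h⟩
    exact ⟨R, hR, by rw [if_pos h', h]⟩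

theorem TModel.sort_eval {D : Schema} (A : TModel D) {α : SVar → A.U} (hα : A.Sorted α)
    {t : STerm} {τ : Ty} (ht : t.ty D = some τ) : A.sort τ (A.eval α t) := by
  induction t generalizing τ with
  | var x =>
    simp only [STerm.ty, Option.some.injEq] at ht
    exact ht ▸ hα x
  | const σ c =>
    cases c with
    | none =>
      simp only [STerm.ty, Option.some.injEq] at ht
      exact ht ▸ A.undef_sort σ
    | some k =>
      simp only [STerm.ty] at ht
      split_ifs at ht with h
      simp only [Option.some.injEq] at ht
      exact ht ▸ A.cst_sort σ k h
  | app r j t ih =>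
    obtain ⟨R, hR, h', h⟩ := STerm.ty_app_iff.1 ht
    exact A.fn_sort r j R τ _ hR h (ih h')

theorem TModel.eval_congr {D : Schema} (A : TModel D) {α β : SVar → A.U} {t : STerm}
    (h : ∀ x, t.base = .var x → α x = β x) : A.eval α t = A.eval β t := by
  induction t with
  | var x => exact h x rfl
  | const τ c => cases c <;> rfl
  | app r j t ih =>
    simp only [TModel.eval]
    rw [ih h]

theorem STerm.base_base (t : STerm) : t.base.base = t.base := by
  induction t with
  | app r j t ih => exact ih
  | _ => rfl

theorem STerm.base_ty_isSome {D : Schema} {t : STerm} (h : (t.ty D).isSome) :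
    (t.base.ty D).isSome := by
  induction t with
  | app r j t ih =>
    obtain ⟨τ, hτ⟩ := Option.isSome_iff_exists.1 h
    obtain ⟨R, hR, h', h⟩ := STerm.ty_app_iff.1 hτ
    exact ih (by simp [h'])
  | _ => exact h

theorem Fml.bases_isSome {D : Schema} {φ : Fml} (hφ : φ.WF D) :
    ∀ t ∈ φ.bases, t.base = t ∧ (t.ty D).isSome := by
  induction φ with
  | tru => simp [Fml.bases]
  | fls => simp [Fml.bases]
  | eq a b =>
    obtain ⟨τ, ha, hb⟩ := hφ
    simp only [Fml.bases, List.mem_cons, List.not_mem_nil, or_false]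
    rintro t (rfl | rfl)
    · exact ⟨a.base_base, STerm.base_ty_isSome (by simp [ha])⟩
    · exact ⟨b.base_base, STerm.base_ty_isSome (by simp [hb])⟩
  | neg φ ih => exact ih hφ
  | and φ ψ ih₁ ih₂ =>
    intro t ht
    rcases List.mem_append.1 ht with h | h
    exacts [ih₁ hφ.1 t h, ih₂ hφ.2 t h]
  | or φ ψ ih₁ ih₂ =>
    intro t ht
    rcases List.mem_append.1 ht with h | h
    exacts [ih₁ hφ.1 t h, ih₂ hφ.2 t h]

theorem Schema.WF.cat_unique {D : Schema} (hD : D.WF) {r r' : ℕ} {R R' : CatRel}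
    (h : D.cat[r]? = some R) (h' : D.cat[r']? = some R') (he : R.idTy = R'.idTy) :
    r = r' ∧ R = R' := by
  obtain ⟨hr, hR⟩ := List.getElem?_eq_some_iff.1 h
  obtain ⟨hr', hR'⟩ := List.getElem?_eq_some_iff.1 h'
  have : r = r' := by
    refine (List.Nodup.getElem_inj_iff hD.keys_nodup (hi := by simpa) (hj := by simpa)).1 ?_
    simp [hR, hR', he]
  subst this
  exact ⟨rfl, by simpa [h] using h'⟩

theorem Schema.isCatId_iff {D : Schema} {s : ℕ} :
    D.isCatId s = true ↔ ∃ (r : ℕ) (R : CatRel), D.cat[r]? = some R ∧ R.idTy = s := by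
  simp only [Schema.isCatId, List.any_eq_true, beq_iff_eq]
  constructor
  · rintro ⟨R, hR, rfl⟩
    obtain ⟨r, hr⟩ := List.mem_iff_getElem?.1 hR
    exact ⟨r, R, hr, rfl⟩
  · rintro ⟨r, R, hr, rfl⟩
    exact ⟨R, List.mem_of_getElem? hr, rfl⟩

/-! ## Consequences of acyclicity -/

theorem Schema.edge_path {D : Schema} {r r' j : ℕ} {R R' : CatRel} (hr : D.cat[r]? = some R)
    (hr' : D.cat[r']? = some R') (hj : R.attrs[j]? = some (.ident R'.idTy)) :
    Relation.TransGen D.Edge (r, 0) (r', 0) := by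
  have h₁ : D.typeAt (r, j + 1) = some (.ident R'.idTy) := by
    simp [Schema.typeAt, hr, CatRel.row, hj]
  have h₂ : D.typeAt (r', 0) = some (.ident R'.idTy) := by
    simp [Schema.typeAt, hr', CatRel.row]
  have h₃ : D.typeAt (r, 0) = some (.ident R.idTy) := by
    simp [Schema.typeAt, hr, CatRel.row]
  refine .tail (.single (b := (r, j + 1)) ?_) ?_
  · exact ⟨by simp [h₃], by simp [h₁], .inl ⟨rfl, by simp, rfl⟩⟩
  · exact ⟨by simp [h₁], by simp [h₂], .inr ⟨rfl, by simp, by rw [h₁, h₂]⟩⟩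

/-- The first type is that of a non-key attribute of the relation whose id type is the second. -/
def Schema.SubTy (D : Schema) (τ' τ : Ty) : Prop :=
  ∃ (r : ℕ) (R : CatRel), D.cat[r]? = some R ∧ τ = .ident R.idTy ∧ τ' ∈ R.attrs

theorem Schema.Acyclic.wellFounded_subTy {D : Schema} (h : D.Acyclic) (hD : D.WF) :
    WellFounded D.SubTy := by
  let lt : Fin D.cat.length → Fin D.cat.length → Prop := fun a b =>
    Relation.TransGen D.Edge (b.1, 0) (a.1, 0)
  have : IsTrans _ lt := ⟨fun a b c h₁ h₂ => h₂.trans h₁⟩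
  have : Std.Irrefl lt := ⟨fun a => h _⟩
  have wf : WellFounded lt := Finite.wellFounded_of_trans_of_irrefl lt
  have base : ∀ τ, (∀ (r : ℕ) (R : CatRel), D.cat[r]? = some R → τ ≠ .ident R.idTy) → Acc D.SubTy τ :=
    fun τ hτ => ⟨_, fun τ' ⟨r, R, hR, he, _⟩ => absurd he (hτ r R hR)⟩
  have key : ∀ (a : Fin D.cat.length) (R : CatRel), D.cat[a.1]? = some R →
      Acc D.SubTy (.ident R.idTy) := by
    intro a
    induction a using wf.induction with
    | _ a ih =>
      refine fun R hR => ⟨_, fun τ ⟨r₁, R₁, hR₁, he, hτ⟩ => ?_⟩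
      obtain ⟨rfl, rfl⟩ := hD.cat_unique hR hR₁ (by simpa using he)
      by_cases hc : ∃ (r' : ℕ) (R' : CatRel), D.cat[r']? = some R' ∧ τ = .ident R'.idTy
      · obtain ⟨r', R', hR', rfl⟩ := hc
        obtain ⟨j, hj⟩ := List.mem_iff_getElem?.1 hτ
        exact ih ⟨r', (List.getElem?_eq_some_iff.1 hR').1⟩ (Schema.edge_path hR hR' hj) R' hR'
      · push Not at hc
        exact base τ hc
  refine ⟨fun τ => ?_⟩
  by_cases hc : ∃ (r' : ℕ) (R' : CatRel), D.cat[r']? = some R' ∧ τ = .ident R'.idTy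
  · obtain ⟨r', R', hR', rfl⟩ := hc
    exact key ⟨r', (List.getElem?_eq_some_iff.1 hR').1⟩ R' hR'
  · push Not at hc
    exact base τ hc

/-- A recursive specification along a well-founded relation has a solution. -/
theorem exists_eq_step {α β : Type*} [Inhabited β] {rel : α → α → Prop} (wf : WellFounded rel)
    (step : (α → β) → α → β)
    (hstep : ∀ f g a, (∀ b, rel b a → f b = g b) → step f a = step g a) :
    ∃ f : α → β, ∀ a, f a = step f a := by
  classical
  refine ⟨wf.fix fun a rec => step (fun b => if h : rel b a then rec b h else default) a,
    fun a => ?_⟩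
  rw [wf.fix_eq]
  exact hstep _ _ _ fun b hb => by simp [hb]

/-- The relations whose attributes are applied in a term, outermost first. -/
def STerm.rels : STerm → List ℕ
  | .app r _ t => r :: t.rels
  | _ => []

theorem STerm.rels_path {D : Schema} {r j : ℕ} {t : STerm}
    (h : ((STerm.app r j t).ty D).isSome) :
    ∀ r' ∈ t.rels, Relation.TransGen D.Edge (r', 0) (r, 0) := by
  induction t generalizing r j with
  | var x => simp [STerm.rels]
  | const τ c => simp [STerm.rels]
  | app r₁ j₁ t ih =>
    obtain ⟨τ, hτ⟩ := Option.isSome_iff_exists.1 h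
    obtain ⟨R, hR, h', -⟩ := STerm.ty_app_iff.1 hτ
    obtain ⟨R₁, hR₁, h₁, hj₁⟩ := STerm.ty_app_iff.1 h'
    have hp := Schema.edge_path hR₁ hR hj₁
    intro r' hr'
    rcases List.mem_cons.1 hr' with rfl | hr'
    · exact hp
    · exact (ih (Option.isSome_of_eq_some h') r' hr').trans hp

theorem STerm.length_rels_le {D : Schema} (h : D.Acyclic) {t : STerm} (ht : (t.ty D).isSome) :
    t.rels.length ≤ D.cat.length := by
  have key : t.rels.Nodup ∧ ∀ r ∈ t.rels, r < D.cat.length := by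
    induction t with
    | var x => simp [STerm.rels]
    | const τ c => simp [STerm.rels]
    | app r j t ih =>
      have hp := STerm.rels_path ht
      obtain ⟨τ, hτ⟩ := Option.isSome_iff_exists.1 ht
      obtain ⟨R, hR, h', -⟩ := STerm.ty_app_iff.1 hτ
      obtain ⟨h₁, h₂⟩ := ih (by simp [h'])
      refine ⟨List.nodup_cons.2 ⟨fun hm => h _ (hp r hm), h₁⟩, ?_⟩
      intro r' hr'
      rcases List.mem_cons.1 hr' with rfl | hr'
      exacts [(List.getElem?_eq_some_iff.1 hR).1, h₂ r' hr']
  calc t.rels.length = t.rels.toFinset.card := (List.toFinset_card_of_nodup key.1).symm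
    _ ≤ (Finset.range D.cat.length).card :=
      Finset.card_le_card fun r hr => Finset.mem_range.2 (key.2 r (List.mem_toFinset.1 hr))
    _ = D.cat.length := Finset.card_range _

theorem STerm.mem_children {D : Schema} {t u : STerm} :
    u ∈ t.children D ↔ ∃ r j, u = .app r j t ∧ (u.ty D).isSome := by
  simp only [STerm.children, List.mem_flatMap, Prod.exists, List.mk_mem_zipIdx_iff_getElem?]
  constructor
  · rintro ⟨R, r, hR, h⟩
    by_cases h' : t.ty D = some (.ident R.idTy)
    swap
    · simp [h'] at h
    rw [if_pos h'] at h
    obtain ⟨j, hj, rfl⟩ := List.mem_map.1 h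
    refine ⟨r, j, rfl, ?_⟩
    have : (STerm.app r j t).ty D = some (R.attrs[j]'(List.mem_range.1 hj)) :=
      STerm.ty_app_iff.2 ⟨R, hR, h', List.getElem?_eq_getElem _⟩
    simp [this]
  · rintro ⟨r, j, rfl, h⟩
    obtain ⟨τ, hτ⟩ := Option.isSome_iff_exists.1 h
    obtain ⟨R, hR, h', hj⟩ := STerm.ty_app_iff.1 hτ
    refine ⟨R, r, hR, ?_⟩
    rw [if_pos h']
    exact List.mem_map.2 ⟨j, List.mem_range.2 (List.getElem?_eq_some_iff.1 hj).1, rfl⟩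

theorem subset_closeTerms {D : Schema} (d : ℕ) (ts : List STerm) : ts ⊆ closeTerms D d ts := by
  cases d with
  | zero => exact List.Subset.refl _
  | succ d => exact List.subset_append_left _ _

theorem app_mem_closeTerms {D : Schema} {d r j : ℕ} {ts : List STerm} {t : STerm}
    (ht : t ∈ closeTerms D d ts) (h : ((STerm.app r j t).ty D).isSome) :
    STerm.app r j t ∈ closeTerms D (d + 1) ts := by
  induction d generalizing ts with
  | zero =>
    exact List.mem_append_right _ (List.mem_flatMap.2 ⟨t, ht, STerm.mem_children.2 ⟨r, j, rfl, h⟩⟩)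
  | succ d ih =>
    refine List.mem_append_right _ ?_
    rcases List.mem_append.1 ht with ht | ht
    · exact subset_closeTerms _ _
        (List.mem_flatMap.2 ⟨t, ht, STerm.mem_children.2 ⟨r, j, rfl, h⟩⟩)
    · exact ih ht

theorem closeTerms_mono {D : Schema} {d e : ℕ} (h : d ≤ e) (ts : List STerm) :
    closeTerms D d ts ⊆ closeTerms D e ts := by
  induction d generalizing e ts with
  | zero => exact subset_closeTerms e ts
  | succ d ih =>
    obtain ⟨e, rfl⟩ : ∃ e', e = e' + 1 := ⟨e - 1, by omega⟩
    exact List.append_subset.2 ⟨List.subset_append_left _ _,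
      List.Subset.trans (ih (by omega) _) (List.subset_append_right _ _)⟩

/-- The well-sorted terms over the variables and constants in `X`. -/
def termsOver (D : Schema) (X : Set STerm) : Set STerm := {t | t.base ∈ X ∧ (t.ty D).isSome}

theorem termsOver.app {D : Schema} {X : Set STerm} {r j : ℕ} {R : CatRel} {τ : Ty} {t : STerm}
    (ht : t ∈ termsOver D X) (hR : D.cat[r]? = some R) (hj : R.attrs[j]? = some τ)
    (h : t.ty D = some (.ident R.idTy)) : STerm.app r j t ∈ termsOver D X :=
  ⟨ht.1, by rw [STerm.ty_app_iff.2 ⟨R, hR, h, hj⟩]; rfl⟩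

theorem mem_closeTerms_of_mem_termsOver {D : Schema} (h : D.Acyclic) {X : List STerm} {t : STerm}
    (ht : t ∈ termsOver D {t | t ∈ X}) : t ∈ closeTerms D D.cat.length X := by
  refine closeTerms_mono (STerm.length_rels_le h ht.2) X ?_
  obtain ⟨hb, hs⟩ := ht
  induction t with
  | var x => exact hb
  | const τ c => exact hb
  | app r j t ih =>
    refine app_mem_closeTerms (ih hb ?_) hs
    obtain ⟨τ, hτ⟩ := Option.isSome_iff_exists.1 hs
    obtain ⟨R, hR, h', hj⟩ := STerm.ty_app_iff.1 hτ
    simp [h']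

theorem termsOver_finite {D : Schema} (h : D.Acyclic) {X : Set STerm} (hX : X.Finite) :
    (termsOver D X).Finite := by
  refine ((closeTerms D D.cat.length hX.toFinset.toList).finite_toSet).subset fun t ht =>
    mem_closeTerms_of_mem_termsOver h ?_
  simpa [termsOver] using ht

theorem closeTerms_sound {D : Schema} {d : ℕ} {ts : List STerm} (hts : ∀ t ∈ ts, (t.ty D).isSome) :
    ∀ t ∈ closeTerms D d ts, (t.ty D).isSome ∧ ∃ u ∈ ts, t.base = u.base := by
  induction d generalizing ts with
  | zero => exact fun t ht => ⟨hts t ht, t, ht, rfl⟩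
  | succ d ih =>
    intro t ht
    rcases List.mem_append.1 ht with ht | ht
    · exact ⟨hts t ht, t, ht, rfl⟩
    · obtain ⟨h₁, u, hu, h₂⟩ := ih (fun u hu => by
        obtain ⟨v, hv, hu⟩ := List.mem_flatMap.1 hu
        obtain ⟨r, j, rfl, h⟩ := STerm.mem_children.1 hu
        exact h) t ht
      obtain ⟨v, hv, hu⟩ := List.mem_flatMap.1 hu
      obtain ⟨r, j, rfl, h⟩ := STerm.mem_children.1 hu
      exact ⟨h₁, v, hv, h₂⟩

/-- The variables and constants of `φ` and the declared id constants. -/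
def basesWithIds (D : Schema) (φ : Fml) : List STerm :=
  φ.bases ++ D.idConsts.map fun p => STerm.const (.ident p.1) (some p.2)

theorem constOk_idConsts {D : Schema} {p : ℕ × ℕ} (hp : p ∈ D.idConsts) :
    D.constOk (.ident p.1) p.2 = true := by
  simp [Schema.constOk, hp]

theorem basesWithIds_isSome {D : Schema} {φ : Fml} (hφ : φ.WF D) :
    ∀ t ∈ basesWithIds D φ, t.base = t ∧ (t.ty D).isSome := by
  intro t ht
  rcases List.mem_append.1 ht with ht | ht
  · exact Fml.bases_isSome hφ t ht
  · obtain ⟨p, hp, rfl⟩ := List.mem_map.1 ht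
    exact ⟨rfl, by simp [STerm.ty, constOk_idConsts hp]⟩

theorem mem_termsOf {D : Schema} (h : D.Acyclic) {φ : Fml} (hφ : φ.WF D) {t : STerm} :
    t ∈ termsOf D φ ↔ t ∈ termsOver D {t | t ∈ basesWithIds D φ} := by
  have hb : ∀ t, t ∈ (basesWithIds D φ).dedup ↔ t ∈ basesWithIds D φ := fun t => List.mem_dedup
  rw [termsOf, List.mem_dedup]
  constructor
  · intro ht
    obtain ⟨h₁, u, hu, h₂⟩ := closeTerms_sound (ts := (basesWithIds D φ).dedup) (fun u hu =>
      (basesWithIds_isSome hφ u ((hb u).1 hu)).2) t ht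
    refine ⟨?_, h₁⟩
    rw [hb] at hu
    rw [h₂, (basesWithIds_isSome hφ u hu).1]
    exact hu
  · intro ht
    refine mem_closeTerms_of_mem_termsOver (X := (basesWithIds D φ).dedup) h ?_
    simpa [termsOver] using ht

/-! ## Existentially closed extensions -/

/-- The elements of the free extension of a structure: its own elements, new atomic objects, and
new tuples of a catalog relation, given by their attributes and a copy number. -/
inductive Ext (U : Type) : Type
  | old (u : U)
  | new (τ : Ty) (n : ℕ)
  | node (r : ℕ) (args : List (Ext U)) (n : ℕ)

/-- The copy number of a new element. -/
def Ext.copy {U : Type} : Ext U → ℕ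
  | .old _ => 0
  | .new _ n => n
  | .node _ _ n => n

/-- Types that may be extended by new atomic objects. -/
def Schema.OpenTy (D : Schema) : Ty → Prop
  | .enum _ _ => False
  | .prim _ => True
  | .ident s => D.isCatId s = false

/-- Well-sorted elements of the free extension. -/
inductive ExtSort {D : Schema} (A : TModel D) : Ty → Ext A.U → Prop
  | old (τ : Ty) (u : A.U) (h : A.sort τ u) : ExtSort A τ (.old u)
  | new (τ : Ty) (n : ℕ) (h : D.OpenTy τ) : ExtSort A τ (.new τ n)
  | node (r : ℕ) (R : CatRel) (args : List (Ext A.U)) (n : ℕ) (hR : D.cat[r]? = some R)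
      (hlen : args.length = R.attrs.length)
      (hargs : ∀ (j : ℕ) (τ : Ty) (a : Ext A.U), R.attrs[j]? = some τ → args[j]? = some a →
        ExtSort A τ a)
      (hne : ∀ (j : ℕ) (τ : Ty) (a : Ext A.U), R.attrs[j]? = some τ → args[j]? = some a →
        a ≠ .old (A.undef τ)) : ExtSort A (.ident R.idTy) (.node r args n)

def extFn {D : Schema} (A : TModel D) (r j : ℕ) : Ext A.U → Ext A.U
  | .old u => .old (A.fn r j u)
  | .new τ n => .new τ n
  | .node _ args _ => args.getD j (.old (A.undef lifeTy))

theorem Schema.OpenTy.not_cat {D : Schema} {r : ℕ} {R : CatRel} (hR : D.cat[r]? = some R) :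
    ¬ D.OpenTy (.ident R.idTy) := fun h => by
  have := Schema.isCatId_iff.2 ⟨r, R, hR, rfl⟩
  simp_all [Schema.OpenTy]

theorem extSort_old {D : Schema} {A : TModel D} {τ : Ty} {u : A.U}
    (h : ExtSort A τ (.old u)) : A.sort τ u := by
  cases h with | old _ _ h => exact h

theorem not_extSort_new {D : Schema} {A : TModel D} {σ : Ty} {r n : ℕ} {R : CatRel}
    (hR : D.cat[r]? = some R) : ¬ ExtSort A (.ident R.idTy) (.new σ n) := by
  intro h
  generalize hτ : Ty.ident R.idTy = τ at h
  cases h with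
  | new _ _ h => exact Schema.OpenTy.not_cat hR (hτ ▸ h)

theorem extFn_node {D : Schema} (hD : D.WF) {A : TModel D} {r r' j n : ℕ} {R : CatRel} {τ : Ty}
    {args : List (Ext A.U)} (hR : D.cat[r]? = some R) (hj : R.attrs[j]? = some τ)
    (h : ExtSort A (.ident R.idTy) (.node r' args n)) :
    ExtSort A τ (extFn A r j (.node r' args n)) ∧
      extFn A r j (.node r' args n) ≠ .old (A.undef τ) := by
  generalize hσ : Ty.ident R.idTy = σ at h
  cases h with
  | node _ R' _ _ hR' hlen hargs hne =>
    obtain ⟨rfl, rfl⟩ := hD.cat_unique hR hR' (by simpa using hσ)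
    have hlt : j < args.length := hlen ▸ (List.getElem?_eq_some_iff.1 hj).1
    have he : args[j]? = some (extFn A r j (.node r args n)) := by
      simp [extFn, hlt]
    exact ⟨hargs j τ _ hj he, hne j τ _ hj he⟩

/-- The free extension of a model of the DB theory. -/
abbrev TModel.ext {D : Schema} (hD : D.WF) (A : TModel D) : TModel D where
  U := Ext A.U
  sort := ExtSort A
  undef τ := .old (A.undef τ)
  cst τ k := .old (A.cst τ k)
  fn := extFn A
  undef_sort τ := .old _ _ (A.undef_sort τ)
  cst_sort τ k h := .old _ _ (A.cst_sort τ k h)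
  fn_sort := by
    intro r j R τ u hR hj hu
    cases u with
    | old u => exact .old _ _ (A.fn_sort r j R τ u hR hj (extSort_old hu))
    | new σ n => exact absurd hu (not_extSort_new hR)
    | node r' args n => exact (extFn_node hD hR hj hu).1
  fn_undef := by
    intro r j R τ u hR hj hu
    cases u with
    | old u =>
      have := A.fn_undef r j R τ u hR hj (extSort_old hu)
      simpa [extFn] using this
    | new σ n => exact absurd hu (not_extSort_new hR)
    | node r' args n => simpa using (extFn_node hD hR hj hu).2
  cst_ne_undef τ k h := by simpa using A.cst_ne_undef τ k h
  cst_inj τ k l hk hl h := A.cst_inj τ k l hk hl (by simpa using h)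
  enum_cases := by
    intro a n u hu
    cases hu with
    | old _ u h => simpa using A.enum_cases a n u h
    | new _ _ h => exact absurd h (by simp [Schema.OpenTy])

theorem TModel.embeds_ext {D : Schema} (hD : D.WF) (A : TModel D) :
    A.Embeds (A.ext hD) Ext.old where
  sort τ u h := .old τ u h
  inj _ _ _ _ _ h := Ext.old.inj h
  undef _ := rfl
  cst _ _ _ := rfl
  fn _ _ _ _ _ _ _ _ := rfl

theorem exists_copy_numbers {X U : Type*} {P : Set X} (hP : P.Finite) (k : X → Option U)
    (copy : U → ℕ) : ∃ c : X → ℕ, Set.InjOn c P ∧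
      ∀ p ∈ P, ∀ q ∈ P, ∀ e, k p = some e → copy e ≠ c q := by
  obtain ⟨f, hf⟩ := Set.countable_iff_exists_injOn.1 hP.countable
  obtain ⟨N, hN⟩ := (hP.image fun p => ((k p).map copy).getD 0).bddAbove
  refine ⟨fun x => N + 1 + f x, fun x hx y hy h => hf hx hy (by simpa using h), ?_⟩
  intro p hp q hq e he
  have : copy e ≤ N := hN ⟨p, hp, by simp [he]⟩
  dsimp only
  omega

/-- A finite partial structure, part of which is identified with elements of a free extension by
`k`, can be mapped injectively into the free extension. -/
theorem exists_amalgam {D : Schema} (hD : D.WF) (hac : D.Acyclic) (A : TModel D) {X : Type}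
    {P : Set (Ty × X)} (hP : P.Finite) (nx : ℕ → ℕ → X → X) (k : Ty → X → Option (Ext A.U))
    (hcl : ∀ (r : ℕ) (R : CatRel) (j : ℕ) (τ : Ty) (x : X), D.cat[r]? = some R →
      R.attrs[j]? = some τ → (.ident R.idTy, x) ∈ P → (τ, nx r j x) ∈ P)
    (ksort : ∀ τ x e, (τ, x) ∈ P → k τ x = some e → ExtSort A τ e)
    (kinj : ∀ τ x y e, (τ, x) ∈ P → (τ, y) ∈ P → k τ x = some e → k τ y = some e → x = y)
    (kfn : ∀ (r : ℕ) (R : CatRel) (j : ℕ) (τ : Ty) (x : X) (e : Ext A.U), D.cat[r]? = some R →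
      R.attrs[j]? = some τ → (.ident R.idTy, x) ∈ P → k (.ident R.idTy) x = some e →
      k τ (nx r j x) = some (extFn A r j e))
    (kenum : ∀ a n x, (.enum a n, x) ∈ P → k (.enum a n) x ≠ none)
    (kundef : ∀ (r : ℕ) (R : CatRel) (j : ℕ) (τ : Ty) (x : X), D.cat[r]? = some R →
      R.attrs[j]? = some τ → (.ident R.idTy, x) ∈ P → k (.ident R.idTy) x = none →
      k τ (nx r j x) ≠ some (.old (A.undef τ))) :
    ∃ G : Ty → X → Ext A.U,
      (∀ τ x e, k τ x = some e → G τ x = e) ∧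
      (∀ τ x, (τ, x) ∈ P → ExtSort A τ (G τ x)) ∧
      (∀ τ x y, (τ, x) ∈ P → (τ, y) ∈ P → G τ x = G τ y → x = y) ∧
      (∀ (r : ℕ) (R : CatRel) (j : ℕ) (τ : Ty) (x : X), D.cat[r]? = some R →
        R.attrs[j]? = some τ → (.ident R.idTy, x) ∈ P →
        G τ (nx r j x) = extFn A r j (G (.ident R.idTy) x)) := by
  classical
  obtain ⟨c, hc, hcopy⟩ := exists_copy_numbers hP (fun p => k p.1 p.2) Ext.copy
  have wf := hac.wellFounded_subTy hD
  let step : (Ty → X → Ext A.U) → Ty → X → Ext A.U := fun G τ x =>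
    match k τ x with
    | some e => e
    | none =>
      if h : ∃ q : ℕ × CatRel, D.cat[q.1]? = some q.2 ∧ τ = .ident q.2.idTy then
        .node h.choose.1 (h.choose.2.attrs.zipIdx.map fun p => G p.1 (nx h.choose.1 p.2 x))
          (c (τ, x))
      else .new τ (c (τ, x))
  have : Inhabited (X → Ext A.U) := ⟨fun _ => .old (A.undef lifeTy)⟩
  obtain ⟨G, hG⟩ := exists_eq_step wf step (by
    intro f g τ hfg
    funext x
    simp only [step]
    cases k τ x with
    | some e => rfl
    | none =>
      dsimp only
      split_ifs with h
      · congr 1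
        refine List.map_congr_left fun p hp => ?_
        rw [hfg]
        exact ⟨_, _, h.choose_spec.1, h.choose_spec.2, List.fst_mem_of_mem_zipIdx hp⟩
      · rfl)
  have hknown : ∀ τ x e, k τ x = some e → G τ x = e := by
    intro τ x e he
    rw [hG]
    simp [step, he]
  have hnode : ∀ (r : ℕ) (R : CatRel) (x : X), D.cat[r]? = some R → k (.ident R.idTy) x = none →
      G (.ident R.idTy) x = .node r (R.attrs.zipIdx.map fun p => G p.1 (nx r p.2 x))
        (c (.ident R.idTy, x)) := by
    intro r R x hR hk
    have h : ∃ q : ℕ × CatRel, D.cat[q.1]? = some q.2 ∧ Ty.ident R.idTy = .ident q.2.idTy :=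
      ⟨(r, R), hR, rfl⟩
    obtain ⟨h₁, h₂⟩ := hD.cat_unique h.choose_spec.1 hR (by simpa using h.choose_spec.2.symm)
    conv_lhs => rw [hG]
    simp only [step, hk, dif_pos h, h₁, h₂]
  have hnew : ∀ τ x, (∀ (r : ℕ) (R : CatRel), D.cat[r]? = some R → τ ≠ .ident R.idTy) →
      k τ x = none → G τ x = .new τ (c (τ, x)) := by
    intro τ x h hk
    conv_lhs => rw [hG]
    simp only [step, hk]
    rw [dif_neg]
    rintro ⟨q, hq, h'⟩
    exact h q.1 q.2 hq h'
  have hcat : ∀ τ : Ty, (∃ (r : ℕ) (R : CatRel), D.cat[r]? = some R ∧ τ = .ident R.idTy) ∨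
      (∀ (r : ℕ) (R : CatRel), D.cat[r]? = some R → τ ≠ .ident R.idTy) := by
    intro τ
    by_cases h : ∃ (r : ℕ) (R : CatRel), D.cat[r]? = some R ∧ τ = .ident R.idTy
    · exact .inl h
    · push Not at h
      exact .inr h
  have hunknown : ∀ τ x, k τ x = none → (G τ x).copy = c (τ, x) ∧ ∀ u, G τ x ≠ .old u := by
    intro τ x hk
    rcases hcat τ with ⟨r, R, hR, rfl⟩ | h
    · rw [hnode r R x hR hk]
      exact ⟨rfl, by simp⟩
    · rw [hnew τ x h hk]
      exact ⟨rfl, by simp⟩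
  refine ⟨G, hknown, ?_, ?_, ?_⟩
  · intro τ
    induction τ using wf.induction with
    | _ τ ih =>
      intro x hx
      cases hk : k τ x with
      | some e =>
        rw [hknown τ x e hk]
        exact ksort τ x e hx hk
      | none =>
        rcases hcat τ with ⟨r, R, hR, rfl⟩ | h
        · rw [hnode r R x hR hk]
          have harg : ∀ (j : ℕ) (σ : Ty) (a : Ext A.U), R.attrs[j]? = some σ →
              (R.attrs.zipIdx.map fun p => G p.1 (nx r p.2 x))[j]? = some a →
              a = G σ (nx r j x) := by
            intro j σ a hj ha
            simpa [hj, eq_comm] using ha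
          refine .node r R _ _ hR (by simp) ?_ ?_
          · intro j σ a hj ha
            rw [harg j σ a hj ha]
            exact ih σ ⟨r, R, hR, rfl, List.mem_of_getElem? hj⟩ _ (hcl r R j σ x hR hj hx)
          · intro j σ a hj ha
            rw [harg j σ a hj ha]
            cases hk' : k σ (nx r j x) with
            | some e =>
              rw [hknown _ _ _ hk']
              rintro rfl
              exact kundef r R j σ x hR hj hx hk hk'
            | none => exact (hunknown _ _ hk').2 _
        · rw [hnew τ x h hk]
          refine .new _ _ ?_
          cases τ with
          | enum a n => exact kenum a n x hx hk
          | prim a => trivial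
          | ident s =>
            show D.isCatId s = false
            by_contra hs
            obtain ⟨r, R, hR, rfl⟩ := Schema.isCatId_iff.1 (by simpa using hs)
            exact h r R hR rfl
  · intro τ x y hx hy h
    cases hkx : k τ x with
    | some e =>
      cases hky : k τ y with
      | some e' =>
        rw [hknown _ _ _ hkx, hknown _ _ _ hky] at h
        exact kinj τ x y e hx hy hkx (h ▸ hky)
      | none =>
        rw [hknown _ _ _ hkx] at h
        exact absurd (h ▸ (hunknown _ _ hky).1) (hcopy _ hx _ hy e hkx)
    | none =>
      cases hky : k τ y with
      | some e' =>
        rw [hknown _ _ _ hky] at h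
        exact absurd (h ▸ (hunknown _ _ hkx).1) (hcopy _ hy _ hx e' hky)
      | none =>
        have h' : c (τ, x) = c (τ, y) := by
          rw [← (hunknown _ _ hkx).1, ← (hunknown _ _ hky).1, h]
        simpa using hc hx hy h'
  · intro r R j τ x hR hj hx
    cases hk : k (.ident R.idTy) x with
    | some e => rw [hknown _ _ _ hk, hknown _ _ _ (kfn r R j τ x e hR hj hx hk)]
    | none =>
      rw [hnode r R x hR hk]
      simp [extFn, hj]

/-- The sorted values of the terms over `X`. -/
def TModel.valuesOver {D : Schema} (A : TModel D) (α : SVar → A.U) (X : Set STerm) :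
    Set (Ty × A.U) :=
  {p | ∃ t ∈ termsOver D X, t.ty D = some p.1 ∧ A.eval α t = p.2}

theorem TModel.valuesOver_finite {D : Schema} (hac : D.Acyclic) (A : TModel D) (α : SVar → A.U)
    {X : Set STerm} (hX : X.Finite) : (A.valuesOver α X).Finite := by
  refine ((termsOver_finite hac hX).image fun t => ((t.ty D).getD lifeTy, A.eval α t)).subset ?_
  rintro ⟨τ, u⟩ ⟨t, ht, h₁, h₂⟩
  exact ⟨t, ht, by simp_all⟩

theorem TModel.valuesOver_fn {D : Schema} (A : TModel D) {α : SVar → A.U} {X : Set STerm}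
    {r j : ℕ} {R : CatRel} {τ : Ty} {u : A.U} (hR : D.cat[r]? = some R)
    (hj : R.attrs[j]? = some τ) (h : (.ident R.idTy, u) ∈ A.valuesOver α X) :
    (τ, A.fn r j u) ∈ A.valuesOver α X := by
  obtain ⟨t, ht, h₁, h₂⟩ := h
  refine ⟨.app r j t, termsOver.app ht hR hj h₁, STerm.ty_app_iff.2 ⟨R, hR, h₁, hj⟩, ?_⟩
  simp only at h₂
  simp [TModel.eval, h₂]

theorem TModel.valuesOver_sort {D : Schema} (A : TModel D) {α : SVar → A.U} (hα : A.Sorted α)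
    {X : Set STerm} {p : Ty × A.U} (h : p ∈ A.valuesOver α X) : A.sort p.1 p.2 := by
  obtain ⟨t, ht, h₁, h₂⟩ := h
  exact h₂ ▸ A.sort_eval hα h₁

theorem TModel.ext_exClosed {D : Schema} (hD : D.WF) (hac : D.Acyclic) (A : TModel D) :
    (A.ext hD).ExClosed := by
  classical
  intro B h hemb φ keep α β hφ hα hβ hkeep hsat
  let X : Set STerm := {t | t ∈ φ.bases}
  let k : Ty → B.U → Option (Ext A.U) := fun τ b =>
    if h' : ∃ e, (A.ext hD).sort τ e ∧ h e = b then some h'.choose else none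
  have hk : ∀ τ b e, k τ b = some e → (A.ext hD).sort τ e ∧ h e = b := by
    intro τ b e he
    by_cases h' : ∃ e, (A.ext hD).sort τ e ∧ h e = b
    · simp only [k, dif_pos h', Option.some.injEq] at he
      exact he ▸ h'.choose_spec
    · simp [k, dif_neg h'] at he
  have hk' : ∀ τ e, (A.ext hD).sort τ e → k τ (h e) = some e := by
    intro τ e he
    have h' : ∃ e', (A.ext hD).sort τ e' ∧ h e' = h e := ⟨e, he, rfl⟩
    simp only [k, dif_pos h', Option.some.injEq]
    exact hemb.inj τ _ _ h'.choose_spec.1 he h'.choose_spec.2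
  have hundef : ∀ τ, k τ (B.undef τ) = some ((A.ext hD).undef τ) := fun τ => by
    rw [← hemb.undef]
    exact hk' _ _ ((A.ext hD).undef_sort τ)
  have hcst : ∀ τ n, D.constOk τ n = true → k τ (B.cst τ n) = some ((A.ext hD).cst τ n) :=
    fun τ n hn => by
      rw [← hemb.cst τ n hn]
      exact hk' _ _ ((A.ext hD).cst_sort τ n hn)
  have hXfin : X.Finite := φ.bases.finite_toSet
  obtain ⟨G, hG₁, hG₂, hG₃, hG₄⟩ := exists_amalgam hD hac A
    (B.valuesOver_finite hac β hXfin) B.fn k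
    (fun r R j τ x hR hj hx => B.valuesOver_fn hR hj hx)
    (fun τ x e _ he => (hk τ x e he).1)
    (fun τ x y e _ _ hx hy => (hk τ x e hx).2.symm.trans (hk τ y e hy).2)
    (fun r R j τ x e hR hj hx he => by
      obtain ⟨h₁, rfl⟩ := hk _ _ _ he
      rw [← hemb.fn r j R τ e hR hj h₁]
      exact hk' _ _ ((A.ext hD).fn_sort r j R τ e hR hj h₁))
    (fun a n x hx => by
      rcases B.enum_cases a n x (B.valuesOver_sort hβ hx) with rfl | ⟨i, hi, rfl⟩
      · simp [hundef]
      · rw [hcst _ _ (by simpa [Schema.constOk, Ty.hasObj] using hi)]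
        simp)
    (fun r R j τ x hR hj hx hkx hkn => by
      have h₁ := (hk _ _ _ hkn).2
      have h₂ : B.fn r j x = B.undef τ := h₁.symm.trans (hemb.undef τ)
      rw [(B.fn_undef r j R τ x hR hj (B.valuesOver_sort hβ hx)).1 h₂, hundef] at hkx
      simp at hkx)
  let α' : SVar → (A.ext hD).U := fun x =>
    if (x.ty, β x) ∈ B.valuesOver β X then G x.ty (β x) else α x
  have heval : ∀ t ∈ termsOver D X, ∀ τ, t.ty D = some τ →
      (A.ext hD).eval α' t = G τ (B.eval β t) := by
    intro t ht τ hτ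
    induction t generalizing τ with
    | var x =>
      simp only [STerm.ty, Option.some.injEq] at hτ
      subst hτ
      have : (x.ty, β x) ∈ B.valuesOver β X := ⟨.var x, ht, rfl, rfl⟩
      simp [TModel.eval, α', this]
    | const σ n =>
      cases n with
      | none =>
        simp only [STerm.ty, Option.some.injEq] at hτ
        subst hτ
        exact (hG₁ _ _ _ (hundef _)).symm
      | some n =>
        simp only [STerm.ty] at hτ
        split_ifs at hτ with hn
        simp only [Option.some.injEq] at hτ
        subst hτ
        exact (hG₁ _ _ _ (hcst _ _ hn)).symm
    | app r j t ih =>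
      obtain ⟨R, hR, h', hj⟩ := STerm.ty_app_iff.1 hτ
      have ht' : t ∈ termsOver D X := ⟨ht.1, by simp [h']⟩
      simp only [TModel.eval]
      rw [hG₄ r R j τ _ hR hj ⟨t, ht', h', rfl⟩, ih ht' _ h']
  refine ⟨α', ?_, ?_, ?_⟩
  · intro x
    by_cases hx : (x.ty, β x) ∈ B.valuesOver β X
    · simpa [α', hx] using hG₂ _ _ hx
    · simpa [α', hx] using hα x
  · intro x hx
    by_cases hx' : (x.ty, β x) ∈ B.valuesOver β X
    · simp only [α', hx', if_true]
      refine hG₁ _ _ _ ?_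
      rw [hkeep x hx]
      exact hk' _ _ (hα x)
    · simp [α', hx']
  · rw [TModel.sat_iff_holds] at hsat ⊢
    refine (Fml.holds_congr hφ ?_).1 hsat
    intro a b τ ha hb ha' hb'
    have ha₁ : a ∈ termsOver D X := ⟨ha', by simp [ha]⟩
    have hb₁ : b ∈ termsOver D X := ⟨hb', by simp [hb]⟩
    rw [heval a ha₁ τ ha, heval b hb₁ τ hb]
    exact ⟨fun h => by rw [h], hG₃ _ _ _ ⟨a, ha₁, ha, rfl⟩ ⟨b, hb₁, hb, rfl⟩⟩

/-! ## Naming the elements of finite parts of a model -/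

theorem exists_injOn_lt {X : Type*} {F : Set X} (hF : F.Finite) {N : ℕ}
    (hN : hF.toFinset.card ≤ N) : ∃ g : X → ℕ, Set.InjOn g F ∧ ∀ x ∈ F, g x < N := by
  classical
  let e := hF.toFinset.equivFin
  refine ⟨fun x => if h : x ∈ hF.toFinset then (e ⟨x, h⟩).1 else 0, ?_, ?_⟩
  · intro x hx y hy h
    have hx' : x ∈ hF.toFinset := by simpa using hx
    have hy' : y ∈ hF.toFinset := by simpa using hy
    simp only [dif_pos hx', dif_pos hy'] at h
    simpa using e.injective (Fin.ext h)
  · intro x hx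
    have hx' : x ∈ hF.toFinset := by simpa using hx
    simp only [dif_pos hx']
    exact lt_of_lt_of_le (e ⟨x, hx'⟩).2 hN

theorem constOk_enum {D : Schema} {a n k : ℕ} (h : k < n) : D.constOk (.enum a n) k = true := by
  simpa [Schema.constOk, Ty.hasObj] using h

theorem hasObj_of_constOk {D : Schema} {τ : Ty} {k : ℕ} (h : D.constOk τ k = true) :
    τ.hasObj k = true := by
  cases τ <;> simp_all [Schema.constOk, Ty.hasObj]

/-- Proper objects of a type can be assigned to the elements of a finite part of a model,
respecting given constants; the objects below `b + N` suffice if the constants are below `b` and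
there are at most `N` elements. -/
theorem exists_object_names {D : Schema} (A : TModel D) {F : Set (Ty × A.U)}
    (hs : ∀ p ∈ F, A.sort p.1 p.2) {b N : ℕ} {g : Ty × A.U → ℕ} (hg : Set.InjOn g F)
    (hgN : ∀ p ∈ F, g p < N) (τ : Ty) (K : Set ℕ)
    (hK : ∀ k ∈ K, D.constOk τ k = true ∧ k < b) :
    ∃ f : A.U → ℕ,
      (∀ u v, (τ, u) ∈ F → (τ, v) ∈ F → u ≠ A.undef τ → v ≠ A.undef τ → f u = f v → u = v) ∧
      (∀ u, (τ, u) ∈ F → u ≠ A.undef τ → τ.hasObj (f u) = true ∧ f u < b + N) ∧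
      (∀ k ∈ K, f (A.cst τ k) = k) := by
  classical
  by_cases hτ : ∃ a n, τ = .enum a n ∧ n ≤ b + N
  · obtain ⟨a, n, rfl, hn⟩ := hτ
    let f : A.U → ℕ := fun u =>
      if h : ∃ k < n, u = A.cst (.enum a n) k then h.choose else 0
    have hf : ∀ u, (∃ k < n, u = A.cst (.enum a n) k) →
        f u < n ∧ u = A.cst (.enum a n) (f u) := by
      intro u h
      simp only [f, dif_pos h]
      exact h.choose_spec
    have hF : ∀ u, (.enum a n, u) ∈ F → u ≠ A.undef (.enum a n) →
        ∃ k < n, u = A.cst (.enum a n) k := fun u hu hne =>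
      (A.enum_cases a n u (hs _ hu)).resolve_left hne
    refine ⟨f, ?_, ?_, ?_⟩
    · intro u v hu hv hu' hv' h
      rw [(hf u (hF u hu hu')).2, (hf v (hF v hv hv')).2, h]
    · intro u hu hu'
      have := (hf u (hF u hu hu')).1
      exact ⟨by simpa [Ty.hasObj] using this, by omega⟩
    · intro k hk
      have hkn : k < n := by simpa [Ty.hasObj] using hasObj_of_constOk (hK k hk).1
      have h := hf _ ⟨k, hkn, rfl⟩
      exact (A.cst_inj _ _ _ (hK k hk).1 (constOk_enum h.1) h.2).symm
  · have hobj : ∀ k < b + N, τ.hasObj k = true := by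
      intro k hk
      cases τ with
      | enum a n =>
        have : ¬ n ≤ b + N := fun h => hτ ⟨a, n, rfl, h⟩
        simp only [Ty.hasObj, decide_eq_true_eq]
        omega
      | prim a => rfl
      | ident s => rfl
    let f : A.U → ℕ := fun u =>
      if h : ∃ k ∈ K, u = A.cst τ k then h.choose else b + g (τ, u)
    have hpos : ∀ u, (∃ k ∈ K, u = A.cst τ k) → f u ∈ K ∧ u = A.cst τ (f u) := by
      intro u h
      simp only [f, dif_pos h]
      exact h.choose_spec
    have hneg : ∀ u, (¬ ∃ k ∈ K, u = A.cst τ k) → f u = b + g (τ, u) := by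
      intro u h
      simp only [f, dif_neg h]
    refine ⟨f, ?_, ?_, ?_⟩
    · intro u v hu hv _ _ h
      by_cases hu' : ∃ k ∈ K, u = A.cst τ k <;> by_cases hv' : ∃ k ∈ K, v = A.cst τ k
      · rw [(hpos u hu').2, (hpos v hv').2, h]
      · have := (hK _ (hpos u hu').1).2
        rw [hneg v hv'] at h
        omega
      · have := (hK _ (hpos v hv').1).2
        rw [hneg u hu'] at h
        omega
      · rw [hneg u hu', hneg v hv'] at h
        simpa using hg hu hv (by omega)
    · intro u hu _
      have hlt : f u < b + N := by
        by_cases hu' : ∃ k ∈ K, u = A.cst τ k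
        · have := (hK _ (hpos u hu').1).2
          omega
        · have := hgN _ hu
          rw [hneg u hu']
          omega
      exact ⟨hobj _ hlt, hlt⟩
    · intro k hk
      have h := hpos (A.cst τ k) ⟨k, hk, rfl⟩
      exact (A.cst_inj _ _ _ (hK k hk).1 (hK _ h.1).1 h.2).symm

theorem exists_names {D : Schema} (A : TModel D) {F : Set (Ty × A.U)} (hF : F.Finite)
    (hs : ∀ p ∈ F, A.sort p.1 p.2) {b N : ℕ} (hN : hF.toFinset.card ≤ N) (K : Set (Ty × ℕ))
    (hK : ∀ p ∈ K, D.constOk p.1 p.2 = true ∧ p.2 < b) :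
    ∃ ν : Ty → A.U → Val,
      (∀ τ u, ν τ u = none ↔ u = A.undef τ) ∧
      (∀ τ u v, (τ, u) ∈ F → (τ, v) ∈ F → ν τ u = ν τ v → u = v) ∧
      (∀ τ u k, (τ, u) ∈ F → ν τ u = some k → τ.hasObj k = true ∧ k < b + N) ∧
      (∀ p ∈ K, ν p.1 (A.cst p.1 p.2) = some p.2) := by
  classical
  obtain ⟨g, hg, hgN⟩ := exists_injOn_lt hF hN
  choose f hf₁ hf₂ hf₃ using fun τ => exists_object_names A hs hg hgN τ {k | (τ, k) ∈ K}
    fun k hk => hK _ hk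
  have hnone : ∀ τ u, (if u = A.undef τ then none else some (f τ u)) = none ↔ u = A.undef τ := by
    intro τ u
    split_ifs with h <;> simp [h]
  refine ⟨fun τ u => if u = A.undef τ then none else some (f τ u), hnone, ?_, ?_, ?_⟩
  · intro τ u v hu hv h
    dsimp only at h
    by_cases hu' : u = A.undef τ
    · rw [hu', ((hnone τ v).1 (by rw [← h, if_pos hu']))]
    · by_cases hv' : v = A.undef τ
      · simp [hu', hv'] at h
      · simp only [hu', hv', if_false, Option.some.injEq] at h
        exact hf₁ τ u v hu hv hu' hv' h
  · intro τ u k hu h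
    by_cases hu' : u = A.undef τ
    · simp [hu'] at h
    · simp only [hu', if_false, Option.some.injEq] at h
      exact h ▸ hf₂ τ u hu hu'
  · intro p hp
    simp only [A.cst_ne_undef _ _ (hK p hp).1, if_false]
    rw [hf₃ p.1 p.2 hp]

/-! ## Catalog instances as models -/

/-- Sorts in the model given by a catalog instance. -/
def CatInst.Sort (D : Schema) (I : CatInst) : Ty → Val → Prop
  | _, none => True
  | .ident s, some k => D.isCatId s = true → I.HasKey D s k
  | τ, some k => τ.hasObj k = true

open Classical in
/-- Attributes of identifiers in a catalog instance. -/
noncomputable def CatInst.fn (I : CatInst) (r j : ℕ) (v : Val) : Val :=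
  if h : ∃ t ∈ I r, t.head? = some v then (h.choose[j + 1]?).getD none else none

theorem CatInst.Valid.row_eq {D : Schema} {I : CatInst} (hI : I.Valid D) {r : ℕ} {R : CatRel}
    (hR : D.cat[r]? = some R) {t : List Val} (ht : t ∈ I r) :
    ∃ k, t = some k :: (List.range R.attrs.length).map fun j => I.fn r j (some k) := by
  have htyped := hI.typed r R hR t ht
  obtain ⟨v, t', rfl⟩ : ∃ v t', t = v :: t' := by
    cases t with
    | nil => simp [CatRel.row] at htyped
    | cons v t' => exact ⟨v, t', rfl⟩
  simp only [CatRel.row, List.forall₂_cons] at htyped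
  obtain ⟨⟨k, rfl, -⟩, htl⟩ := htyped
  refine ⟨k, ?_⟩
  have h : ∃ t ∈ I r, t.head? = some (some k) := ⟨_, ht, rfl⟩
  have hc : h.choose = some k :: t' := hI.primary r _ h.choose_spec.1 _ ht h.choose_spec.2
  congr 1
  apply List.ext_getElem
  · simpa using htl.length_eq
  · intro i h₁ h₂
    simp [CatInst.fn, dif_pos h, hc, h₁]

theorem CatInst.Valid.row_mem {D : Schema} {I : CatInst} (hD : D.WF) (hI : I.Valid D) {r : ℕ}
    {R : CatRel} (hR : D.cat[r]? = some R) {k : ℕ} (hk : I.HasKey D R.idTy k) :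
    some k :: (List.range R.attrs.length).map (fun j => I.fn r j (some k)) ∈ I r := by
  obtain ⟨r', R', hR', he, t, ht, hh⟩ := hk
  obtain ⟨rfl, rfl⟩ := hD.cat_unique hR' hR he
  obtain ⟨k', hk'⟩ := hI.row_eq hR ht
  have : k' = k := by
    rw [hk'] at hh
    simpa using hh
  subst this
  exact hk' ▸ ht

theorem CatInst.Valid.fn_none {D : Schema} {I : CatInst} (hI : I.Valid D) {r : ℕ}
    {R : CatRel} (hR : D.cat[r]? = some R) (j : ℕ) : I.fn r j none = none := by
  rw [CatInst.fn, dif_neg]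
  rintro ⟨t, ht, h⟩
  obtain ⟨k, hk⟩ := hI.row_eq hR ht
  simp [hk] at h

theorem CatInst.sort_cat {D : Schema} {I : CatInst} {r : ℕ} {R : CatRel}
    (hR : D.cat[r]? = some R) {k : ℕ} (h : I.Sort D (.ident R.idTy) (some k)) :
    I.HasKey D R.idTy k :=
  h (Schema.isCatId_iff.2 ⟨r, R, hR, rfl⟩)

theorem CatInst.Valid.fn_some {D : Schema} {I : CatInst} (hD : D.WF) (hI : I.Valid D) {r j k : ℕ}
    {R : CatRel} {τ : Ty} (hR : D.cat[r]? = some R) (hj : R.attrs[j]? = some τ)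
    (hk : I.HasKey D R.idTy k) : ∃ l, I.fn r j (some k) = some l ∧ I.Sort D τ (some l) := by
  have hrow := hI.row_mem hD hR hk
  have hlt := (List.getElem?_eq_some_iff.1 hj).1
  have hτ : R.row[j + 1]? = some τ := by simpa [CatRel.row] using hj
  have hv : (some k :: (List.range R.attrs.length).map fun j => I.fn r j (some k))[j + 1]? =
      some (I.fn r j (some k)) := by
    simp [hlt]
  have htyped := hI.typed r R hR _ hrow
  obtain ⟨l, hl, hobj⟩ : ∃ l, I.fn r j (some k) = some l ∧ τ.hasObj l = true := by
    have := (List.forall₂_iff_get.1 htyped).2 (j + 1) (by simpa using hlt)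
      (by simpa [CatRel.row] using hlt)
    simp only [List.get_eq_getElem] at this
    rw [List.getElem?_eq_some_iff] at hτ hv
    rw [hτ.2, hv.2] at this
    exact this
  refine ⟨l, hl, ?_⟩
  cases τ with
  | ident s => exact fun _ => hI.foreign r R hR _ hrow (j + 1) s l hτ (by rw [hv, hl])
  | _ => exact hobj

/-- The model of the DB theory that is given by a catalog instance. -/
noncomputable abbrev CatInst.model {D : Schema} (hD : D.WF) (I : CatInst) (hI : I.Valid D) :
    TModel D where
  U := Val
  sort := I.Sort D
  undef _ := none
  cst _ k := some k
  fn := I.fn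
  undef_sort τ := by cases τ <;> trivial
  cst_sort τ k h := by
    cases τ with
    | ident s =>
      intro hs
      have : (s, k) ∈ D.idConsts := by simpa [Schema.constOk, hs] using h
      exact hI.consts _ this
    | _ => exact hasObj_of_constOk h
  fn_sort r j R τ u hR hj hu := by
    cases u with
    | none =>
      rw [hI.fn_none hR]
      cases τ <;> trivial
    | some k =>
      obtain ⟨l, hl, hs⟩ := hI.fn_some hD hR hj (CatInst.sort_cat hR hu)
      exact hl ▸ hs
  fn_undef r j R τ u hR hj hu := by
    cases u with
    | none => simp [hI.fn_none hR]
    | some k =>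
      obtain ⟨l, hl, hs⟩ := hI.fn_some hD hR hj (CatInst.sort_cat hR hu)
      simp [hl]
  cst_ne_undef _ _ _ := by simp
  cst_inj _ _ _ _ _ h := by simpa using h
  enum_cases a n u hu := by
    cases u with
    | none => exact .inl rfl
    | some k => exact .inr ⟨k, by simpa [CatInst.Sort, Ty.hasObj] using hu, rfl⟩

/-- Finitely many named elements that are closed under attributes form a catalog instance. -/
theorem exists_catInst {D : Schema} (hD : D.WF) {J : Type} {S : Set J} (hS : S.Finite)
    (ty : J → Ty) (ch : ℕ → ℕ → J → J) (lab : J → Val)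
    (hch : ∀ x ∈ S, ∀ (r : ℕ) (R : CatRel) (j : ℕ) (τ : Ty), D.cat[r]? = some R →
      R.attrs[j]? = some τ → ty x = .ident R.idTy →
      ch r j x ∈ S ∧ ty (ch r j x) = τ ∧ (lab (ch r j x) = none ↔ lab x = none))
    (hcong : ∀ x ∈ S, ∀ y ∈ S, ∀ (r : ℕ) (R : CatRel) (j : ℕ) (τ : Ty), D.cat[r]? = some R →
      R.attrs[j]? = some τ → ty x = .ident R.idTy → ty y = .ident R.idTy → lab x = lab y →
      lab (ch r j x) = lab (ch r j y))
    (hobj : ∀ x ∈ S, ∀ k, lab x = some k → (ty x).hasObj k = true)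
    (hconst : ∀ p ∈ D.idConsts, ∃ x ∈ S, ty x = .ident p.1 ∧ lab x = some p.2) :
    ∃ I : CatInst, I.Valid D ∧ (∀ x ∈ S, I.Sort D (ty x) (lab x)) ∧
      ∀ x ∈ S, ∀ (r : ℕ) (R : CatRel) (j : ℕ) (τ : Ty), D.cat[r]? = some R →
        R.attrs[j]? = some τ → ty x = .ident R.idTy → I.fn r j (lab x) = lab (ch r j x) := by
  let row : ℕ → CatRel → J → List Val := fun r R x =>
    lab x :: (List.range R.attrs.length).map fun j => lab (ch r j x)
  let I : CatInst := fun r => {t | ∃ R, D.cat[r]? = some R ∧ ∃ x ∈ S, ty x = .ident R.idTy ∧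
    lab x ≠ none ∧ t = row r R x}
  have hkey : ∀ x ∈ S, ∀ s k, ty x = .ident s → D.isCatId s = true → lab x = some k →
      I.HasKey D s k := by
    intro x hx s k hs hc hk
    obtain ⟨r, R, hR, rfl⟩ := Schema.isCatId_iff.1 hc
    exact ⟨r, R, hR, rfl, row r R x, ⟨R, hR, x, hx, hs, by simp [hk], rfl⟩, by simp [row, hk]⟩
  have hget : ∀ (r : ℕ) (R : CatRel) (x : J) (j : ℕ) (τ : Ty), D.cat[r]? = some R → x ∈ S →
      ty x = .ident R.idTy → lab x ≠ none → R.row[j]? = some τ →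
      ∃ y ∈ S, ty y = τ ∧ lab y ≠ none ∧ (row r R x)[j]? = some (lab y) := by
    intro r R x j τ hR hx hty hne hj
    cases j with
    | zero =>
      refine ⟨x, hx, ?_, hne, rfl⟩
      rw [hty]
      simpa [CatRel.row] using hj
    | succ j =>
      have hj' : R.attrs[j]? = some τ := by simpa [CatRel.row] using hj
      obtain ⟨h₁, h₂, h₃⟩ := hch x hx r R j τ hR hj' hty
      have hlt := (List.getElem?_eq_some_iff.1 hj').1
      exact ⟨_, h₁, h₂, fun h => hne (h₃.1 h), by simp [row, hlt]⟩
  have hI : I.Valid D := by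
    refine ⟨?_, ?_, ?_, ?_, ?_⟩
    · intro r
      cases hR : D.cat[r]? with
      | none => exact Set.Finite.subset Set.finite_empty fun t ⟨R, hR', _⟩ => by simp [hR] at hR'
      | some R =>
        refine (hS.image (row r R)).subset ?_
        rintro t ⟨R', hR', x, hx, -, -, rfl⟩
        obtain rfl : R = R' := by simpa [hR] using hR'
        exact ⟨x, hx, rfl⟩
    · rintro r R hR t ⟨R', hR', x, hx, hty, hne, rfl⟩
      obtain rfl : R = R' := by simpa [hR] using hR'
      refine List.forall₂_iff_get.2 ⟨by simp [row, CatRel.row], fun i h₁ h₂ => ?_⟩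
      obtain ⟨y, hy, hty', hne', he⟩ := hget r R x i (R.row[i]'h₂) hR hx hty hne
        (List.getElem?_eq_getElem _)
      obtain ⟨k, hk⟩ := Option.ne_none_iff_exists'.1 hne'
      refine ⟨k, ?_, ?_⟩
      · rw [List.getElem?_eq_some_iff] at he
        simp only [List.get_eq_getElem, he.2, hk]
      · simp only [List.get_eq_getElem]
        exact hty' ▸ hobj y hy k hk
    · rintro r t ⟨R, hR, x, hx, hty, hne, rfl⟩ t' ⟨R', hR', x', hx', hty', hne', rfl⟩ h
      obtain rfl : R = R' := by simpa [hR] using hR'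
      have h' : lab x = lab x' := by simpa [row] using h
      simp only [row, h']
      congr 1
      refine List.map_congr_left fun j hj => ?_
      exact hcong x hx x' hx' r R j _ hR
        (List.getElem?_eq_getElem (List.mem_range.1 hj)) hty hty' h'
    · rintro r R hR t ⟨R', hR', x, hx, hty, hne, rfl⟩ j s k hj hk
      obtain rfl : R = R' := by simpa [hR] using hR'
      obtain ⟨y, hy, hty', hne', he⟩ := hget r R x j _ hR hx hty hne hj
      rw [he] at hk
      refine hkey y hy s k hty' ?_ (by simpa using hk)
      cases j with
      | zero =>
        have : R.idTy = s := by simpa [CatRel.row] using hj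
        exact Schema.isCatId_iff.2 ⟨r, R, hR, this⟩
      | succ j =>
        have hj' : R.attrs[j]? = some (.ident s) := by simpa [CatRel.row] using hj
        exact hD.foreign R (List.mem_of_getElem? hR) s (List.mem_of_getElem? hj')
    · intro p hp
      obtain ⟨x, hx, hty, hk⟩ := hconst p hp
      exact hkey x hx _ _ hty (hD.consts_cat p hp) hk
  refine ⟨I, hI, ?_, ?_⟩
  · intro x hx
    cases hk : lab x with
    | none => cases ty x <;> trivial
    | some k =>
      cases hty : ty x with
      | ident s => exact fun hc => hkey x hx s k hty hc hk
      | _ =>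
        have := hobj x hx k hk
        rw [hty] at this
        exact this
  · intro x hx r R j τ hR hj hty
    cases hk : lab x with
    | none => rw [hI.fn_none hR, ((hch x hx r R j τ hR hj hty).2.2.2 hk)]
    | some k =>
      have hm : row r R x ∈ I r := ⟨R, hR, x, hx, hty, by simp [hk], rfl⟩
      obtain ⟨k', hk'⟩ := hI.row_eq hR hm
      simp only [row, hk, List.cons.injEq, Option.some.injEq, List.map_inj_left] at hk'
      obtain ⟨rfl, h⟩ := hk'
      exact (h j (List.mem_range.2 (List.getElem?_eq_some_iff.1 hj).1)).symm

/-! ## Correctness of the executable backend -/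

theorem lookup_map_self {X Y : Type*} [BEq X] [LawfulBEq X] (f : X → Y) {x : X} {l : List X}
    (hx : x ∈ l) : (l.map fun y => (y, f y)).lookup x = some (f x) := by
  induction l with
  | nil => simp at hx
  | cons y l ih =>
    by_cases h : x = y
    · subst h
      simp
    · have hx' : x ∈ l := (List.mem_cons.1 hx).resolve_left h
      simp [List.lookup_cons, ih hx', beq_eq_false_iff_ne.2 h]

theorem map_mem_allLabellings {vals : List Val} {f : STerm → Val} {ts : List STerm}
    (h : ∀ t ∈ ts, f t ∈ vals) : (ts.map fun t => (t, f t)) ∈ allLabellings vals ts := by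
  induction ts with
  | nil => simp [allLabellings]
  | cons t ts ih =>
    simp only [allLabellings, List.map_cons, List.mem_flatMap, List.mem_map]
    exact ⟨_, ih fun u hu => h u (List.mem_cons_of_mem _ hu), f t, h t List.mem_cons_self, rfl⟩

theorem Labelling.valid_iff {D : Schema} {ts : List STerm} {l : Labelling} :
    l.valid D ts = true ↔
      (∀ t ∈ ts, ∀ τ k, t.ty D = some τ → l.val t = some k → τ.hasObj k = true) ∧
      (∀ r j u, STerm.app r j u ∈ ts → (l.val (.app r j u) = none ↔ l.val u = none)) ∧
      (∀ r j u u', STerm.app r j u ∈ ts → STerm.app r j u' ∈ ts → l.val u = l.val u' →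
        l.val (.app r j u) = l.val (.app r j u')) := by
  simp only [Labelling.valid, List.all_eq_true, Bool.and_eq_true]
  constructor
  · intro h
    refine ⟨?_, ?_, ?_⟩
    · intro t ht τ k hτ hk
      simpa [hτ, hk] using (h t ht).1
    · intro r j u hu
      have := (h _ hu).2
      simp only [Bool.and_eq_true, beq_iff_eq, decide_eq_decide] at this
      exact this.1
    · intro r j u u' hu hu' he
      have := (h _ hu).2
      simp only [Bool.and_eq_true, List.all_eq_true] at this
      simpa [he] using this.2 _ hu'
  · rintro ⟨h₁, h₂, h₃⟩ t ht
    refine ⟨?_, ?_⟩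
    · cases hτ : t.ty D with
      | none => rfl
      | some τ =>
        cases hk : l.val t with
        | none => rfl
        | some k => exact h₁ t ht τ k hτ hk
    · cases t with
      | var x => rfl
      | const τ c => rfl
      | app r j u =>
        simp only [Bool.and_eq_true, List.all_eq_true, beq_iff_eq, decide_eq_decide]
        refine ⟨h₂ r j u ht, fun t' ht' => ?_⟩
        cases t' with
        | var x => rfl
        | const τ c => rfl
        | app r' j' u' =>
          simp only [Bool.or_eq_true, Bool.not_eq_true', decide_eq_false_iff_not,
            decide_eq_true_eq]
          by_cases hc : r = r' ∧ j = j' ∧ l.val u = l.val u'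
          · obtain ⟨rfl, rfl, he⟩ := hc
            exact .inr (h₃ r j u u' ht ht' he)
          · exact .inl hc

theorem lt_foldr_max {l : List ℕ} {n : ℕ} (h : n ∈ l) : n ≤ l.foldr max 0 := by
  induction l with
  | nil => simp at h
  | cons m l ih =>
    rcases List.mem_cons.1 h with rfl | h
    · simp
    · exact le_trans (ih h) (by simp)

theorem idConst_mem_termsOf {D : Schema} (hac : D.Acyclic) {φ : Fml} (hφ : φ.WF D) {p : ℕ × ℕ}
    (hp : p ∈ D.idConsts) : STerm.const (.ident p.1) (some p.2) ∈ termsOf D φ := by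
  refine (mem_termsOf hac hφ).2 ⟨?_, by simp [STerm.ty, constOk_idConsts hp]⟩
  exact List.mem_append_right _ (List.mem_map.2 ⟨p, hp, rfl⟩)

theorem mem_termsOf_of_bases {D : Schema} (hac : D.Acyclic) {φ : Fml} (hφ : φ.WF D) {t : STerm}
    {τ : Ty} (ht : t.ty D = some τ) (hb : t.base ∈ φ.bases) : t ∈ termsOf D φ :=
  (mem_termsOf hac hφ).2 ⟨List.mem_append_left _ hb, by simp [ht]⟩

theorem app_mem_termsOf {D : Schema} (hac : D.Acyclic) {φ : Fml} (hφ : φ.WF D) {r j : ℕ}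
    {R : CatRel} {τ : Ty} {t : STerm} (hR : D.cat[r]? = some R) (hj : R.attrs[j]? = some τ)
    (h : t.ty D = some (.ident R.idTy)) (ht : t ∈ termsOf D φ) :
    STerm.app r j t ∈ termsOf D φ :=
  (mem_termsOf hac hφ).2 (termsOver.app ((mem_termsOf hac hφ).1 ht) hR hj h)

theorem isSome_of_mem_termsOf {D : Schema} (hac : D.Acyclic) {φ : Fml} (hφ : φ.WF D) {t : STerm}
    (ht : t ∈ termsOf D φ) : (t.ty D).isSome :=
  ((mem_termsOf hac hφ).1 ht).2

theorem mem_termsOf_of_app {D : Schema} (hac : D.Acyclic) {φ : Fml} (hφ : φ.WF D) {r j : ℕ}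
    {t : STerm} (ht : STerm.app r j t ∈ termsOf D φ) : t ∈ termsOf D φ := by
  have h := (mem_termsOf hac hφ).1 ht
  obtain ⟨τ, hτ⟩ := Option.isSome_iff_exists.1 h.2
  obtain ⟨R, hR, hty, hj⟩ := STerm.ty_app_iff.1 hτ
  exact (mem_termsOf hac hφ).2 ⟨h.1, by simp [hty]⟩

/-- A model of a formula yields one of the labellings of the terms. -/
theorem exists_labelling {D : Schema} (hac : D.Acyclic) {φ : Fml} (hφ : φ.WF D)
    (A : TModel D) {β : SVar → A.U} (hβ : A.Sorted β) (hsat : A.Sat β φ) :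
    ∃ l ∈ modelsOf D φ, ∀ t ∈ termsOf D φ, ∀ τ, t.ty D = some τ →
      (l.val t = none ↔ A.eval β t = A.undef τ) ∧
      ∀ t' ∈ termsOf D φ, t'.ty D = some τ → (l.val t = l.val t' ↔ A.eval β t = A.eval β t') := by
  classical
  let ts := termsOf D φ
  let F : Set (Ty × A.U) := (fun t => ((t.ty D).getD lifeTy, A.eval β t)) '' {t | t ∈ ts}
  have hF : F.Finite := ts.finite_toSet.image _
  have hmem : ∀ t ∈ ts, ∀ τ, t.ty D = some τ → (τ, A.eval β t) ∈ F := fun t ht τ hτ =>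
    ⟨t, ht, by simp [hτ]⟩
  have hs : ∀ p ∈ F, A.sort p.1 p.2 := by
    rintro p ⟨t, ht, rfl⟩
    obtain ⟨τ, hτ⟩ := Option.isSome_iff_exists.1 (isSome_of_mem_termsOf hac hφ ht)
    simpa [hτ] using A.sort_eval hβ hτ
  have hcard : hF.toFinset.card ≤ ts.length := by
    have : hF.toFinset = ts.toFinset.image fun t => ((t.ty D).getD lifeTy, A.eval β t) := by
      ext p
      simp [F]
    rw [this]
    exact Finset.card_image_le.trans (List.toFinset_card_le ts)
  let b : ℕ := (ts.map fun t => match t with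
    | .const _ (some k) => k + 1
    | _ => 0).foldr max 0
  let K : Set (Ty × ℕ) := {p | STerm.const p.1 (some p.2) ∈ ts}
  have hconst : ∀ τ k, STerm.const τ (some k) ∈ ts → D.constOk τ k = true := by
    intro τ k h
    have := isSome_of_mem_termsOf hac hφ h
    simp only [STerm.ty] at this
    split_ifs at this with h'
    · exact h'
    · simp at this
  obtain ⟨ν, hν₁, hν₂, hν₃, hν₄⟩ := exists_names A hF hs (b := b) hcard K (fun p hp => by
    refine ⟨hconst _ _ hp, ?_⟩
    exact Nat.lt_of_succ_le (lt_foldr_max (List.mem_map.2 ⟨_, hp, rfl⟩)))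
  let f : STerm → Val := fun t => ν ((t.ty D).getD lifeTy) (A.eval β t)
  let l : Labelling := ts.map fun t => (t, f t)
  have hval : ∀ t ∈ ts, l.val t = f t := by
    intro t ht
    have hlk : (l.lookup t).getD none = f t := by
      simp [l, lookup_map_self f ht]
    cases t with
    | var x => exact hlk
    | app r j t => exact hlk
    | const τ c =>
      cases c with
      | none => exact ((hν₁ τ _).2 rfl).symm
      | some k =>
        have := hν₄ (τ, k) ht
        simp only [f, STerm.ty, hconst τ k ht, if_true, Option.getD_some, TModel.eval]
        exact this.symm
  have hval' : ∀ t ∈ ts, ∀ τ, t.ty D = some τ → l.val t = ν τ (A.eval β t) := by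
    intro t ht τ hτ
    simp [hval t ht, f, hτ]
  have hnone : ∀ t ∈ ts, ∀ τ, t.ty D = some τ → (l.val t = none ↔ A.eval β t = A.undef τ) := by
    intro t ht τ hτ
    rw [hval' t ht τ hτ, hν₁]
  have heq : ∀ t ∈ ts, ∀ t' ∈ ts, ∀ τ, t.ty D = some τ → t'.ty D = some τ →
      (l.val t = l.val t' ↔ A.eval β t = A.eval β t') := by
    intro t ht t' ht' τ hτ hτ'
    rw [hval' t ht τ hτ, hval' t' ht' τ hτ']
    exact ⟨hν₂ τ _ _ (hmem t ht τ hτ) (hmem t' ht' τ hτ'), fun h => by rw [h]⟩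
  refine ⟨l, ?_, fun t ht τ hτ => ⟨hnone t ht τ hτ, fun t' ht' hτ' => heq t ht t' ht' τ hτ hτ'⟩⟩
  refine List.mem_filter.2 ⟨map_mem_allLabellings fun t ht => ?_, ?_⟩
  · cases hk : f t with
    | none => simp
    | some k =>
      obtain ⟨τ, hτ⟩ := Option.isSome_iff_exists.1 (isSome_of_mem_termsOf hac hφ ht)
      have := (hν₃ τ _ k (hmem t ht τ hτ) (by rw [← hk]; simp [f, hτ])).2
      refine List.mem_cons_of_mem _ (List.mem_map.2 ⟨k, List.mem_range.2 this, rfl⟩)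
  · rw [Bool.and_eq_true]
    refine ⟨Labelling.valid_iff.2 ⟨?_, ?_, ?_⟩, ?_⟩
    · intro t ht τ k hτ hk
      rw [hval' t ht τ hτ] at hk
      exact (hν₃ τ _ k (hmem t ht τ hτ) hk).1
    · intro r j u hu
      obtain ⟨τ, hτ⟩ := Option.isSome_iff_exists.1 (isSome_of_mem_termsOf hac hφ hu)
      obtain ⟨R, hR, h', hj⟩ := STerm.ty_app_iff.1 hτ
      rw [hnone _ hu τ hτ, hnone u (mem_termsOf_of_app hac hφ hu) _ h']
      exact A.fn_undef r j R τ _ hR hj (A.sort_eval hβ h')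
    · intro r j u u' hu hu' he
      obtain ⟨τ, hτ⟩ := Option.isSome_iff_exists.1 (isSome_of_mem_termsOf hac hφ hu)
      obtain ⟨R, hR, h', hj⟩ := STerm.ty_app_iff.1 hτ
      obtain ⟨τ', hτ'⟩ := Option.isSome_iff_exists.1 (isSome_of_mem_termsOf hac hφ hu')
      obtain ⟨R', hR', h'', hj'⟩ := STerm.ty_app_iff.1 hτ'
      obtain rfl : R = R' := by simpa [hR] using hR'
      obtain rfl : τ = τ' := by simpa [hj] using hj'
      rw [heq _ hu _ hu' τ hτ hτ']
      simp only [TModel.eval]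
      rw [(heq u (mem_termsOf_of_app hac hφ hu) u' (mem_termsOf_of_app hac hφ hu') _ h' h'').1 he]
    · rw [Labelling.sat_iff_holds]
      rw [TModel.sat_iff_holds] at hsat
      exact (Fml.holds_congr hφ fun a b' τ ha hb ha' hb' =>
        (heq a (mem_termsOf_of_bases hac hφ ha ha') b' (mem_termsOf_of_bases hac hφ hb hb')
        τ ha hb)).2 hsat

theorem mem_modelsOf {D : Schema} {φ : Fml} {l : Labelling} (hl : l ∈ modelsOf D φ) :
    l.valid D (termsOf D φ) = true ∧ l.sat φ = true := by
  have := (List.mem_filter.1 hl).2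
  rwa [Bool.and_eq_true] at this

/-- A labelling of the terms yields a model. -/
theorem tsat_of_mem_modelsOf {D : Schema} (hD : D.WF) (hac : D.Acyclic) {φ : Fml} (hφ : φ.WF D)
    {l : Labelling} (hl : l ∈ modelsOf D φ) : TSat D φ := by
  classical
  obtain ⟨hv, hsat⟩ := mem_modelsOf hl
  obtain ⟨h₁, h₂, h₃⟩ := Labelling.valid_iff.1 hv
  let ts := termsOf D φ
  have hty : ∀ t ∈ ts, ∀ τ, (t.ty D).getD lifeTy = τ → t.ty D = some τ := by
    intro t ht τ hτ
    obtain ⟨σ, hσ⟩ := Option.isSome_iff_exists.1 (isSome_of_mem_termsOf hac hφ ht)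
    simp_all
  obtain ⟨I, hI, hI₁, hI₂⟩ := exists_catInst hD (S := {t | t ∈ ts}) ts.finite_toSet
    (fun t => (t.ty D).getD lifeTy) STerm.app l.val
    (fun t ht r R j τ hR hj hτ => by
      have ht' := hty t ht _ hτ
      have hm := app_mem_termsOf hac hφ hR hj ht' ht
      have : (STerm.app r j t).ty D = some τ := STerm.ty_app_iff.2 ⟨R, hR, ht', hj⟩
      exact ⟨hm, by simp [this], h₂ r j t hm⟩)
    (fun t ht t' ht' r R j τ hR hj hτ hτ' he =>
      h₃ r j t t' (app_mem_termsOf hac hφ hR hj (hty t ht _ hτ) ht)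
        (app_mem_termsOf hac hφ hR hj (hty t' ht' _ hτ') ht') he)
    (fun t ht k hk => h₁ t ht _ k (hty t ht _ rfl) hk)
    (fun p hp => ⟨_, idConst_mem_termsOf hac hφ hp, by simp [STerm.ty, constOk_idConsts hp], rfl⟩)
  let α : SVar → Val := fun x => if STerm.var x ∈ ts then l.val (.var x) else none
  have heval : ∀ t ∈ ts, (I.model hD hI).eval α t = l.val t := by
    intro t ht
    induction t with
    | var x => simp [TModel.eval, α, ht]
    | const τ c => cases c <;> rfl
    | app r j t ih =>
      have hm := mem_termsOf_of_app hac hφ ht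
      obtain ⟨τ, hτ⟩ := Option.isSome_iff_exists.1 (isSome_of_mem_termsOf hac hφ ht)
      obtain ⟨R, hR, h', hj⟩ := STerm.ty_app_iff.1 hτ
      simp only [TModel.eval, ih hm]
      exact hI₂ t hm r R j τ hR hj (by simp [h'])
  refine ⟨I.model hD hI, α, ?_, ?_⟩
  · intro x
    by_cases hx : STerm.var x ∈ ts
    · simpa [α, hx, STerm.ty] using hI₁ _ hx
    · simpa [α, hx] using (I.model hD hI).undef_sort x.ty
  · rw [TModel.sat_iff_holds]
    rw [Labelling.sat_iff_holds] at hsat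
    refine (Fml.holds_congr hφ fun a b τ ha hb ha' hb' => ?_).1 hsat
    rw [heval a (mem_termsOf_of_bases hac hφ ha ha'), heval b (mem_termsOf_of_bases hac hφ hb hb')]

theorem sat_diagram {D : Schema} (A : TModel D) (α : SVar → A.U) (ts : List STerm)
    (l : Labelling) : A.Sat α (l.diagram D ts) ↔ ∀ t ∈ ts, ∀ τ, t.ty D = some τ →
      (l.val t = none ↔ A.eval α t = A.undef τ) ∧
      ∀ t' ∈ ts, t'.ty D = some τ → (l.val t = l.val t' ↔ A.eval α t = A.eval α t') := by
  have hlit : ∀ a b : STerm, A.Sat α (if l.val a = l.val b then .eq a b else .neg (.eq a b)) ↔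
      (l.val a = l.val b ↔ A.eval α a = A.eval α b) := by
    intro a b
    split_ifs with h <;> simp [TModel.Sat, h]
  simp only [Labelling.diagram, TModel.sat_bigAnd, List.mem_flatMap, forall_exists_index, and_imp]
  constructor
  · intro h t ht τ hτ
    have h' := fun ψ => h ψ t ht
    simp only [hτ, List.mem_cons, List.mem_map, List.mem_filter, decide_eq_true_eq] at h'
    refine ⟨(hlit _ _).1 (h' _ (.inl rfl)), fun t' ht' hτ' => ?_⟩
    exact (hlit _ _).1 (h' _ (.inr ⟨t', ⟨ht', hτ'⟩, rfl⟩))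
  · intro h ψ t ht hψ
    cases hτ : t.ty D with
    | none => simp [hτ] at hψ
    | some τ =>
      simp only [hτ, List.mem_cons, List.mem_map, List.mem_filter, decide_eq_true_eq] at hψ
      rcases hψ with rfl | ⟨u, ⟨hu, hσ⟩, rfl⟩
      · exact (hlit _ _).2 (h t ht τ hτ).1
      · exact (hlit _ _).2 ((h t ht τ hτ).2 u hu hσ)

/-- A permutation of a finite set of labels that extends a partial injection. -/
theorem exists_perm_extending {n : ℕ} (Q : Fin n → Fin n → Prop)
    (hfun : ∀ i j j', Q i j → Q i j' → j = j') (hinj : ∀ i i' j, Q i j → Q i' j → i = i') :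
    ∃ π : Fin n ≃ Fin n, ∀ i j, Q i j → π i = j := by
  classical
  let f : Fin n → Fin n := fun i => if h : ∃ j, Q i j then h.choose else i
  have hf : ∀ i j, Q i j → f i = j := by
    intro i j h
    have h' : ∃ j, Q i j := ⟨j, h⟩
    simp only [f, dif_pos h']
    exact hfun _ _ _ h'.choose_spec h
  obtain ⟨g, hg⟩ := Set.MapsTo.exists_equiv_extend_of_card_eq (α := Fin n) (t := Finset.univ)
    (by simp) (s := {i | ∃ j, Q i j}) (f := f) (by simp [Set.MapsTo]) (by
      rintro i ⟨j, hj⟩ i' ⟨j', hj'⟩ h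
      rw [hf i j hj, hf i' j' hj'] at h
      exact hinj i i' j hj (h ▸ hj'))
  refine ⟨g.trans (Equiv.subtypeUnivEquiv (by simp)), fun i j h => ?_⟩
  have := hg i ⟨j, h⟩
  rw [hf i j h] at this
  exact this

/-- The labels of the terms in `C`, of which a model realizes the diagram, are identified with
elements of the model; all labels of enumerated types are identified. -/
theorem exists_identification {D : Schema} (A : TModel D) {α : SVar → A.U} (hα : A.Sorted α)
    {l : Labelling} {C : Set STerm}
    (hobj : ∀ t ∈ C, ∀ τ k, t.ty D = some τ → l.val t = some k → τ.hasObj k = true)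
    (hdiag : ∀ t ∈ C, ∀ τ, t.ty D = some τ → (l.val t = none ↔ A.eval α t = A.undef τ) ∧
      ∀ t' ∈ C, t'.ty D = some τ → (l.val t = l.val t' ↔ A.eval α t = A.eval α t')) :
    ∃ e : Ty → Val → Option A.U,
      (∀ t ∈ C, ∀ τ, t.ty D = some τ → e τ (l.val t) = some (A.eval α t)) ∧
      (∀ τ, e τ none = some (A.undef τ)) ∧
      (∀ τ v u, e τ v = some u → A.sort τ u) ∧
      (∀ τ v w u, e τ v = some u → e τ w = some u → v = w) ∧
      (∀ a n k, k < n → e (.enum a n) (some k) ≠ none) ∧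
      (∀ s v u, e (.ident s) v = some u → v = none ∨
        ∃ t ∈ C, t.ty D = some (.ident s) ∧ l.val t = v) := by
  classical
  have hperm : ∀ a n, ∃ π : Fin n ≃ Fin n, ∀ i j : Fin n,
      (∃ t ∈ C, t.ty D = some (.enum a n) ∧ l.val t = some i.1 ∧
        A.eval α t = A.cst (.enum a n) j.1) → π i = j := by
    intro a n
    apply exists_perm_extending
    · rintro i j j' ⟨t, ht, hτ, hi, hj⟩ ⟨t', ht', hτ', hi', hj'⟩
      have := ((hdiag t ht _ hτ).2 t' ht' hτ').1 (by rw [hi, hi'])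
      rw [hj, hj'] at this
      exact Fin.ext (A.cst_inj _ _ _ (constOk_enum j.2) (constOk_enum j'.2) this)
    · rintro i i' j ⟨t, ht, hτ, hi, hj⟩ ⟨t', ht', hτ', hi', hj'⟩
      have := ((hdiag t ht _ hτ).2 t' ht' hτ').2 (by rw [hj, hj'])
      rw [hi, hi'] at this
      exact Fin.ext (by simpa using this)
  choose π hπ using hperm
  let e : Ty → Val → Option A.U := fun τ v =>
    match τ, v with
    | τ, none => some (A.undef τ)
    | .enum a n, some k => if h : k < n then some (A.cst (.enum a n) (π a n ⟨k, h⟩)) else none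
    | τ, some k => if h : ∃ t ∈ C, t.ty D = some τ ∧ l.val t = some k then
        some (A.eval α h.choose) else none
  have hnone : ∀ τ, e τ none = some (A.undef τ) := fun τ => by cases τ <;> rfl
  have henum : ∀ a n k (h : k < n),
      e (.enum a n) (some k) = some (A.cst (.enum a n) (π a n ⟨k, h⟩)) := by
    intro a n k h
    simp [e, h]
  have hterm : ∀ t ∈ C, ∀ τ, t.ty D = some τ → e τ (l.val t) = some (A.eval α t) := by
    intro t ht τ hτ
    cases hv : l.val t with
    | none => rw [hnone, ((hdiag t ht τ hτ).1.1 hv)]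
    | some k =>
      have hne : A.eval α t ≠ A.undef τ := fun h => by
        rw [(hdiag t ht τ hτ).1.2 h] at hv
        simp at hv
      have hch : ∀ h : ∃ t' ∈ C, t'.ty D = some τ ∧ l.val t' = some k,
          A.eval α h.choose = A.eval α t := fun h =>
        ((hdiag _ h.choose_spec.1 τ h.choose_spec.2.1).2 t ht hτ).1
          (h.choose_spec.2.2.trans hv.symm)
      have hex : ∃ t' ∈ C, t'.ty D = some τ ∧ l.val t' = some k := ⟨t, ht, hτ, hv⟩
      cases τ with
      | enum a n =>
        have hk : k < n := by simpa [Ty.hasObj] using hobj t ht _ k hτ hv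
        rw [henum a n k hk]
        obtain ⟨j, hj, hj'⟩ := (A.enum_cases a n _ (A.sort_eval hα hτ)).resolve_left hne
        rw [hπ a n ⟨k, hk⟩ ⟨j, hj⟩ ⟨t, ht, hτ, hv, hj'⟩, hj']
      | prim a => simp only [e, dif_pos hex, hch hex]
      | ident s => simp only [e, dif_pos hex, hch hex]
  have hother : ∀ τ k u, (∀ a n, τ ≠ .enum a n) → e τ (some k) = some u →
      ∃ t ∈ C, t.ty D = some τ ∧ l.val t = some k ∧ A.eval α t = u := by
    intro τ k u hτ h
    by_cases hex : ∃ t ∈ C, t.ty D = some τ ∧ l.val t = some k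
    · cases τ with
      | enum a n => exact absurd rfl (hτ a n)
      | _ =>
        simp only [e, dif_pos hex, Option.some.injEq] at h
        exact ⟨_, hex.choose_spec.1, hex.choose_spec.2.1, hex.choose_spec.2.2, h⟩
    · cases τ with
      | enum a n => exact absurd rfl (hτ a n)
      | _ => simp [e, dif_neg hex] at h
  have hlt : ∀ a n k u, e (.enum a n) (some k) = some u → k < n := by
    intro a n k u h
    by_contra hk
    simp [e, hk] at h
  have hsome : ∀ τ k u, e τ (some k) = some u → A.sort τ u ∧ u ≠ A.undef τ := by
    intro τ k u h
    by_cases hτ : ∃ a n, τ = .enum a n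
    · obtain ⟨a, n, rfl⟩ := hτ
      have hk := hlt a n k u h
      rw [henum a n k hk, Option.some.injEq] at h
      have hc : D.constOk (.enum a n) (π a n ⟨k, hk⟩).1 = true := constOk_enum (Fin.is_lt _)
      exact h ▸ ⟨A.cst_sort _ _ hc, A.cst_ne_undef _ _ hc⟩
    · push Not at hτ
      obtain ⟨t, ht, hty, hv, rfl⟩ := hother τ k u hτ h
      refine ⟨A.sort_eval hα hty, fun h' => ?_⟩
      rw [(hdiag t ht τ hty).1.2 h'] at hv
      simp at hv
  refine ⟨e, hterm, hnone, ?_, ?_, ?_, ?_⟩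
  · intro τ v u h
    cases v with
    | none =>
      rw [hnone, Option.some.injEq] at h
      exact h ▸ A.undef_sort τ
    | some k => exact (hsome τ k u h).1
  · intro τ v w u hv hw
    cases v with
    | none =>
      cases w with
      | none => rfl
      | some k =>
        rw [hnone, Option.some.injEq] at hv
        exact absurd hv.symm (hsome τ k u hw).2
    | some k =>
      cases w with
      | none =>
        rw [hnone, Option.some.injEq] at hw
        exact absurd hw.symm (hsome τ k u hv).2
      | some k' =>
        by_cases hτ : ∃ a n, τ = .enum a n
        · obtain ⟨a, n, rfl⟩ := hτ
          have hk := hlt a n k u hv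
          have hk' := hlt a n k' u hw
          rw [henum a n k hk, Option.some.injEq] at hv
          rw [henum a n k' hk', Option.some.injEq] at hw
          have := A.cst_inj _ _ _ (constOk_enum (Fin.is_lt _)) (constOk_enum (Fin.is_lt _))
            (hv.trans hw.symm)
          have := (π a n).injective (Fin.ext this)
          simpa using this
        · push Not at hτ
          obtain ⟨t, ht, hty, hv', rfl⟩ := hother τ k u hτ hv
          obtain ⟨t', ht', hty', hw', h⟩ := hother τ k' _ hτ hw
          rw [← hv', ← hw']
          exact ((hdiag t ht τ hty).2 t' ht' hty').2 h.symm
  · intro a n k hk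
    simp [henum a n k hk]
  · intro s v u h
    cases v with
    | none => exact .inl rfl
    | some k =>
      obtain ⟨t, ht, hty, hv, -⟩ := hother (.ident s) k u (by simp) h
      exact .inr ⟨t, ht, hty, hv⟩

/-- A labelling whose diagram over the current artifact variables is realized in a model can be
realized over the same values in the free extension of the model. -/
theorem exists_ext_of_diagram {D : Schema} (hD : D.WF) (hac : D.Acyclic) {φ : Fml} (hφ : φ.WF D)
    {l : Labelling} (hl : l ∈ modelsOf D φ) (A : TModel D) {α : SVar → A.U} (hα : A.Sorted α)
    (hdiag : A.Sat α (l.diagram D ((termsOf D φ).filter STerm.isCur))) :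
    ∃ β : SVar → (A.ext hD).U, (A.ext hD).Sorted β ∧
      (∀ x, x.isCur = true → β x = Ext.old (α x)) ∧ (A.ext hD).Sat β φ := by
  classical
  obtain ⟨hv, hsat⟩ := mem_modelsOf hl
  obtain ⟨h₁, h₂, h₃⟩ := Labelling.valid_iff.1 hv
  rw [sat_diagram] at hdiag
  let ts := termsOf D φ
  let C : Set STerm := {t | t ∈ ts.filter STerm.isCur}
  have hC : ∀ t, t ∈ C ↔ t ∈ ts ∧ t.isCur = true := fun t => List.mem_filter
  obtain ⟨e, he₁, he₂, he₃, he₄, he₅, he₆⟩ := exists_identification A hα (C := C)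
    (fun t ht => h₁ t ((hC t).1 ht).1) hdiag
  let nx : ℕ → ℕ → Val → Val := fun r j v =>
    if h : ∃ u, STerm.app r j u ∈ ts ∧ l.val u = v then l.val (.app r j h.choose) else none
  have hnx : ∀ r j u, STerm.app r j u ∈ ts → nx r j (l.val u) = l.val (.app r j u) := by
    intro r j u hu
    have h : ∃ u', STerm.app r j u' ∈ ts ∧ l.val u' = l.val u := ⟨u, hu, rfl⟩
    simp only [nx, dif_pos h]
    exact h₃ r j _ _ h.choose_spec.1 hu h.choose_spec.2
  let P : Set (Ty × Val) := {p | ∃ t ∈ ts, t.ty D = some p.1 ∧ l.val t = p.2}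
  have hP : P.Finite := by
    refine (ts.finite_toSet.image fun t => ((t.ty D).getD lifeTy, l.val t)).subset ?_
    rintro ⟨τ, v⟩ ⟨t, ht, hτ, hv⟩
    exact ⟨t, ht, by simp_all⟩
  have hobj : ∀ τ k, (τ, some k) ∈ P → τ.hasObj k = true := by
    rintro τ k ⟨t, ht, hτ, hk⟩
    exact h₁ t ht τ k hτ hk
  obtain ⟨G, hG₁, hG₂, hG₃, hG₄⟩ := exists_amalgam hD hac A hP nx
    (fun τ v => (e τ v).map Ext.old)
    (by
      rintro r R j τ v hR hj ⟨t, ht, hτ, rfl⟩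
      have hm := app_mem_termsOf hac hφ hR hj hτ ht
      exact ⟨_, hm, STerm.ty_app_iff.2 ⟨R, hR, hτ, hj⟩, (hnx r j t hm).symm⟩)
    (by
      intro τ v a _ h
      obtain ⟨u, hu, rfl⟩ := Option.map_eq_some_iff.1 h
      exact .old _ _ (he₃ τ v u hu))
    (by
      intro τ v w a _ _ hv hw
      obtain ⟨u, hu, rfl⟩ := Option.map_eq_some_iff.1 hv
      obtain ⟨u', hu', h⟩ := Option.map_eq_some_iff.1 hw
      exact he₄ τ v w u hu (by rw [hu', Ext.old.inj h]))
    (by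
      rintro r R j τ v a hR hj ⟨t, ht, hτ, hvt⟩ h
      obtain ⟨u, hu, rfl⟩ := Option.map_eq_some_iff.1 h
      simp only at hvt hτ
      rcases he₆ _ _ _ hu with rfl | ⟨t', ht', hτ', rfl⟩
      · have hm := app_mem_termsOf hac hφ hR hj hτ ht
        have hn : nx r j none = none := by
          have := hnx r j t hm
          rwa [(h₂ r j t hm).2 hvt, hvt] at this
        rw [he₂, Option.some.injEq] at hu
        subst hu
        have := (A.fn_undef r j R τ _ hR hj (A.undef_sort _)).2 rfl
        simp [hn, he₂, extFn, this]
      · have hm := app_mem_termsOf hac hφ hR hj hτ' ((hC t').1 ht').1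
        have hc : STerm.app r j t' ∈ C := (hC _).2 ⟨hm, ((hC t').1 ht').2⟩
        rw [he₁ t' ht' _ hτ', Option.some.injEq] at hu
        subst hu
        rw [hnx r j t' hm, he₁ _ hc τ (STerm.ty_app_iff.2 ⟨R, hR, hτ', hj⟩)]
        rfl)
    (by
      intro a n v hv h
      rw [Option.map_eq_none_iff] at h
      cases v with
      | none => simp [he₂] at h
      | some k => exact he₅ a n k (by simpa [Ty.hasObj] using hobj _ k hv) h)
    (by
      rintro r R j τ v hR hj ⟨t, ht, hτ, hvt⟩ h h'
      simp only at hvt hτ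
      subst hvt
      have hm := app_mem_termsOf hac hφ hR hj hτ ht
      obtain ⟨u, hu, hu'⟩ := Option.map_eq_some_iff.1 h'
      rw [Ext.old.inj hu'] at hu
      have := he₄ τ _ _ _ hu (he₂ τ)
      rw [hnx r j t hm, h₂ r j t hm] at this
      simp [this, he₂] at h)
  have hGC : ∀ t ∈ C, ∀ τ, t.ty D = some τ → G τ (l.val t) = Ext.old (A.eval α t) := by
    intro t ht τ hτ
    exact hG₁ _ _ _ (by simp [he₁ t ht τ hτ])
  let β : SVar → (A.ext hD).U := fun x =>
    if STerm.var x ∈ ts then G x.ty (l.val (.var x)) else Ext.old (α x)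
  have heval : ∀ t ∈ ts, ∀ τ, t.ty D = some τ → (A.ext hD).eval β t = G τ (l.val t) := by
    intro t ht τ hτ
    induction t generalizing τ with
    | var x =>
      simp only [STerm.ty, Option.some.injEq] at hτ
      subst hτ
      simp [TModel.eval, β, ht]
    | const σ c =>
      rw [hGC _ ((hC _).2 ⟨ht, rfl⟩) τ hτ]
      cases c <;> rfl
    | app r j t ih =>
      obtain ⟨R, hR, h', hj⟩ := STerm.ty_app_iff.1 hτ
      have hm := mem_termsOf_of_app hac hφ ht
      simp only [TModel.eval]
      rw [← hnx r j t ht, hG₄ r R j τ (l.val t) hR hj ⟨t, hm, h', rfl⟩, ih hm _ h']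
  refine ⟨β, ?_, ?_, ?_⟩
  · intro x
    by_cases hx : STerm.var x ∈ ts
    · simpa [β, hx] using hG₂ x.ty (l.val (.var x)) ⟨.var x, hx, rfl, rfl⟩
    · simpa [β, hx] using ExtSort.old _ _ (hα x)
  · intro x hx
    by_cases hx' : STerm.var x ∈ ts
    · simp only [β, hx', if_true]
      exact hGC (.var x) ((hC _).2 ⟨hx', hx⟩) x.ty rfl
    · simp [β, hx']
  · rw [TModel.sat_iff_holds]
    rw [Labelling.sat_iff_holds] at hsat
    refine (Fml.holds_congr hφ fun a b τ ha hb ha' hb' => ?_).1 hsat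
    have ha₁ := mem_termsOf_of_bases hac hφ ha ha'
    have hb₁ := mem_termsOf_of_bases hac hφ hb hb'
    rw [heval a ha₁ τ ha, heval b hb₁ τ hb]
    exact ⟨fun h => by rw [h], hG₃ τ _ _ ⟨a, ha₁, ha, rfl⟩ ⟨b, hb₁, hb, rfl⟩⟩

theorem wf_diagram {D : Schema} (ts : List STerm) (l : Labelling) : (l.diagram D ts).WF D := by
  simp only [Labelling.diagram, Fml.wf_bigAnd, List.mem_flatMap, forall_exists_index, and_imp]
  intro ψ t ht hψ
  have hlit : ∀ (a b : STerm) (τ : Ty), a.ty D = some τ → b.ty D = some τ →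
      Fml.WF D (if l.val a = l.val b then .eq a b else .neg (.eq a b)) := by
    intro a b τ ha hb
    split_ifs <;> exact ⟨τ, ha, hb⟩
  cases hτ : t.ty D with
  | none => simp [hτ] at hψ
  | some τ =>
    simp only [hτ, List.mem_cons, List.mem_map, List.mem_filter, decide_eq_true_eq] at hψ
    rcases hψ with rfl | ⟨t', ⟨ht', hτ'⟩, rfl⟩
    · exact hlit _ _ τ hτ rfl
    · exact hlit _ _ τ hτ hτ'

theorem bases_diagram {D : Schema} {ts : List STerm} {l : Labelling} {t : STerm}
    (ht : t ∈ (l.diagram D ts).bases) : (∃ u ∈ ts, t = u.base) ∨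
      ∃ u ∈ ts, ∃ τ, u.ty D = some τ ∧ t = .const τ none := by
  have hlit : ∀ a b : STerm,
      t ∈ (if l.val a = l.val b then Fml.eq a b else .neg (.eq a b)).bases →
      t = a.base ∨ t = b.base := by
    intro a b h
    split_ifs at h <;> simpa [Fml.bases] using h
  simp only [Labelling.diagram, Fml.mem_bases_bigAnd, List.mem_flatMap] at ht
  obtain ⟨ψ, ⟨u, hu, hψ⟩, ht⟩ := ht
  cases hτ : u.ty D with
  | none => simp [hτ] at hψ
  | some τ =>
    simp only [hτ, List.mem_cons, List.mem_map, List.mem_filter, decide_eq_true_eq] at hψ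
    rcases hψ with rfl | ⟨t', ⟨ht', hτ'⟩, rfl⟩
    · rcases hlit _ _ ht with h | h
      exacts [.inl ⟨u, hu, h⟩, .inr ⟨u, hu, τ, hτ, h⟩]
    · rcases hlit _ _ ht with h | h
      exacts [.inl ⟨u, hu, h⟩, .inl ⟨t', ht', h⟩]

theorem STerm.isCur_base (t : STerm) : t.base.isCur = t.isCur := by
  simp only [STerm.isCur, STerm.base_base]

theorem STerm.isCur_var {t : STerm} (h : t.isCur = true) {x : SVar} (hx : t.base = .var x) :
    x.isCur = true := by
  simpa [STerm.isCur, hx] using h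

/-- The executable satisfiability test and quantifier elimination are correct. -/
theorem refBackend_correct {D : Schema} (hD : D.WF) (hac : D.Acyclic) :
    (refBackend D).Correct D where
  sat_iff φ hφ := by
    have h : (refBackend D).sat φ = true ↔ ∃ l, l ∈ modelsOf D φ := by
      simp [refBackend, List.eq_nil_iff_forall_not_mem]
    rw [h]
    constructor
    · rintro ⟨l, hl⟩
      exact tsat_of_mem_modelsOf hD hac hφ hl
    · rintro ⟨A, α, hα, hsat⟩
      obtain ⟨l, hl, -⟩ := exists_labelling hac hφ A hα hsat
      exact ⟨l, hl⟩
  qe_wf φ hφ := by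
    constructor
    · simp only [refBackend, Fml.wf_bigOr, List.mem_map]
      rintro _ ⟨l, -, rfl⟩
      exact wf_diagram _ _
    · intro t ht
      simp only [refBackend, Fml.mem_bases_bigOr, List.mem_map] at ht
      obtain ⟨_, ⟨l, -, rfl⟩, ht⟩ := ht
      rcases bases_diagram ht with ⟨u, hu, rfl⟩ | ⟨u, hu, τ, hτ, rfl⟩
      · rw [STerm.isCur_base]
        exact (List.mem_filter.1 hu).2
      · rfl
  qe_iff φ hφ A hA α hα := by
    simp only [refBackend, TModel.sat_bigOr, List.mem_map, exists_exists_and_eq_and]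
    constructor
    · rintro ⟨l, hl, hdiag⟩
      obtain ⟨β, hβ, hcur, hsat⟩ := exists_ext_of_diagram hD hac hφ hl A hα hdiag
      exact hA (A.ext hD) Ext.old (A.embeds_ext hD) φ {x | x.isCur = true} α β hφ hα hβ hcur hsat
    · rintro ⟨β, hβ, hcur, hsat⟩
      obtain ⟨l, hl, h⟩ := exists_labelling hac hφ A hβ hsat
      refine ⟨l, hl, (sat_diagram A α _ l).2 ?_⟩
      have heval : ∀ t ∈ (termsOf D φ).filter STerm.isCur, A.eval α t = A.eval β t :=
        fun t ht => A.eval_congr fun x hx =>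
          (hcur x (STerm.isCur_var (List.mem_filter.1 ht).2 hx)).symm
      intro t ht τ hτ
      obtain ⟨h₁, h₂⟩ := h t (List.mem_filter.1 ht).1 τ hτ
      refine ⟨by rw [h₁, heval t ht], fun u hu hσ => ?_⟩
      rw [h₂ u (List.mem_filter.1 hu).1 hσ, heval t ht, heval u hu]

/-! ## Backward search -/

theorem STerm.ty_prime {D : Schema} (t : STerm) : t.prime.ty D = t.ty D := by
  induction t with
  | var x => rfl
  | const τ c => cases c <;> rfl
  | app r j t ih => simp only [STerm.prime, STerm.ty, ih]

theorem Fml.wf_prime {D : Schema} {φ : Fml} (h : φ.WF D) : φ.prime.WF D := by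
  induction φ with
  | tru => trivial
  | fls => trivial
  | eq a b =>
    obtain ⟨τ, ha, hb⟩ := h
    exact ⟨τ, by rw [STerm.ty_prime, ha], by rw [STerm.ty_prime, hb]⟩
  | neg φ ih => exact ih h
  | and φ ψ ih₁ ih₂ => exact ⟨ih₁ h.1, ih₂ h.2⟩
  | or φ ψ ih₁ ih₂ => exact ⟨ih₁ h.1, ih₂ h.2⟩

/-- The next state in an assignment to current and next artifact variables. -/
def primed {U : Type*} (β : SVar → U) : SVar → U := fun x => β ⟨x.name.prime, x.ty⟩

theorem TModel.eval_prime {D : Schema} (A : TModel D) (β : SVar → A.U) (t : STerm) :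
    A.eval β t.prime = A.eval (primed β) t := by
  induction t with
  | var x => rfl
  | const τ c => cases c <;> rfl
  | app r j t ih => simp only [STerm.prime, TModel.eval, ih]

theorem TModel.sat_prime {D : Schema} (A : TModel D) (β : SVar → A.U) (φ : Fml) :
    A.Sat β φ.prime ↔ A.Sat (primed β) φ := by
  induction φ <;> simp_all [Fml.prime, TModel.Sat, TModel.eval_prime]

theorem TModel.Sorted.primed {D : Schema} {A : TModel D} {β : SVar → A.U} (h : A.Sorted β) :
    A.Sorted (primed β) := fun x => h ⟨x.name.prime, x.ty⟩

theorem STerm.base_prime (t : STerm) : t.prime.base = t.base.prime := by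
  induction t with
  | app r j t ih => exact ih
  | _ => rfl

theorem Fml.mem_bases_prime {φ : Fml} {t : STerm} (h : t ∈ φ.prime.bases) :
    ∃ u ∈ φ.bases, t = u.prime := by
  induction φ with
  | tru => simp [Fml.prime, Fml.bases] at h
  | fls => simp [Fml.prime, Fml.bases] at h
  | eq a b =>
    simp only [Fml.prime, Fml.bases, List.mem_cons, List.not_mem_nil, or_false,
      STerm.base_prime] at h
    rcases h with rfl | rfl
    · exact ⟨a.base, by simp [Fml.bases], rfl⟩
    · exact ⟨b.base, by simp [Fml.bases], rfl⟩
  | neg φ ih => exact ih h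
  | and φ ψ ih₁ ih₂ =>
    rcases List.mem_append.1 h with h | h
    · obtain ⟨u, hu, e⟩ := ih₁ h
      exact ⟨u, List.mem_append_left _ hu, e⟩
    · obtain ⟨u, hu, e⟩ := ih₂ h
      exact ⟨u, List.mem_append_right _ hu, e⟩
  | or φ ψ ih₁ ih₂ =>
    rcases List.mem_append.1 h with h | h
    · obtain ⟨u, hu, e⟩ := ih₁ h
      exact ⟨u, List.mem_append_left _ hu, e⟩
    · obtain ⟨u, hu, e⟩ := ih₂ h
      exact ⟨u, List.mem_append_right _ hu, e⟩

/-- The disjunction of the transition formulas. -/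
def SAS.transFml (sys : SAS) : Fml := .bigOr (sys.trans.map (Trans.fml sys.vars))

structure SAS.WF (D : Schema) (sys : SAS) : Prop where
  initial : sys.initial.WF D
  trans : sys.transFml.WF D

/-- The formula computed in the `n`-th round of backward search from `χ`. -/
def SAS.iter (sys : SAS) (be : Backend) (χ : Fml) : ℕ → Fml
  | 0 => be.qe χ
  | n + 1 => be.qe (sys.pre (sys.iter be χ n))

/-- The disjunction of the formulas computed in the first `n` rounds. -/
def SAS.visited (sys : SAS) (be : Backend) (χ : Fml) : ℕ → Fml
  | 0 => .fls
  | n + 1 => .or (sys.iter be χ n) (sys.visited be χ n)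

/-- A state satisfying `χ`, with its quantified variables, is reached in `n` transitions. -/
def SAS.ReachesIn {D : Schema} (sys : SAS) (χ : Fml) (A : TModel D) : ℕ → (SVar → A.U) → Prop
  | 0, α => ∃ β, A.Sorted β ∧ (∀ x, x.isCur = true → β x = α x) ∧ A.Sat β χ
  | n + 1, α => ∃ β, A.Sorted β ∧ (∀ x, x.isCur = true → β x = α x) ∧ A.Sat β sys.transFml ∧
      sys.ReachesIn χ A n (primed β)

theorem SAS.wf_pre {D : Schema} {sys : SAS} (hsys : sys.WF D) {φ : Fml} (hφ : φ.WF D) :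
    (sys.pre φ).WF D := ⟨hsys.trans, Fml.wf_prime hφ⟩

section Search

variable {D : Schema} {sys : SAS} {be : Backend} {χ : Fml}

theorem SAS.iter_wf (hsys : sys.WF D) (hbe : be.Correct D) (hχ : χ.WF D) (n : ℕ) :
    (sys.iter be χ n).WF D ∧ (sys.iter be χ n).IsState := by
  induction n with
  | zero => exact hbe.qe_wf χ hχ
  | succ n ih => exact hbe.qe_wf _ (SAS.wf_pre hsys ih.1)

theorem SAS.visited_wf (hsys : sys.WF D) (hbe : be.Correct D) (hχ : χ.WF D) (n : ℕ) :
    (sys.visited be χ n).WF D := by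
  induction n with
  | zero => trivial
  | succ n ih => exact ⟨(SAS.iter_wf hsys hbe hχ n).1, ih⟩

theorem SAS.sat_iter (hsys : sys.WF D) (hbe : be.Correct D) (hχ : χ.WF D) {A : TModel D}
    (hA : A.ExClosed) (n : ℕ) {α : SVar → A.U} (hα : A.Sorted α) :
    A.Sat α (sys.iter be χ n) ↔ sys.ReachesIn χ A n α := by
  induction n generalizing α with
  | zero => exact hbe.qe_iff χ hχ A hA α hα
  | succ n ih =>
    have hwf := SAS.iter_wf hsys hbe hχ n
    refine (hbe.qe_iff _ (SAS.wf_pre hsys hwf.1) A hA α hα).trans ?_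
    refine exists_congr fun β => and_congr_right fun hβ => and_congr_right fun _ => ?_
    refine and_congr Iff.rfl ?_
    rw [TModel.sat_prime, ih hβ.primed]

theorem SAS.sat_visited {A : TModel D} {α : SVar → A.U} (n : ℕ) :
    A.Sat α (sys.visited be χ n) ↔ ∃ i < n, A.Sat α (sys.iter be χ i) := by
  induction n with
  | zero => simp [SAS.visited, TModel.Sat]
  | succ n ih =>
    simp only [SAS.visited, TModel.Sat, ih, Nat.lt_succ_iff_lt_or_eq]
    constructor
    · rintro (h | ⟨i, hi, h⟩)
      exacts [⟨n, .inr rfl, h⟩, ⟨i, .inl hi, h⟩]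
    · rintro ⟨i, hi | rfl, h⟩
      exacts [.inr ⟨i, hi, h⟩, .inl h]

theorem TModel.Embeds.eval {A B : TModel D} {h : A.U → B.U} (hh : A.Embeds B h) {α : SVar → A.U}
    (hα : A.Sorted α) {t : STerm} {τ : Ty} (ht : t.ty D = some τ) :
    B.eval (fun x => h (α x)) t = h (A.eval α t) := by
  induction t generalizing τ with
  | var x => rfl
  | const σ c =>
    cases c with
    | none => exact (hh.undef σ).symm
    | some k =>
      simp only [STerm.ty] at ht
      split_ifs at ht with hc
      exact (hh.cst σ k hc).symm
  | app r j t ih =>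
    obtain ⟨R, hR, h', hj⟩ := STerm.ty_app_iff.1 ht
    simp only [TModel.eval, ih h']
    exact (hh.fn r j R τ _ hR hj (A.sort_eval hα h')).symm

theorem TModel.Embeds.sat {A B : TModel D} {h : A.U → B.U} (hh : A.Embeds B h) {α : SVar → A.U}
    (hα : A.Sorted α) {φ : Fml} (hφ : φ.WF D) :
    B.Sat (fun x => h (α x)) φ ↔ A.Sat α φ := by
  rw [TModel.sat_iff_holds, TModel.sat_iff_holds]
  refine Fml.holds_congr hφ fun a b τ ha hb _ _ => ?_
  rw [hh.eval hα ha, hh.eval hα hb]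
  exact ⟨hh.inj τ _ _ (A.sort_eval hα ha) (A.sort_eval hα hb), fun e => by rw [e]⟩

theorem TModel.Embeds.sorted {A B : TModel D} {h : A.U → B.U} (hh : A.Embeds B h)
    {α : SVar → A.U} (hα : A.Sorted α) : B.Sorted fun x => h (α x) :=
  fun x => hh.sort _ _ (hα x)

theorem SAS.ReachesIn.embed (hsys : sys.WF D) (hχ : χ.WF D) {A B : TModel D} {h : A.U → B.U}
    (hh : A.Embeds B h) {n : ℕ} {α : SVar → A.U} (hr : sys.ReachesIn χ A n α) :
    sys.ReachesIn χ B n fun x => h (α x) := by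
  induction n generalizing α with
  | zero =>
    obtain ⟨β, hβ, hcur, hsat⟩ := hr
    exact ⟨_, hh.sorted hβ, fun x hx => by rw [hcur x hx], (hh.sat hβ hχ).2 hsat⟩
  | succ n ih =>
    obtain ⟨β, hβ, hcur, hsat, hr⟩ := hr
    exact ⟨_, hh.sorted hβ, fun x hx => by rw [hcur x hx], (hh.sat hβ hsys.trans).2 hsat, ih hr⟩

theorem TSat.exClosed (hD : D.WF) (hac : D.Acyclic) {φ : Fml} (hφ : φ.WF D) (h : TSat D φ) :
    ∃ (A : TModel D) (α : SVar → A.U), A.ExClosed ∧ A.Sorted α ∧ A.Sat α φ := by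
  obtain ⟨A, α, hα, hsat⟩ := h
  have hh := A.embeds_ext hD
  exact ⟨A.ext hD, _, A.ext_exClosed hD hac, hh.sorted hα, (hh.sat hα hφ).2 hsat⟩

theorem ty_mem_of_base_mem {B : List STerm} {T : List Ty}
    (hB : ∀ t ∈ B, ∀ τ, t.ty D = some τ → τ ∈ T) (hcat : ∀ R ∈ D.cat, ∀ τ ∈ R.attrs, τ ∈ T)
    {t : STerm} {τ : Ty} (ht : t.ty D = some τ)
    (hb : t.base ∈ B ++ T.map fun τ => STerm.const τ none) : τ ∈ T := by
  have key : ∀ u ∈ B ++ T.map fun τ => STerm.const τ none, ∀ τ, u.ty D = some τ → τ ∈ T := by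
    intro u hu τ hτ
    rcases List.mem_append.1 hu with hu | hu
    · exact hB u hu τ hτ
    · obtain ⟨σ, hσ, rfl⟩ := List.mem_map.1 hu
      simp only [STerm.ty, Option.some.injEq] at hτ
      exact hτ ▸ hσ
  cases t with
  | var x => exact key _ hb τ ht
  | const σ c => exact key _ hb τ ht
  | app r j t =>
    obtain ⟨R, hR, -, hj⟩ := STerm.ty_app_iff.1 ht
    exact hcat R (List.mem_of_getElem? hR) τ (List.mem_of_getElem? hj)

/-- With the reference backend, all formulas computed by backward search are over finitely many
variables and constants. -/
theorem exists_finite_bases (hac : D.Acyclic) (hD : D.WF) (hsys : sys.WF D) (hχ : χ.WF D) :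
    ∃ X : List STerm, ∀ n, ∀ t ∈ (sys.iter (refBackend D) χ n).bases, t ∈ X := by
  let B : List STerm := sys.transFml.bases ++ basesWithIds D χ
  let T : List Ty := B.filterMap (STerm.ty D) ++ D.cat.flatMap CatRel.attrs
  let X : List STerm := B ++ T.map fun τ => STerm.const τ none
  have hids : ∀ p ∈ D.idConsts, STerm.const (.ident p.1) (some p.2) ∈ X := fun p hp =>
    List.mem_append_left _ (List.mem_append_right _ (List.mem_append_right _
      (List.mem_map.2 ⟨p, hp, rfl⟩)))
  have hqe : ∀ ψ : Fml, ψ.WF D → (∀ t ∈ ψ.bases, t.isCur = true → t ∈ X) →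
      ∀ t ∈ ((refBackend D).qe ψ).bases, t ∈ X := by
    intro ψ hψ hX t ht
    simp only [refBackend, Fml.mem_bases_bigOr, List.mem_map] at ht
    obtain ⟨_, ⟨l, -, rfl⟩, ht⟩ := ht
    have hbase : ∀ u ∈ (termsOf D ψ).filter STerm.isCur, u.base ∈ X := by
      intro u hu
      obtain ⟨hu, hc⟩ := List.mem_filter.1 hu
      rcases List.mem_append.1 ((mem_termsOf hac hψ).1 hu).1 with h | h
      · exact hX _ h (by rwa [STerm.isCur_base])
      · obtain ⟨p, hp, h⟩ := List.mem_map.1 h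
        exact h ▸ hids p hp
    rcases bases_diagram ht with ⟨u, hu, rfl⟩ | ⟨u, hu, τ, hτ, rfl⟩
    · exact hbase u hu
    · refine List.mem_append_right _ (List.mem_map.2 ⟨τ, ?_, rfl⟩)
      refine ty_mem_of_base_mem (D := D) (B := B) ?_ ?_ hτ (hbase u hu)
      · exact fun t ht τ hτ => List.mem_append_left _ (List.mem_filterMap.2 ⟨t, ht, hτ⟩)
      · exact fun R hR τ hτ => List.mem_append_right _ (List.mem_flatMap.2 ⟨R, hR, hτ⟩)
  refine ⟨X, fun n => ?_⟩
  induction n with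
  | zero =>
    refine hqe χ hχ fun t ht _ => ?_
    exact List.mem_append_left _ (List.mem_append_right _ (List.mem_append_left _ ht))
  | succ n ih =>
    have hwf := SAS.iter_wf hsys (refBackend_correct hD hac) hχ n
    refine hqe _ (SAS.wf_pre hsys hwf.1) fun t ht hc => ?_
    rcases List.mem_append.1 ht with ht | ht
    · exact List.mem_append_left _ (List.mem_append_left _ ht)
    · obtain ⟨u, hu, rfl⟩ := Fml.mem_bases_prime ht
      have hu' := (Fml.bases_isSome hwf.1 u hu).1
      have hcur := hwf.2 u hu
      cases u with
      | var x =>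
        exfalso
        obtain ⟨name, ty⟩ := x
        cases name <;> simp_all [STerm.isCur, STerm.base, STerm.prime, SVar.isCur, SName.prime]
      | const τ c => exact ih _ hu
      | app r j u =>
        exfalso
        have := congrArg STerm.rels hu'
        have h : ∀ t : STerm, t.base.rels = [] := fun t => by
          induction t with
          | app r j t ih => exact ih
          | _ => rfl
        rw [h] at this
        simp [STerm.rels] at this

theorem SAS.search_terminates (hac : D.Acyclic) (hD : D.WF) (hsys : sys.WF D)
    (hbe : be.Correct D) (hχ : χ.WF D) :
    ∃ n, be.sat (.and (sys.iter be χ n) (.neg (sys.visited be χ n))) = false := by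
  by_contra hcon
  have hwf : ∀ n, (Fml.and (sys.iter be χ n) (.neg (sys.visited be χ n))).WF D := fun n =>
    ⟨(SAS.iter_wf hsys hbe hχ n).1, SAS.visited_wf hsys hbe hχ n⟩
  have hsat : ∀ n, ∃ (A : TModel D) (α : SVar → A.U), A.ExClosed ∧ A.Sorted α ∧
      A.Sat α (.and (sys.iter be χ n) (.neg (sys.visited be χ n))) := by
    intro n
    refine ((hbe.sat_iff _ (hwf n)).1 ?_).exClosed hD hac (hwf n)
    by_contra h
    exact hcon ⟨n, by simpa using h⟩
  choose A α hA hα hsat using hsat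
  have href := refBackend_correct hD hac
  have heq : ∀ n i, (A n).Sat (α n) (sys.iter be χ i) ↔
      (A n).Sat (α n) (sys.iter (refBackend D) χ i) := fun n i => by
    rw [SAS.sat_iter hsys hbe hχ (hA n) i (hα n), SAS.sat_iter hsys href hχ (hA n) i (hα n)]
  obtain ⟨X, hX⟩ := exists_finite_bases hac hD hsys hχ
  have hT := termsOver_finite hac X.finite_toSet
  let T := termsOver D {t | t ∈ X}
  let f : ℕ → Set (STerm × STerm) := fun n =>
    {p | p ∈ T ×ˢ T ∧ (A n).eval (α n) p.1 = (A n).eval (α n) p.2}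
  have hne : ∀ i n, i < n → f i ≠ f n := by
    intro i n hin he
    have h₁ : (A i).Sat (α i) (sys.iter (refBackend D) χ i) := (heq i i).1 (hsat i).1
    have h₂ : ¬ (A n).Sat (α n) (sys.iter (refBackend D) χ i) := fun h =>
      (hsat n).2 ((SAS.sat_visited n).2 ⟨i, hin, (heq n i).2 h⟩)
    rw [TModel.sat_iff_holds] at h₁ h₂
    refine h₂ ((Fml.holds_congr (SAS.iter_wf hsys href hχ i).1 ?_).1 h₁)
    intro a b τ ha hb ha' hb'
    have ha₁ : a ∈ T := ⟨hX i _ ha', by simp [ha]⟩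
    have hb₁ : b ∈ T := ⟨hX i _ hb', by simp [hb]⟩
    have := Set.ext_iff.1 he (a, b)
    simpa [f, ha₁, hb₁] using this
  have hinj : Function.Injective f := by
    intro i n h
    rcases lt_trichotomy i n with h' | h' | h'
    · exact absurd h (hne i n h')
    · exact h'
    · exact absurd h.symm (hne n i h')
  refine Set.infinite_range_of_injective hinj ((hT.prod hT).finite_subsets.subset ?_)
  rintro _ ⟨n, rfl⟩
  exact fun p hp => hp.1

theorem SAS.search_shift (N k : ℕ)
    (h : ∀ i < N, be.sat (.and (sys.iter be χ i) (.neg (sys.visited be χ i))) ≠ false ∧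
      be.sat (.and sys.initial (sys.iter be χ i)) ≠ true) :
    sys.search be (N + k) (sys.iter be χ 0) (sys.visited be χ 0) =
      sys.search be k (sys.iter be χ N) (sys.visited be χ N) := by
  induction N generalizing k with
  | zero => simp
  | succ N ih =>
    rw [show N + 1 + k = N + (k + 1) by omega, ih (k + 1) fun i hi => h i (by omega)]
    obtain ⟨h₁, h₂⟩ := h N (by omega)
    rw [SAS.search, if_neg h₁, if_neg h₂]
    rfl

/-- Backward search terminates and decides reachability in existentially closed models. -/
theorem SAS.search_correct (hac : D.Acyclic) (hD : D.WF) (hsys : sys.WF D) (hbe : be.Correct D)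
    (hχ : χ.WF D) :
    ∃ b : Bool, (∃ n, sys.search be n (be.qe χ) .fls = some b) ∧
      (b = true ↔ ∃ (A : TModel D) (α : SVar → A.U) (n : ℕ), A.ExClosed ∧ A.Sorted α ∧
        A.Sat α sys.initial ∧ sys.ReachesIn χ A n α) := by
  classical
  obtain ⟨n₀, hn₀⟩ := SAS.search_terminates hac hD hsys hbe hχ
  have hex : ∃ n, be.sat (.and (sys.iter be χ n) (.neg (sys.visited be χ n))) = false ∨
      be.sat (.and sys.initial (sys.iter be χ n)) = true := ⟨n₀, .inl hn₀⟩
  let N := Nat.find hex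
  have hN := Nat.find_spec hex
  have hmin : ∀ i < N, be.sat (.and (sys.iter be χ i) (.neg (sys.visited be χ i))) ≠ false ∧
      be.sat (.and sys.initial (sys.iter be χ i)) ≠ true := fun i hi => by
    have := Nat.find_min hex hi
    push Not at this
    exact this
  have hwf : ∀ n, (Fml.and (sys.iter be χ n) (.neg (sys.visited be χ n))).WF D := fun n =>
    ⟨(SAS.iter_wf hsys hbe hχ n).1, SAS.visited_wf hsys hbe hχ n⟩
  have hwf' : ∀ n, (Fml.and sys.initial (sys.iter be χ n)).WF D := fun n =>
    ⟨hsys.initial, (SAS.iter_wf hsys hbe hχ n).1⟩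
  have hsearch : sys.search be (N + 1) (be.qe χ) .fls =
      sys.search be 1 (sys.iter be χ N) (sys.visited be χ N) := SAS.search_shift N 1 hmin
  by_cases hcase : be.sat (.and (sys.iter be χ N) (.neg (sys.visited be χ N))) = false
  · refine ⟨false, ⟨N + 1, by rw [hsearch, SAS.search, if_pos hcase]⟩, ?_⟩
    simp only [Bool.false_eq_true, false_iff]
    rintro ⟨A, α, n, hA, hα, hinit, hr⟩
    have hN' : ∀ γ : SVar → A.U, A.Sorted γ → sys.ReachesIn χ A N γ →
        ∃ i < N, sys.ReachesIn χ A i γ := by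
      intro γ hγ hr
      by_contra hno
      have : be.sat (.and (sys.iter be χ N) (.neg (sys.visited be χ N))) = true := by
        refine (hbe.sat_iff _ (hwf N)).2 ⟨A, γ, hγ, (SAS.sat_iter hsys hbe hχ hA N hγ).2 hr, ?_⟩
        intro hv
        obtain ⟨i, hi, h⟩ := (SAS.sat_visited N).1 hv
        exact hno ⟨i, hi, (SAS.sat_iter hsys hbe hχ hA i hγ).1 h⟩
      rw [hcase] at this
      simp at this
    have key : ∀ n (γ : SVar → A.U), A.Sorted γ → sys.ReachesIn χ A n γ →
        ∃ i < N, sys.ReachesIn χ A i γ := by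
      have hle : ∀ i (γ : SVar → A.U), i ≤ N → A.Sorted γ → sys.ReachesIn χ A i γ →
          ∃ i < N, sys.ReachesIn χ A i γ := by
        intro i γ hi hγ hr
        rcases hi.lt_or_eq with hi | rfl
        · exact ⟨i, hi, hr⟩
        · exact hN' γ hγ hr
      intro n
      induction n with
      | zero => exact fun γ hγ hr => hle 0 γ (Nat.zero_le _) hγ hr
      | succ n ih =>
        rintro γ hγ ⟨β, hβ, hcur, htr, hr⟩
        obtain ⟨i, hi, hr'⟩ := ih _ hβ.primed hr
        exact hle (i + 1) γ hi hγ ⟨β, hβ, hcur, htr, hr'⟩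
    obtain ⟨i, hi, hr'⟩ := key n α hα hr
    exact (hmin i hi).2 ((hbe.sat_iff _ (hwf' i)).2
      ⟨A, α, hα, hinit, (SAS.sat_iter hsys hbe hχ hA i hα).2 hr'⟩)
  · have hyes := hN.resolve_left hcase
    refine ⟨true, ⟨N + 1, by rw [hsearch, SAS.search, if_neg hcase, if_pos hyes]⟩, ?_⟩
    simp only [true_iff]
    obtain ⟨A, α, hA, hα, hsat⟩ :=
      ((hbe.sat_iff _ (hwf' N)).1 hyes).exClosed hD hac (hwf' N)
    exact ⟨A, α, N, hA, hα, hsat.1, (SAS.sat_iter hsys hbe hχ hA N hα).1 hsat.2⟩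

/-- A run needs finitely many assignments only, and is preserved by maps that preserve the
relevant formulas under them. -/
theorem SAS.ReachesIn.exists_assignments {A : TModel D} {n : ℕ} {α : SVar → A.U}
    (hr : sys.ReachesIn χ A n α) :
    ∃ L : List (SVar → A.U), (∀ β ∈ L, A.Sorted β) ∧
      ∀ (B : TModel D) (g : Ty → A.U → B.U), (∀ τ u, B.sort τ (g τ u)) →
        (∀ β ∈ L, A.Sat β χ → B.Sat (fun x => g x.ty (β x)) χ) →
        (∀ β ∈ L, A.Sat β sys.transFml → B.Sat (fun x => g x.ty (β x)) sys.transFml) →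
        sys.ReachesIn χ B n fun x => g x.ty (α x) := by
  induction n generalizing α with
  | zero =>
    obtain ⟨β, hβ, hcur, hsat⟩ := hr
    refine ⟨[β], by simpa using hβ, fun B g hg h₁ _ => ?_⟩
    exact ⟨_, fun x => hg _ _, fun x hx => by rw [hcur x hx], h₁ β (by simp) hsat⟩
  | succ n ih =>
    obtain ⟨β, hβ, hcur, hsat, hr⟩ := hr
    obtain ⟨L, hL, h⟩ := ih hr
    refine ⟨β :: L, by simpa using ⟨hβ, hL⟩, fun B g hg h₁ h₂ => ?_⟩
    exact ⟨_, fun x => hg _ _, fun x hx => by rw [hcur x hx], h₂ β (by simp) hsat,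
      h B g hg (fun β hβ => h₁ β (List.mem_cons_of_mem _ hβ))
        fun β hβ => h₂ β (List.mem_cons_of_mem _ hβ)⟩

/-- A part of a model that is given by finitely many assignments is realized in a catalog
instance. -/
theorem exists_catInst_of_assignments (hac : D.Acyclic) (hD : D.WF) (A : TModel D)
    (L : List (SVar → A.U)) (hL : ∀ β ∈ L, A.Sorted β) (hne : L ≠ []) (X : List STerm) :
    ∃ (I : CatInst) (hI : I.Valid D) (g : Ty → A.U → Val), (∀ τ u, (I.model hD hI).sort τ (g τ u)) ∧
      ∀ β ∈ L, ∀ φ : Fml, φ.WF D → (∀ t ∈ φ.bases, t ∈ X) →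
        (A.Sat β φ ↔ (I.model hD hI).Sat (fun x => g x.ty (β x)) φ) := by
  classical
  let Y : Set STerm :=
    {t | t ∈ X ++ D.idConsts.map fun p => STerm.const (.ident p.1) (some p.2)}
  have hY : Y.Finite := List.finite_toSet _
  let F : Set (Ty × A.U) := {p | ∃ β ∈ L, p ∈ A.valuesOver β Y}
  have hF : F.Finite := by
    have : F = ⋃ β ∈ {β | β ∈ L}, A.valuesOver β Y := by
      ext p
      simp [F]
    rw [this]
    exact L.finite_toSet.biUnion fun β _ => A.valuesOver_finite hac β hY
  have hs : ∀ p ∈ F, A.sort p.1 p.2 := by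
    rintro p ⟨β, hβ, hp⟩
    exact A.valuesOver_sort (hL β hβ) hp
  have hcl : ∀ (r : ℕ) (R : CatRel) (j : ℕ) (τ : Ty) (u : A.U), D.cat[r]? = some R →
      R.attrs[j]? = some τ → (.ident R.idTy, u) ∈ F → (τ, A.fn r j u) ∈ F := by
    rintro r R j τ u hR hj ⟨β, hβ, hp⟩
    exact ⟨β, hβ, A.valuesOver_fn hR hj hp⟩
  let K : Set (Ty × ℕ) := {p | STerm.const p.1 (some p.2) ∈ Y ∧ D.constOk p.1 p.2 = true}
  have hK : K.Finite := by
    have hinj : Function.Injective fun p : Ty × ℕ => STerm.const p.1 (some p.2) := by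
      rintro ⟨a, b⟩ ⟨c, d⟩ h
      simpa using h
    exact (hY.preimage hinj.injOn).subset fun p hp => hp.1
  obtain ⟨b, hb⟩ := (hK.image Prod.snd).bddAbove
  obtain ⟨ν, hν₁, hν₂, hν₃, hν₄⟩ := exists_names A hF hs (b := b + 1) le_rfl K fun p hp =>
    ⟨hp.2, Nat.lt_succ_of_le (hb ⟨p, hp, rfl⟩)⟩
  have hid : ∀ p ∈ D.idConsts, (Ty.ident p.1, p.2) ∈ K := fun p hp =>
    ⟨List.mem_append_right _ (List.mem_map.2 ⟨p, hp, rfl⟩), constOk_idConsts hp⟩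
  obtain ⟨I, hI, hI₁, hI₂⟩ := exists_catInst hD hF Prod.fst
    (fun r j p => (((D.cat[r]?).bind fun R => R.attrs[j]?).getD lifeTy, A.fn r j p.2))
    (fun p => ν p.1 p.2)
    (by
      rintro ⟨σ, u⟩ hp r R j τ hR hj hσ
      simp only at hσ
      subst hσ
      simp only [hR, hj, Option.bind_some, Option.getD_some]
      refine ⟨hcl r R j τ u hR hj hp, trivial, ?_⟩
      rw [hν₁, hν₁]
      exact A.fn_undef r j R τ u hR hj (hs _ hp))
    (by
      rintro ⟨σ, u⟩ hp ⟨σ', u'⟩ hp' r R j τ hR hj hσ hσ' he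
      simp only at hσ hσ' he
      subst hσ hσ'
      rw [hν₂ _ u u' hp hp' he])
    (fun p hp k hk => (hν₃ p.1 p.2 k hp hk).1)
    (fun p hp => by
      obtain ⟨β, hβ⟩ := List.exists_mem_of_ne_nil L hne
      refine ⟨(.ident p.1, A.cst (.ident p.1) p.2), ⟨β, hβ, .const (.ident p.1) (some p.2),
        ⟨(hid p hp).1, ?_⟩, ?_, rfl⟩, rfl, hν₄ _ (hid p hp)⟩ <;>
        simp [STerm.ty, constOk_idConsts hp])
  let g : Ty → A.U → Val := fun τ u => if (τ, u) ∈ F then ν τ u else none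
  have hg : ∀ τ u, (τ, u) ∈ F → g τ u = ν τ u := fun τ u h => by simp [g, h]
  refine ⟨I, hI, g, ?_, ?_⟩
  · intro τ u
    by_cases h : (τ, u) ∈ F
    · rw [hg τ u h]
      exact hI₁ _ h
    · simp only [g, h, if_false]
      exact (I.model hD hI).undef_sort τ
  · intro β hβ φ hφ hX
    have hmem : ∀ t ∈ termsOver D Y, ∀ τ, t.ty D = some τ → (τ, A.eval β t) ∈ F :=
      fun t ht τ hτ => ⟨β, hβ, t, ht, hτ, rfl⟩
    have heval : ∀ t ∈ termsOver D Y, ∀ τ, t.ty D = some τ →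
        (I.model hD hI).eval (fun x => g x.ty (β x)) t = ν τ (A.eval β t) := by
      intro t ht τ hτ
      induction t generalizing τ with
      | var x =>
        have := hmem _ ht τ hτ
        simp only [STerm.ty, Option.some.injEq] at hτ
        subst hτ
        exact hg _ _ this
      | const σ c =>
        cases c with
        | none =>
          simp only [STerm.ty, Option.some.injEq] at hτ
          subst hτ
          exact ((hν₁ _ _).2 rfl).symm
        | some k =>
          simp only [STerm.ty] at hτ
          split_ifs at hτ with hc
          simp only [Option.some.injEq] at hτ
          subst hτ
          exact (hν₄ (σ, k) ⟨ht.1, hc⟩).symm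
      | app r j t ih =>
        obtain ⟨R, hR, h', hj⟩ := STerm.ty_app_iff.1 hτ
        have ht' : t ∈ termsOver D Y := ⟨ht.1, by simp [h']⟩
        simp only [TModel.eval]
        rw [ih ht' _ h']
        have := hI₂ _ (hmem t ht' _ h') r R j τ hR hj rfl
        simpa [hR, hj] using this
    rw [TModel.sat_iff_holds, TModel.sat_iff_holds]
    refine Fml.holds_congr hφ fun a b τ ha hb ha' hb' => ?_
    have ha₁ : a ∈ termsOver D Y := ⟨List.mem_append_left _ (hX _ ha'), by simp [ha]⟩
    have hb₁ : b ∈ termsOver D Y := ⟨List.mem_append_left _ (hX _ hb'), by simp [hb]⟩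
    rw [heval a ha₁ τ ha, heval b hb₁ τ hb]
    exact ⟨fun h => by rw [h], hν₂ τ _ _ (hmem a ha₁ τ ha) (hmem b hb₁ τ hb)⟩

/-- Backward search decides reachability in models given by catalog instances. -/
theorem SAS.search_correct_catInst (hac : D.Acyclic) (hD : D.WF) (hsys : sys.WF D)
    (hbe : be.Correct D) (hχ : χ.WF D) :
    ∃ b : Bool, (∃ n, sys.search be n (be.qe χ) .fls = some b) ∧
      (b = true ↔ ∃ (I : CatInst) (hI : I.Valid D) (α : SVar → Val) (n : ℕ),
        (I.model hD hI).Sorted α ∧ (I.model hD hI).Sat α sys.initial ∧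
        sys.ReachesIn χ (I.model hD hI) n α) := by
  obtain ⟨b, hb, h⟩ := SAS.search_correct hac hD hsys hbe hχ
  refine ⟨b, hb, h.trans ⟨?_, ?_⟩⟩
  · rintro ⟨A, α, n, -, hα, hinit, hr⟩
    obtain ⟨L, hL, hmap⟩ := hr.exists_assignments
    obtain ⟨I, hI, g, hg, hsat⟩ := exists_catInst_of_assignments hac hD A (α :: L)
      (by simpa using ⟨hα, hL⟩) (by simp) (sys.initial.bases ++ sys.transFml.bases ++ χ.bases)
    refine ⟨I, hI, fun x => g x.ty (α x), n, fun x => hg _ _, ?_, ?_⟩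
    · exact (hsat α (by simp) _ hsys.initial fun t ht => by simp [ht]).1 hinit
    · refine hmap (I.model hD hI) g hg (fun β hβ => ?_) fun β hβ => ?_
      · exact (hsat β (List.mem_cons_of_mem _ hβ) _ hχ fun t ht => by simp [ht]).1
      · exact (hsat β (List.mem_cons_of_mem _ hβ) _ hsys.trans fun t ht => by simp [ht]).1
  · rintro ⟨I, hI, α, n, hα, hinit, hr⟩
    have hh := (I.model hD hI).embeds_ext hD
    exact ⟨_, _, n, (I.model hD hI).ext_exClosed hD hac, hh.sorted hα,
      (hh.sat hα hsys.initial).2 hinit, hr.embed hsys hχ hh⟩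

end Search

/-! ## Well-formedness of lifecycle rules -/

/-- The data part is well-formed, and the bindings that it reads are stored by a rule in `L`. -/
def Act.OK (D : Schema) (L : List Rule) : Act → Prop
  | .skip => True
  | .test φ => φ.WF D
  | .exec u => u.WF D
  | .bind _ g => g.WF D 0
  | .release b ss => ∃ g : Guard, (∃ ρ ∈ L, ρ.act = .bind b g) ∧ g.WF D 0 ∧ SetsWF D g.head ss

/-- The rule is about blocks with numbers below `N`, and its data part is well-formed. -/
def Rule.OK (D : Schema) (N : ℕ) (L : List Rule) (ρ : Rule) : Prop :=
  (∀ p ∈ ρ.pre, p.1 < N) ∧ (∀ p ∈ ρ.post, p.1 < N) ∧ ρ.act.OK D L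

/-- The block with the given number and size is nonempty and within the first `N` blocks. -/
def Within (N : ℕ) (p : ℕ × ℕ) : Prop := 1 ≤ p.2 ∧ p.1 + p.2 ≤ N

def Ctx.Within (N : ℕ) (C : Ctx) : Prop :=
  DataAwareBPMN.Within N C.root ∧ DataAwareBPMN.Within N C.inner ∧
    ∀ h ∈ C.handlers, DataAwareBPMN.Within N h.2

theorem Block.one_le_size (b : Block) : 1 ≤ b.size := by
  cases b <;> simp [Block.size]

theorem interrupt_lt {N : ℕ} {p : ℕ × ℕ} {q : LState} (hp : Within N p) :
    ∀ x ∈ interrupt p q, x.1 < N := by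
  obtain ⟨h₁, h₂⟩ := hp
  intro x hx
  simp only [interrupt, List.mem_cons, List.mem_map, List.mem_range] at hx
  rcases hx with rfl | ⟨i, hi, rfl⟩
  · dsimp only
    omega
  · dsimp only
    omega

theorem mem_of_lookup_eq_some {X Y : Type*} [BEq X] [LawfulBEq X] {l : List (X × Y)} {x : X}
    {y : Y} (h : l.lookup x = some y) : (x, y) ∈ l := by
  induction l with
  | nil => simp at h
  | cons p l ih =>
    obtain ⟨a, b⟩ := p
    rw [List.lookup_cons] at h
    by_cases hx : x = a
    · subst hx
      simp only [beq_self_eq_true, Option.some.injEq] at h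
      simp [h]
    · simp only [beq_eq_false_iff_ne.2 hx] at h
      exact List.mem_cons_of_mem _ (ih h)

theorem Ctx.leave_lt {N : ℕ} {C : Ctx} (hC : C.Within N) (e : EndKind) :
    ∀ x ∈ C.leave e, x.1 < N := by
  cases e with
  | plain => exact interrupt_lt hC.2.1
  | error l =>
    simp only [Ctx.leave]
    split
    · next p hp => exact interrupt_lt (hC.2.2 _ (mem_of_lookup_eq_some hp))
    · exact interrupt_lt hC.1

theorem Ctx.guardWith_within {N : ℕ} {C : Ctx} (hC : C.Within N) (e : Boundary) {p : ℕ × ℕ}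
    (hp : DataAwareBPMN.Within N p) : (C.guardWith e p).Within N := by
  cases e with
  | external => exact hC
  | error l =>
    refine ⟨hC.1, hC.2.1, ?_⟩
    intro h hh
    rcases List.mem_cons.1 hh with rfl | hh
    exacts [hp, hC.2.2 h hh]

theorem trigger_ok {D : Schema} {N : ℕ} {L : List Rule} (e : Boundary) {p : ℕ × ℕ}
    (hp : Within N p) : ∀ ρ ∈ trigger e p, ρ.OK D N L := by
  have h := hp.1
  have h' := hp.2
  cases e with
  | external =>
    simp only [trigger, List.forall_mem_cons, List.not_mem_nil, false_imp_iff, implies_true,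
      and_true, Rule.OK, Act.OK]
    exact ⟨⟨by omega, interrupt_lt hp⟩, ⟨by omega, interrupt_lt hp⟩⟩
  | error l => simp [trigger]

theorem Block.rules_ok {D : Schema} {N : ℕ} {L : List Rule} (b : Block) (C : Ctx) (n : ℕ)
    (hwf : b.WF D) (hC : C.Within N) (hn : n + b.size ≤ N) (hL : b.rules C n ⊆ L) :
    ∀ ρ ∈ b.rules C n, ρ.OK D N L := by
  induction b generalizing C n with
  | empty =>
    simp only [Block.size] at hn
    simp [Block.rules, Rule.OK, Act.OK]
    omega
  | task u =>
    simp only [Block.size] at hn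
    simp [Block.rules, Rule.OK, Act.OK, show u.WF D from hwf]
    omega
  | event u =>
    simp only [Block.size] at hn
    simp [Block.rules, Rule.OK, Act.OK, show u.WF D from hwf]
    omega
  | longTask g ss =>
    simp only [Block.size] at hn
    simp only [Block.rules, List.forall_mem_cons, List.not_mem_nil, false_imp_iff, implies_true,
      and_true, Rule.OK, Act.OK]
    exact ⟨⟨by omega, by omega, hwf.1⟩, by omega, by omega, g,
      ⟨⟨[(n, .enabled)], .bind n g, [(n, .active)]⟩, hL List.mem_cons_self, rfl⟩, hwf⟩
  | possibleCompl φ₁ φ₂ e =>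
    simp only [Block.size] at hn
    simp only [Block.rules, List.forall_mem_cons, List.not_mem_nil, false_imp_iff, implies_true,
      and_true, Rule.OK, Act.OK]
    exact ⟨⟨by omega, by omega, hwf.1⟩, by omega, Ctx.leave_lt hC e, hwf.2⟩
  | proc s b f ih =>
    simp only [Block.size] at hn
    simp only [Block.rules, List.append_subset] at hL
    have h := ih { C with inner := (n, b.size + 3) } (n + 2) hwf.2.1
      ⟨hC.1, ⟨by simp, by simpa using hn⟩, hC.2.2⟩ (by omega) hL.2
    simp only [Block.rules, List.forall_mem_append, List.forall_mem_cons, List.not_mem_nil,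
      false_imp_iff, implies_true, and_true, Rule.OK, Act.OK, hwf.1, hwf.2.2]
    refine ⟨?_, h⟩
    omega
  | sub p ih =>
    simp only [Block.size] at hn
    simp only [Block.rules, List.append_subset] at hL
    have h := ih C (n + 1) hwf.2 hC (by omega) hL.2
    have := p.one_le_size
    simp only [Block.rules, List.forall_mem_append, List.forall_mem_cons, List.not_mem_nil,
      false_imp_iff, implies_true, and_true, Rule.OK, Act.OK]
    refine ⟨?_, h⟩
    omega
  | seq b₁ b₂ ih₁ ih₂ | deferred b₁ b₂ ih₁ ih₂ | par b₁ b₂ ih₁ ih₂ =>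
    simp only [Block.size] at hn
    simp only [Block.rules, List.append_subset] at hL
    have h₁ := ih₁ C (n + 1) hwf.1 hC (by omega) hL.1.2
    have h₂ := ih₂ C (n + 1 + b₁.size) hwf.2 hC (by omega) hL.2
    have := b₁.one_le_size
    have := b₂.one_le_size
    simp only [Block.rules, List.forall_mem_append, List.forall_mem_cons, List.not_mem_nil,
      false_imp_iff, implies_true, and_true, Rule.OK, Act.OK]
    refine ⟨⟨?_, h₁⟩, h₂⟩
    omega
  | xor φ₁ φ₂ b₁ b₂ ih₁ ih₂ | incl φ₁ φ₂ b₁ b₂ ih₁ ih₂ | loop φ₁ φ₂ b₁ b₂ ih₁ ih₂ =>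
    simp only [Block.size] at hn
    simp only [Block.rules, List.append_subset] at hL
    have h₁ := ih₁ C (n + 1) hwf.2.2.1 hC (by omega) hL.1.2
    have h₂ := ih₂ C (n + 1 + b₁.size) hwf.2.2.2 hC (by omega) hL.2
    have := b₁.one_le_size
    have := b₂.one_le_size
    simp only [Block.rules, List.forall_mem_append, List.forall_mem_cons, List.not_mem_nil,
      false_imp_iff, implies_true, and_true, Rule.OK, Act.OK, Cond.WF, hwf.1, hwf.2.1]
    refine ⟨⟨?_, h₁⟩, h₂⟩
    omega
  | eventChoice e₁ e₂ b₁ b₂ ih₁ ih₂ =>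
    simp only [Block.size] at hn
    simp only [Block.rules, List.append_subset] at hL
    have h₁ := ih₁ C (n + 3) hwf.2.2.1 hC (by omega) hL.1.2
    have h₂ := ih₂ C (n + 3 + b₁.size) hwf.2.2.2 hC (by omega) hL.2
    have := b₁.one_le_size
    have := b₂.one_le_size
    simp only [Block.rules, List.forall_mem_append, List.forall_mem_cons, List.not_mem_nil,
      false_imp_iff, implies_true, and_true, Rule.OK, Act.OK, hwf.1, hwf.2.1]
    refine ⟨⟨?_, h₁⟩, h₂⟩
    omega
  | backExc e a b ih₁ ih₂ =>
    simp only [Block.size] at hn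
    simp only [Block.rules, List.append_subset] at hL
    have := a.one_le_size
    have := b.one_le_size
    have hw : Within N (n + 1, a.size) := ⟨a.one_le_size, by dsimp only; omega⟩
    have h₁ := ih₁ _ (n + 1) hwf.2.1 (Ctx.guardWith_within hC e hw) (by omega) hL.1.2
    have h₂ := ih₂ C (n + 1 + a.size) hwf.2.2 hC (by omega) hL.2
    have h₃ := trigger_ok (D := D) (L := L) e hw
    simp only [Block.rules, List.forall_mem_append]
    refine ⟨⟨⟨?_, h₃⟩, h₁⟩, h₂⟩
    simp only [List.forall_mem_cons, List.not_mem_nil,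
      false_imp_iff, implies_true, and_true, Rule.OK, Act.OK]
    omega
  | fwdExc e a b₁ b₂ ih₁ ih₂ ih₃ =>
    simp only [Block.size] at hn
    simp only [Block.rules, List.append_subset] at hL
    have := a.one_le_size
    have := b₁.one_le_size
    have := b₂.one_le_size
    have hw : Within N (n + 1, a.size) := ⟨a.one_le_size, by dsimp only; omega⟩
    have h₁ := ih₁ _ (n + 1) hwf.2.1 (Ctx.guardWith_within hC e hw) (by omega) hL.1.1.2
    have h₂ := ih₂ C (n + 1 + a.size) hwf.2.2.1 hC (by omega) hL.1.2
    have h₃ := ih₃ C (n + 1 + a.size + b₁.size) hwf.2.2.2 hC (by omega) hL.2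
    have h₄ := trigger_ok (D := D) (L := L) e hw
    simp only [Block.rules, List.forall_mem_append]
    refine ⟨⟨⟨⟨?_, h₄⟩, h₁⟩, h₂⟩, h₃⟩
    simp only [List.forall_mem_cons, List.not_mem_nil,
      false_imp_iff, implies_true, and_true, Rule.OK, Act.OK]
    omega
  | nonInterrupting a b₁ b₂ ih₁ ih₂ ih₃ =>
    simp only [Block.size] at hn
    simp only [Block.rules, List.append_subset] at hL
    have := a.one_le_size
    have := b₁.one_le_size
    have := b₂.one_le_size
    have h₁ := ih₁ C (n + 1) hwf.2.1 hC (by omega) hL.1.1.2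
    have h₂ := ih₂ C (n + 1 + a.size) hwf.2.2.1 hC (by omega) hL.1.2
    have h₃ := ih₃ C (n + 1 + a.size + b₁.size) hwf.2.2.2 hC (by omega) hL.2
    simp only [Block.rules, List.forall_mem_append]
    refine ⟨⟨⟨?_, h₁⟩, h₂⟩, h₃⟩
    simp only [List.forall_mem_cons, List.not_mem_nil,
      false_imp_iff, implies_true, and_true, Rule.OK, Act.OK]
    omega

theorem DAB.rules_ok {M : DAB} (hM : M.WF) : ∀ ρ ∈ M.rules, ρ.OK M.schema M.root.size M.rules := by
  have h₁ := M.root.one_le_size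
  have hw : Within M.root.size (0, M.root.size) := ⟨h₁, by simp⟩
  simp only [DAB.rules, List.forall_mem_cons]
  refine ⟨?_, Block.rules_ok _ _ _ hM.2.2 ⟨hw, hw, by simp⟩ (by simp)
    (List.subset_cons_of_subset _ (List.Subset.refl _))⟩
  simp only [Rule.OK, Act.OK, List.forall_mem_cons, List.not_mem_nil, false_imp_iff, implies_true,
    and_true]
  omega

/-- The bindings that a data part of a rule reads are among the stored ones. -/
theorem mem_stored {M : DAB} {b : ℕ} {g : Guard} (h : ∃ ρ ∈ M.rules, ρ.act = .bind b g) {v : Var}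
    (hv : v ∈ g.head) : (b, v) ∈ M.stored := by
  obtain ⟨ρ, hρ, ha⟩ := h
  refine List.mem_dedup.2 (List.mem_flatMap.2 ⟨ρ, hρ, ?_⟩)
  rw [ha]
  exact List.mem_map.2 ⟨v, hv, rfl⟩

/-! ## Well-formedness of the translation -/

/-- The sort of an artifact variable. -/
def avTy (D : Schema) : AVar → Ty
  | .self _ => .ident D.ctype
  | .cvar _ i => (D.cvars[i]?).getD lifeTy
  | .ctl _ _ => lifeTy
  | .mem _ _ v => v.2
  | .occ _ _ => occTy
  | .cell r _ a => cellTy D r a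

/-- The term has sort `τ` and contains no next artifact variable. -/
def STerm.HasTy (D : Schema) (t : STerm) (τ : Ty) : Prop :=
  t.ty D = some τ ∧ ∀ a σ, t.base ≠ .var ⟨.nxt a, σ⟩

/-- The formula is well-sorted and contains no next artifact variable. -/
def Fml.OK (D : Schema) : Fml → Prop
  | .tru | .fls => True
  | .eq a b => ∃ τ, a.HasTy D τ ∧ b.HasTy D τ
  | .neg φ => φ.OK D
  | .and φ ψ | .or φ ψ => φ.OK D ∧ ψ.OK D

theorem Fml.OK.wf {D : Schema} {φ : Fml} (h : φ.OK D) : φ.WF D := by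
  induction φ with
  | tru => trivial
  | fls => trivial
  | eq a b =>
    obtain ⟨τ, ha, hb⟩ := h
    exact ⟨τ, ha.1, hb.1⟩
  | neg φ ih => exact ih h
  | and φ ψ ih₁ ih₂ => exact ⟨ih₁ h.1, ih₂ h.2⟩
  | or φ ψ ih₁ ih₂ => exact ⟨ih₁ h.1, ih₂ h.2⟩

@[simp] theorem Fml.ok_bigAnd {D : Schema} (l : List Fml) :
    (Fml.bigAnd l).OK D ↔ ∀ φ ∈ l, φ.OK D := by
  induction l with
  | nil => simp [Fml.bigAnd, Fml.OK]
  | cons φ l ih =>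
    simp only [Fml.bigAnd, List.foldr_cons, Fml.OK, List.mem_cons, forall_eq_or_imp] at ih ⊢
    rw [ih]

@[simp] theorem Fml.ok_bigOr {D : Schema} (l : List Fml) :
    (Fml.bigOr l).OK D ↔ ∀ φ ∈ l, φ.OK D := by
  induction l with
  | nil => simp [Fml.bigOr, Fml.OK]
  | cons φ l ih =>
    simp only [Fml.bigOr, List.foldr_cons, Fml.OK, List.mem_cons, forall_eq_or_imp] at ih ⊢
    rw [ih]

/-- The assignments agree on all variables but the next artifact variables. -/
def AgreeNow {U : Type*} (α β : SVar → U) : Prop :=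
  ∀ x : SVar, (∀ a, x.name ≠ .nxt a) → α x = β x

theorem STerm.HasTy.eval_congr {D : Schema} {A : TModel D} {α β : SVar → A.U}
    (h : AgreeNow α β) {t : STerm} {τ : Ty} (ht : t.HasTy D τ) : A.eval α t = A.eval β t :=
  A.eval_congr fun x hx => h x fun a ha => ht.2 a x.ty (by rw [hx, ← ha])

theorem Fml.OK.sat_congr {D : Schema} {A : TModel D} {α β : SVar → A.U}
    (h : AgreeNow α β) {φ : Fml} (hφ : φ.OK D) : A.Sat α φ ↔ A.Sat β φ := by
  induction φ with
  | tru => exact Iff.rfl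
  | fls => exact Iff.rfl
  | eq a b =>
    obtain ⟨τ, ha, hb⟩ := hφ
    simp only [TModel.Sat, ha.eval_congr h, hb.eval_congr h]
  | neg φ ih => exact not_congr (ih hφ)
  | and φ ψ ih₁ ih₂ => exact and_congr (ih₁ hφ.1) (ih₂ hφ.2)
  | or φ ψ ih₁ ih₂ => exact or_congr (ih₁ hφ.1) (ih₂ hφ.2)

/-- Well-sorted case-defined functions. -/
def CTerm.OK (D : Schema) (τ : Ty) : CTerm → Prop
  | .tm t => t.HasTy D τ
  | .ite φ a b => φ.OK D ∧ a.OK D τ ∧ b.OK D τ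

open Classical in
/-- The value of a case-defined function. -/
noncomputable def CTerm.eval {D : Schema} (A : TModel D) (β : SVar → A.U) : CTerm → A.U
  | .tm t => A.eval β t
  | .ite φ a b => if A.Sat β φ then a.eval A β else b.eval A β

theorem CTerm.OK.wf_eqF {D : Schema} {τ : Ty} {C : CTerm} (h : C.OK D τ) {y : STerm}
    (hy : y.ty D = some τ) : (C.eqF y).WF D := by
  induction C with
  | tm t => exact ⟨τ, hy, h.1⟩
  | ite φ a b iha ihb => exact ⟨⟨h.1.wf, iha h.2.1⟩, h.1.wf, ihb h.2.2⟩

theorem CTerm.sat_eqF {D : Schema} (A : TModel D) (β : SVar → A.U) (C : CTerm) (y : STerm) :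
    A.Sat β (C.eqF y) ↔ A.eval β y = C.eval A β := by
  induction C with
  | tm t => exact Iff.rfl
  | ite φ a b iha ihb =>
    simp only [CTerm.eqF, TModel.Sat, CTerm.eval, iha, ihb]
    split_ifs with h <;> simp [h]

theorem CTerm.OK.sort_eval {D : Schema} {A : TModel D} {β : SVar → A.U} (hβ : A.Sorted β) {τ : Ty}
    {C : CTerm} (h : C.OK D τ) : A.sort τ (C.eval A β) := by
  induction C with
  | tm t => exact A.sort_eval hβ h.1
  | ite φ a b iha ihb =>
    simp only [CTerm.eval]
    split_ifs
    exacts [iha h.2.1, ihb h.2.2]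

theorem CTerm.OK.eval_congr {D : Schema} {A : TModel D} {α β : SVar → A.U} (hαβ : AgreeNow α β)
    {τ : Ty} {C : CTerm} (h : C.OK D τ) : C.eval A α = C.eval A β := by
  induction C with
  | tm t => exact STerm.HasTy.eval_congr hαβ h
  | ite φ a b iha ihb =>
    simp only [CTerm.eval, iha h.2.1, ihb h.2.2]
    have hφ := h.1.sat_congr (A := A) hαβ
    by_cases hc : A.Sat β φ
    · rw [if_pos hc, if_pos (hφ.2 hc)]
    · rw [if_neg hc, if_neg fun hs => hc (hφ.1 hs)]

/-- Well-sorted guarded updates. -/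
def Trans.OK (D : Schema) (t : Trans) : Prop :=
  t.guard.OK D ∧ ∀ p ∈ t.upd, p.2.OK D (avTy D p.1)

theorem curT_hasTy {D : Schema} (a : AVar) (τ : Ty) : (curT a τ).HasTy D τ :=
  ⟨rfl, by simp [curT, STerm.base]⟩

theorem exVar_hasTy {D : Schema} (tag : ℕ) (v : Var) : (exVar tag v).HasTy D v.2 :=
  ⟨rfl, by simp [exVar, STerm.base]⟩

theorem undef_hasTy {D : Schema} (τ : Ty) : (STerm.const τ none).HasTy D τ :=
  ⟨rfl, by simp [STerm.base]⟩

theorem const_hasTy {D : Schema} {τ : Ty} {k : ℕ} (h : D.constOk τ k = true) :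
    (STerm.const τ (some k)).HasTy D τ :=
  ⟨by simp [STerm.ty, h], by simp [STerm.base]⟩

/-- What an update makes of an artifact variable. -/
def nextC (D : Schema) (upd : List (AVar × CTerm)) (a : AVar) : CTerm :=
  (upd.lookup a).getD (.tm (curT a (avTy D a)))

theorem Trans.OK.nextC {D : Schema} {t : Trans} (h : t.OK D) (a : AVar) :
    (nextC D t.upd a).OK D (avTy D a) := by
  cases hl : t.upd.lookup a with
  | none =>
    simp only [DataAwareBPMN.nextC, hl, Option.getD_none]
    exact curT_hasTy _ _
  | some C =>
    simp only [DataAwareBPMN.nextC, hl, Option.getD_some]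
    exact h.2 _ (mem_of_lookup_eq_some hl)

theorem Trans.OK.wf_fml {D : Schema} {t : Trans} (h : t.OK D) {vars : List (AVar × Ty × Val)}
    (hv : ∀ p ∈ vars, p.2.1 = avTy D p.1) : (t.fml vars).WF D := by
  refine ⟨h.1.wf, (Fml.wf_bigAnd _).2 ?_⟩
  intro φ hφ
  obtain ⟨p, hp, rfl⟩ := List.mem_map.1 hφ
  rw [hv p hp]
  exact (h.nextC p.1).wf_eqF rfl

/-- `f` respects the types of terms whose variables are in `V`. -/
def TrOK (D : Schema) (nb : ℕ) (V : Set Var) (f : Term → STerm) : Prop :=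
  ∀ t τ, t.ty D nb = some τ → (∀ v ∈ t.vars, v ∈ V) → (f t).HasTy D τ

theorem TrOK.tr {D : Schema} {nb c : ℕ} {V : Set Var} {ρ : Var → STerm}
    (hρ : ∀ v ∈ V, (ρ v).HasTy D v.2) : TrOK D nb V (Term.tr D c ρ) := by
  intro t τ ht hV
  cases t with
  | self =>
    simp only [Term.ty, Option.some.injEq] at ht
    exact ht ▸ curT_hasTy _ _
  | cvar i =>
    simp only [Term.ty] at ht
    simp only [Term.tr, ht, Option.getD_some]
    exact curT_hasTy _ _
  | ctl b =>
    simp only [Term.ty] at ht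
    split_ifs at ht
    simp only [Option.some.injEq] at ht
    exact ht ▸ curT_hasTy _ _
  | var v =>
    simp only [Term.ty] at ht
    split_ifs at ht
    simp only [Option.some.injEq] at ht
    exact ht ▸ hρ v (hV v (by simp [Term.vars]))
  | const σ c =>
    cases c with
    | none =>
      simp only [Term.ty] at ht
      split_ifs at ht
      simp only [Option.some.injEq] at ht
      exact ht ▸ undef_hasTy _
    | some k =>
      simp only [Term.ty] at ht
      split_ifs at ht with h
      simp only [Option.some.injEq] at ht
      rw [Bool.and_eq_true] at h
      exact ht ▸ const_hasTy h.2

theorem Cond.ok_tr {D : Schema} {V : Set Var} {f : Term → STerm} (hf : TrOK D 0 V f)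
    {φ : Cond} (hφ : φ.WF D) : (φ.tr f).OK D := by
  induction φ with
  | eq a b =>
    obtain ⟨ha, hb, τ, ha', hb'⟩ := hφ
    exact ⟨τ, hf a τ ha' (by simp [ha]), hf b τ hb' (by simp [hb])⟩
  | not φ ih => exact ih hφ
  | and φ ψ ih₁ ih₂ => exact ⟨ih₁ hφ.1, ih₂ hφ.2⟩

theorem ok_signed {D : Schema} {pos : Bool} {φ : Fml} (h : φ.OK D) : (signed pos φ).OK D := by
  cases pos <;> exact h

theorem cellTy_eq {D : Schema} {r a : ℕ} {R : RepoRel} {τ : Ty} (hR : D.repo[r]? = some R)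
    (ha : R.attrs[a]? = some τ) : cellTy D r a = τ := by
  simp [cellTy, hR, ha]

theorem ok_isOcc {D : Schema} (r s : ℕ) : (isOcc r s).OK D :=
  ⟨occTy, curT_hasTy _ _, const_hasTy rfl⟩

theorem forall₂_getElem? {X Y : Type*} {P : X → Y → Prop} {l : List X} {l' : List Y}
    (h : List.Forall₂ P l l') {i : ℕ} {x : X} (hx : l[i]? = some x) :
    ∃ y, l'[i]? = some y ∧ P x y := by
  induction h generalizing i with
  | nil => simp at hx
  | cons hp _ ih =>
    cases i with
    | zero =>
      simp only [List.getElem?_cons_zero, Option.some.injEq] at hx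
      exact ⟨_, rfl, hx ▸ hp⟩
    | succ i => exact ih (by simpa using hx)

theorem forall₂_getElem?_right {X Y : Type*} {P : X → Y → Prop} {l : List X} {l' : List Y}
    (h : List.Forall₂ P l l') {i : ℕ} {y : Y} (hy : l'[i]? = some y) :
    ∃ x, l[i]? = some x ∧ P x y := by
  obtain ⟨x, hx, hp⟩ := forall₂_getElem? h.flip hy
  exact ⟨x, hx, hp⟩

theorem forall₂_of_map_eq {X Y : Type*} {f : X → Option Y} {l : List X} {l' : List Y}
    (h : l.map f = l'.map some) : List.Forall₂ (fun x y => f x = some y) l l' := by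
  induction l generalizing l' with
  | nil =>
    cases l' with
    | nil => exact .nil
    | cons y l' => simp at h
  | cons x l ih =>
    cases l' with
    | nil => simp at h
    | cons y l' =>
      simp only [List.map_cons, List.cons.injEq] at h
      exact .cons h.1 (ih h.2)

theorem ok_rowEq {D : Schema} {r s : ℕ} {R : RepoRel} (hR : D.repo[r]? = some R)
    {us : List STerm} (hus : List.Forall₂ (fun u τ => u.HasTy D τ) us R.attrs) :
    (rowEq D r s us).OK D := by
  refine (Fml.ok_bigAnd _).2 fun φ hφ => ?_
  obtain ⟨⟨u, a⟩, hp, rfl⟩ := List.mem_map.1 hφ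
  obtain ⟨τ, hτ, hu⟩ := forall₂_getElem? hus (List.mk_mem_zipIdx_iff_getElem?.1 hp)
  refine ⟨τ, ?_, hu⟩
  rw [cellT, cellTy_eq hR hτ]
  exact curT_hasTy _ _

theorem app_hasTy {D : Schema} {r j : ℕ} {R : CatRel} {τ : Ty} {t : STerm}
    (hR : D.cat[r]? = some R) (hj : R.attrs[j]? = some τ) (ht : t.HasTy D (.ident R.idTy)) :
    (STerm.app r j t).HasTy D τ :=
  ⟨STerm.ty_app_iff.2 ⟨R, hR, ht.1, hj⟩, ht.2⟩

theorem ok_relTr {D : Schema} {m : ℕ} {N : RelName} {τs : List Ty} (hN : D.relTypes N = some τs)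
    {us : List STerm} (hus : List.Forall₂ (fun u τ => u.HasTy D τ) us τs) :
    (relTr D m N us).OK D := by
  cases N with
  | cat r =>
    obtain ⟨R, hR, rfl⟩ := Option.map_eq_some_iff.1 hN
    cases us with
    | nil => trivial
    | cons u us =>
      obtain ⟨hu, hus⟩ := List.forall₂_cons.1 hus
      refine ⟨⟨.ident R.idTy, hu, ?_⟩, (Fml.ok_bigAnd _).2 fun φ hφ => ?_⟩
      · simp only [hR, Option.map_some, Option.getD_some]
        exact undef_hasTy _
      · obtain ⟨⟨u', j⟩, hp, rfl⟩ := List.mem_map.1 hφ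
        obtain ⟨τ, hτ, hu'⟩ := forall₂_getElem? hus (List.mk_mem_zipIdx_iff_getElem?.1 hp)
        exact ⟨τ, hu', app_hasTy hR hτ hu⟩
  | repo r =>
    obtain ⟨R, hR, rfl⟩ := Option.map_eq_some_iff.1 hN
    refine (Fml.ok_bigOr _).2 fun φ hφ => ?_
    obtain ⟨s, -, rfl⟩ := List.mem_map.1 hφ
    exact ⟨ok_isOcc _ _, ok_rowEq hR hus⟩

theorem TrOK.forall₂ {D : Schema} {nb : ℕ} {V : Set Var} {f : Term → STerm} (hf : TrOK D nb V f)
    {ts : List Term} {τs : List Ty} (h : List.Forall₂ (fun t τ => t.ty D nb = some τ) ts τs)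
    (hV : ∀ t ∈ ts, ∀ v ∈ t.vars, v ∈ V) :
    List.Forall₂ (fun u τ => u.HasTy D τ) (ts.map f) τs := by
  induction h with
  | nil => exact .nil
  | cons hp _ ih =>
    exact .cons (hf _ _ hp (hV _ List.mem_cons_self))
      (ih fun t ht => hV t (List.mem_cons_of_mem _ ht))

theorem Lit.ok_tr {D : Schema} {nb m : ℕ} {V : Set Var} {f : Term → STerm} (hf : TrOK D nb V f)
    {l : Lit} (hl : l.WF D nb) (hV : ∀ v ∈ l.vars, v ∈ V) : (l.tr D m f).OK D := by
  cases l with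
  | eq pos a b =>
    obtain ⟨τ, ha, hb⟩ := hl
    exact ok_signed ⟨τ, hf a τ ha fun v hv => hV v (List.mem_append_left _ hv),
      hf b τ hb fun v hv => hV v (List.mem_append_right _ hv)⟩
  | rel pos R ts =>
    obtain ⟨τs, hR, hts⟩ := hl
    exact ok_signed (ok_relTr hR (hf.forall₂ (forall₂_of_map_eq hts) fun t ht v hv =>
      hV v (List.mem_flatMap.2 ⟨t, ht, hv⟩)))

theorem ok_ucqTr {D : Schema} {nb m : ℕ} {V : Set Var} {f : Term → STerm} (hf : TrOK D nb V f)
    {B : List CQ} (hB : ∀ Q ∈ B, ∀ l ∈ Q, l.WF D nb ∧ ∀ v ∈ l.vars, v ∈ V) :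
    (ucqTr D m f B).OK D := by
  refine (Fml.ok_bigOr _).2 fun φ hφ => ?_
  obtain ⟨Q, hQ, rfl⟩ := List.mem_map.1 hφ
  refine (Fml.ok_bigAnd _).2 fun φ hφ => ?_
  obtain ⟨l, hl, rfl⟩ := List.mem_map.1 hφ
  exact Lit.ok_tr hf (hB Q hQ l hl).1 (hB Q hQ l hl).2

theorem selfT_hasTy {D : Schema} (c : ℕ) : (selfT D c).HasTy D (.ident D.ctype) := curT_hasTy _ _

theorem ok_caseDom {D : Schema} {nc : ℕ} {ρ : Var → STerm} {v : Var} (hv : (ρ v).HasTy D v.2) :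
    (caseDom D nc ρ v).OK D := by
  rw [caseDom]
  split_ifs with h
  · refine ⟨⟨_, hv, undef_hasTy _⟩, (Fml.ok_bigOr _).2 fun φ hφ => ?_⟩
    obtain ⟨c, -, rfl⟩ := List.mem_map.1 hφ
    exact ⟨_, hv, h ▸ selfT_hasTy c⟩
  · trivial

theorem Guard.mem_vars_of_body {G : Guard} {Q : CQ} (hQ : Q ∈ G.body) {l : Lit} (hl : l ∈ Q)
    {v : Var} (hv : v ∈ l.vars) : v ∈ G.vars :=
  List.mem_append_right _ (List.mem_flatMap.2 ⟨Q, hQ, List.mem_flatMap.2 ⟨l, hl, hv⟩⟩)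

theorem Guard.ok_tr {D : Schema} {nb nc m c : ℕ} {ρ : Var → STerm} {G : Guard} (hG : G.WF D nb)
    (hρ : ∀ v ∈ G.vars, (ρ v).HasTy D v.2) : (G.tr D nc m c ρ).OK D := by
  refine ⟨(Fml.ok_bigAnd _).2 fun φ hφ => ?_, ?_⟩
  · obtain ⟨v, hv, rfl⟩ := List.mem_map.1 hφ
    exact ok_caseDom (hρ v hv)
  · refine ok_ucqTr (nb := nb) (V := {v | v ∈ G.vars}) (TrOK.tr hρ) fun Q hQ l hl => ?_
    exact ⟨hG.2 Q hQ l hl, fun v hv => Guard.mem_vars_of_body hQ hl hv⟩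

theorem ok_setsTr {D : Schema} {c : ℕ} {vs : List Var} {f : Term → STerm}
    (hf : TrOK D 0 {v | v ∈ vs} f) {ss : List (ℕ × Term)} (hss : SetsWF D vs ss) :
    ∀ p ∈ setsTr c f ss, p.2.OK D (avTy D p.1) := by
  intro p hp
  obtain ⟨q, hq, rfl⟩ := List.mem_map.1 hp
  obtain ⟨τ, hτ, hs⟩ := hss.2 q hq
  simp only [avTy, hτ, Option.getD_some]
  exact hf _ _ hs.1.1 hs.1.2

theorem ok_fillSlot {D : Schema} {r s : ℕ} {R : RepoRel} (hR : D.repo[r]? = some R)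
    {us : List STerm} (hus : List.Forall₂ (fun u τ => u.HasTy D τ) us R.attrs) :
    ∀ p ∈ fillSlot r s us, p.2.OK D (avTy D p.1) := by
  intro p hp
  rcases List.mem_cons.1 hp with rfl | hp
  · exact const_hasTy rfl
  · obtain ⟨⟨u, a⟩, hq, rfl⟩ := List.mem_map.1 hp
    obtain ⟨τ, hτ, hu⟩ := forall₂_getElem? hus (List.mk_mem_zipIdx_iff_getElem?.1 hq)
    simp only [avTy, cellTy_eq hR hτ]
    exact hu

theorem ok_clearSlot {D : Schema} {r s n : ℕ} {φ : Fml} (hφ : φ.OK D) :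
    ∀ p ∈ clearSlot D r s n φ, p.2.OK D (avTy D p.1) := by
  intro p hp
  rcases List.mem_cons.1 hp with rfl | hp
  · exact ⟨hφ, undef_hasTy _, curT_hasTy _ _⟩
  · obtain ⟨a, -, rfl⟩ := List.mem_map.1 hp
    exact ⟨hφ, undef_hasTy _, curT_hasTy _ _⟩

theorem ok_agreeTr {D : Schema} (hD : D.WF) {r s : ℕ} {R : RepoRel} (hR : D.repo[r]? = some R)
    {us : List STerm} (hus : List.Forall₂ (fun u τ => u.HasTy D τ) us R.attrs) :
    (agreeTr D r s R.key us).OK D := by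
  refine (Fml.ok_bigAnd _).2 fun φ hφ => ?_
  obtain ⟨p, hp, rfl⟩ := List.mem_map.1 hφ
  have hlt := hD.repo_key R (List.mem_of_getElem? hR) p hp
  obtain ⟨u, hu, h⟩ := forall₂_getElem?_right hus (List.getElem?_eq_getElem hlt)
  refine ⟨R.attrs[p], ?_, ?_⟩
  · rw [cellT, cellTy_eq hR (List.getElem?_eq_getElem hlt)]
    exact curT_hasTy _ _
  · simpa [List.getD_eq_getElem?_getD, hu] using h

theorem storable_forall₂ {D : Schema} {vs : List Var} {us : List Term} {τs : List Ty}
    (h : List.Forall₂ (fun t τ => Term.Storable D vs t τ) us τs) :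
    List.Forall₂ (fun t τ => Term.TypedIn D vs t τ) us τs :=
  h.imp fun _ _ h => h.1

theorem TrOK.typedIn {D : Schema} {vs : List Var} {f : Term → STerm}
    (hf : TrOK D 0 {v | v ∈ vs} f) {us : List Term} {τs : List Ty}
    (h : List.Forall₂ (fun t τ => Term.TypedIn D vs t τ) us τs) :
    List.Forall₂ (fun u τ => u.HasTy D τ) (us.map f) τs := by
  refine hf.forall₂ (h.imp fun _ _ h => h.1) fun t ht => ?_
  obtain ⟨i, hi⟩ := List.mem_iff_getElem?.1 ht
  obtain ⟨τ, -, h'⟩ := forall₂_getElem? h hi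
  exact h'.2

theorem Ite.ok_tr {D : Schema} {m a : ℕ} {vs : List Var} {f : Term → STerm}
    (hf : TrOK D 0 {v | v ∈ vs} f) {τs : List Ty} {τ : Ty} (ha : τs[a]? = some τ) {b : Ite}
    (hb : b.WF D vs τs) : (b.tr D m f a).OK D τ := by
  induction b with
  | leaf us =>
    obtain ⟨u, hu, h⟩ := forall₂_getElem?_right (hf.typedIn (storable_forall₂ hb)) ha
    simpa [Ite.tr, CTerm.OK, List.getD_eq_getElem?_getD, hu] using h
  | ite ψ yes no ih₁ ih₂ =>
    refine ⟨ok_ucqTr hf fun Q hQ l hl => ?_, ih₁ hb.2.1, ih₂ hb.2.2⟩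
    exact ⟨(hb.1 Q hQ l hl).1, (hb.1 Q hQ l hl).2.2⟩

theorem lookup_eq_some_of_mem {X Y : Type*} [BEq X] [LawfulBEq X] {l : List (X × Y)} {x : X}
    {y : Y} (h : (x, y) ∈ l) (huniq : ∀ y', (x, y') ∈ l → y' = y) : l.lookup x = some y := by
  induction l with
  | nil => simp at h
  | cons p l ih =>
    obtain ⟨a, b⟩ := p
    rw [List.lookup_cons]
    by_cases hx : x = a
    · subst hx
      simp [huniq b (by simp)]
    · simp only [beq_eq_false_iff_ne.2 hx]
      refine ih ?_ fun y' hy' => huniq y' (List.mem_cons_of_mem _ hy')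
      rcases List.mem_cons.1 h with h | h
      · exact absurd (Prod.ext_iff.1 h).1 hx
      · exact h

theorem lookup_eq_none_of_forall {X Y : Type*} [BEq X] [LawfulBEq X] {l : List (X × Y)} {x : X}
    (h : ∀ p ∈ l, p.1 ≠ x) : l.lookup x = none := by
  cases hl : l.lookup x with
  | none => rfl
  | some y => exact absurd rfl (h _ (mem_of_lookup_eq_some hl))

theorem lookup_zipIdx {X : Type*} [BEq X] [LawfulBEq X] {l : List X} (hl : l.Nodup) {i : ℕ}
    {x : X} (h : l[i]? = some x) : l.zipIdx.lookup x = some i := by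
  refine lookup_eq_some_of_mem (List.mk_mem_zipIdx_iff_getElem?.2 h) fun j hj => ?_
  have hj' := List.mk_mem_zipIdx_iff_getElem?.1 hj
  obtain ⟨h₁, h₂⟩ := List.getElem?_eq_some_iff.1 h
  obtain ⟨h₃, h₄⟩ := List.getElem?_eq_some_iff.1 hj'
  exact (hl.getElem_inj_iff).1 (h₄.trans h₂.symm)

theorem bindSlot_of_mem {D : Schema} {r s : ℕ} {ρ : Var → STerm} {vs : List Var} (hvs : vs.Nodup)
    {a : ℕ} {v : Var} (h : vs[a]? = some v) : bindSlot D r s ρ vs v = cellT D r s a := by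
  simp [bindSlot, lookup_zipIdx hvs h]

theorem bindSlot_of_not_mem {D : Schema} {r s : ℕ} {ρ : Var → STerm} {vs : List Var} {v : Var}
    (h : v ∉ vs) : bindSlot D r s ρ vs v = ρ v := by
  have : vs.zipIdx.lookup v = none := lookup_eq_none_of_forall fun p hp e =>
    h (e ▸ List.fst_mem_of_mem_zipIdx hp)
  simp [bindSlot, this]

theorem bindSlot_hasTy {D : Schema} {r s : ℕ} {R : RepoRel} (hR : D.repo[r]? = some R)
    {ρ : Var → STerm} {head vs : List Var} (hvs : vs.Nodup) (hty : vs.map Prod.snd = R.attrs)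
    (hρ : ∀ v ∈ head, (ρ v).HasTy D v.2) :
    ∀ v ∈ head ++ vs, (bindSlot D r s ρ vs v).HasTy D v.2 := by
  intro v hv
  by_cases h : v ∈ vs
  · obtain ⟨a, ha⟩ := List.mem_iff_getElem?.1 h
    rw [bindSlot_of_mem hvs ha, cellT, cellTy_eq hR (τ := v.2)]
    · exact curT_hasTy _ _
    · simp [← hty, ha]
  · rw [bindSlot_of_not_mem h]
    exact hρ v ((List.mem_append.1 hv).resolve_right h)

theorem Effect.ok_tr {D : Schema} (hD : D.WF) {ins : InsertionSemantics} {m c : ℕ}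
    {ρ : Var → STerm} {head : List Var} (hρ : ∀ v ∈ head, (ρ v).HasTy D v.2) {e : Effect}
    (he : e.WF D head) : ∀ t ∈ e.tr D ins m c ρ, t.OK D := by
  have hf : TrOK D 0 {v | v ∈ head} (Term.tr D c ρ) := TrOK.tr hρ
  intro t ht
  cases e with
  | set ss =>
    obtain rfl : t = _ := by simpa [Effect.tr] using ht
    exact ⟨trivial, ok_setsTr hf he⟩
  | insert r us ss =>
    obtain ⟨⟨R, hR, hus⟩, hss⟩ := he
    have hus' := hf.typedIn (storable_forall₂ hus)
    simp only [Effect.tr, hR, Option.getD_some, List.mem_map] at ht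
    obtain ⟨s, -, rfl⟩ := ht
    cases ins with
    | multisetIns =>
      refine ⟨ok_isOcc _ _, fun p hp => ?_⟩
      rcases List.mem_append.1 hp with hp | hp
      exacts [ok_fillSlot hR hus' p hp, ok_setsTr hf hss p hp]
    | setIns =>
      refine ⟨⟨ok_isOcc _ _, ok_agreeTr hD hR hus'⟩, fun p hp => ?_⟩
      rcases List.mem_append.1 hp with hp | hp
      · rcases List.mem_append.1 hp with hp | hp
        exacts [ok_fillSlot hR hus' p hp, ok_setsTr hf hss p hp]
      · obtain ⟨s', -, hp⟩ := List.mem_flatMap.1 hp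
        exact ok_clearSlot (ok_agreeTr hD hR hus') p hp
  | delete r us ss =>
    obtain ⟨⟨R, hR, hus⟩, hss⟩ := he
    have hus' := hf.typedIn hus
    simp only [Effect.tr, List.mem_map] at ht
    obtain ⟨s, -, rfl⟩ := ht
    refine ⟨⟨ok_isOcc _ _, ok_rowEq hR hus'⟩, fun p hp => ?_⟩
    rcases List.mem_append.1 hp with hp | hp
    exacts [ok_clearSlot (by trivial) p hp, ok_setsTr hf hss p hp]
  | update r vs body =>
    obtain ⟨R, hR, hty, hvs, -, hb⟩ := he
    obtain rfl : t = _ := by simpa [Effect.tr] using ht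
    refine ⟨trivial, fun p hp => ?_⟩
    obtain ⟨s, -, hp⟩ := List.mem_flatMap.1 hp
    obtain ⟨a, ha, rfl⟩ := List.mem_map.1 hp
    have ha' : a < R.attrs.length := by
      rw [← hty, List.length_map]
      exact List.mem_range.1 ha
    have hτ := List.getElem?_eq_getElem ha'
    simp only [avTy, cellTy_eq hR hτ]
    refine ⟨ok_isOcc _ _, Ite.ok_tr (TrOK.tr (bindSlot_hasTy hR hvs hty hρ)) hτ hb, ?_⟩
    show (cellT D r s a).HasTy D _
    rw [cellT, cellTy_eq hR hτ]
    exact curT_hasTy _ _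

theorem Act.ok_tr {D : Schema} (hD : D.WF) {ins : InsertionSemantics} {nc m c : ℕ} {L : List Rule}
    {act : Act} (ha : act.OK D L) : ∀ t ∈ act.tr D ins nc m c, t.OK D := by
  intro t ht
  cases act with
  | skip =>
    obtain rfl : t = _ := by simpa [Act.tr] using ht
    exact ⟨trivial, by simp⟩
  | test φ =>
    obtain rfl : t = _ := by simpa [Act.tr] using ht
    exact ⟨Cond.ok_tr (V := Set.univ) (TrOK.tr fun v _ => exVar_hasTy 0 v) ha, by simp⟩
  | exec u =>
    simp only [Act.tr, List.mem_map] at ht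
    obtain ⟨t, ht, rfl⟩ := ht
    have h := Effect.ok_tr hD (fun v _ => exVar_hasTy 0 v) ha.2 t ht
    exact ⟨⟨Guard.ok_tr ha.1 fun v _ => exVar_hasTy 0 v, h.1⟩, h.2⟩
  | bind b g =>
    obtain rfl : t = _ := by simpa [Act.tr] using ht
    refine ⟨Guard.ok_tr ha fun v _ => exVar_hasTy 0 v, fun p hp => ?_⟩
    obtain ⟨v, -, rfl⟩ := List.mem_map.1 hp
    exact exVar_hasTy 0 v
  | release b ss =>
    obtain rfl : t = _ := by simpa [Act.tr] using ht
    obtain ⟨g, -, -, hss⟩ := ha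
    exact ⟨trivial, ok_setsTr (TrOK.tr fun v _ => curT_hasTy _ _) hss⟩

theorem LState.code_lt (q : LState) : q.code < 6 := by
  cases q <;> simp [LState.code]

theorem code_hasTy {D : Schema} (q : LState) :
    (STerm.const lifeTy (some q.code)).HasTy D lifeTy :=
  const_hasTy (constOk_enum q.code_lt)

theorem ok_isActive {D : Schema} (c : ℕ) : (isActive D c).OK D :=
  ⟨_, selfT_hasTy c, undef_hasTy _⟩

theorem Rule.ok_tr {D : Schema} (hD : D.WF) {ins : InsertionSemantics} {nc m c N : ℕ}
    {L : List Rule} {ρ : Rule} (hρ : ρ.OK D N L) : ∀ t ∈ ρ.tr D ins nc m c, t.OK D := by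
  intro t ht
  simp only [Rule.tr, List.mem_map] at ht
  obtain ⟨t, ht, rfl⟩ := ht
  have h := Act.ok_tr hD hρ.2.2 t ht
  refine ⟨⟨⟨ok_isActive c, (Fml.ok_bigAnd _).2 fun φ hφ => ?_⟩, h.1⟩, fun p hp => ?_⟩
  · obtain ⟨p, -, rfl⟩ := List.mem_map.1 hφ
    exact ⟨lifeTy, curT_hasTy _ _, code_hasTy _⟩
  · rcases List.mem_append.1 hp with hp | hp
    · obtain ⟨q, -, rfl⟩ := List.mem_map.1 hp
      exact code_hasTy _
    · exact h.2 p hp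

theorem newCaseTr_ok {D : Schema} (nc c : ℕ) : (newCaseTr D nc c).OK D := by
  refine ⟨⟨ok_isActive c, ⟨_, exVar_hasTy _ _, undef_hasTy _⟩, (Fml.ok_bigAnd _).2 fun φ hφ => ?_⟩,
    fun p hp => ?_⟩
  · obtain ⟨c', -, rfl⟩ := List.mem_map.1 hφ
    exact ⟨_, exVar_hasTy _ _, selfT_hasTy c'⟩
  · obtain rfl : p = _ := by simpa [newCaseTr] using hp
    exact exVar_hasTy _ _

/-- The artifact variables of the translation with `nc` case slots and `m` repository slots. -/
def SysVar (M : DAB) (nc m : ℕ) : AVar → Prop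
  | .self c => c < nc
  | .cvar c i => c < nc ∧ i < M.schema.cvars.length
  | .ctl c b => c < nc ∧ b < M.root.size
  | .mem c b v => c < nc ∧ (b, v) ∈ M.stored
  | .occ r s => r < M.schema.repo.length ∧ s < m
  | .cell r s a => s < m ∧ ∃ R, M.schema.repo[r]? = some R ∧ a < R.attrs.length

/-- The initial values of the artifact variables. -/
def initVal : AVar → Val
  | .ctl _ _ => some LState.idle.code
  | _ => none

theorem mem_toSAS_vars {M : DAB} {S : Setting} {k m : ℕ} {a : AVar} {τ : Ty} {v : Val} :
    (a, τ, v) ∈ (M.toSAS S k m).vars ↔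
      SysVar M (S.caseSlots k) m a ∧ τ = avTy M.schema a ∧ v = initVal a := by
  simp only [DAB.toSAS, List.mem_append, List.mem_flatMap, List.mem_cons, List.mem_map,
    List.mem_range, Prod.mk.injEq, Prod.exists, List.mk_mem_zipIdx_iff_getElem?]
  cases a with
  | self c => simp [SysVar, avTy, initVal]
  | cvar c i =>
    simp only [reduceCtorEq, false_and, false_or, or_false, AVar.cvar.injEq, and_false,
      exists_false, SysVar, avTy, initVal]
    constructor
    · rintro ⟨c', hc, σ, j, hj, ⟨rfl, rfl⟩, rfl, rfl⟩
      exact ⟨⟨hc, (List.getElem?_eq_some_iff.1 hj).1⟩, by simp [hj], rfl⟩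
    · rintro ⟨⟨hc, hi⟩, rfl, rfl⟩
      exact ⟨c, hc, M.schema.cvars[i], i, by simp [hi]⟩
  | ctl c b =>
    simp only [reduceCtorEq, false_and, false_or, or_false, AVar.ctl.injEq, and_false,
      exists_false, SysVar, avTy, initVal]
    constructor
    · rintro ⟨c', hc, b', hb, ⟨rfl, rfl⟩, rfl, rfl⟩
      exact ⟨⟨hc, hb⟩, rfl, rfl⟩
    · rintro ⟨⟨hc, hb⟩, rfl, rfl⟩
      exact ⟨c, hc, b, hb, ⟨rfl, rfl⟩, rfl, rfl⟩
  | mem c b x =>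
    simp only [reduceCtorEq, false_and, false_or, or_false, AVar.mem.injEq, and_false,
      exists_false, SysVar, avTy, initVal]
    constructor
    · rintro ⟨c', hc, b', x₁, x₂, hb, ⟨rfl, rfl, rfl⟩, rfl, rfl⟩
      exact ⟨⟨hc, hb⟩, rfl, rfl⟩
    · rintro ⟨⟨hc, hb⟩, rfl, rfl⟩
      exact ⟨c, hc, b, x.1, x.2, hb, ⟨rfl, rfl, rfl⟩, rfl, rfl⟩
  | occ r s =>
    simp only [reduceCtorEq, false_and, false_or, or_false, AVar.occ.injEq, and_false,
      exists_false, SysVar, avTy, initVal]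
    constructor
    · rintro ⟨R, r', hR, s', hs, ⟨rfl, rfl⟩, rfl, rfl⟩
      exact ⟨⟨(List.getElem?_eq_some_iff.1 hR).1, hs⟩, rfl, rfl⟩
    · rintro ⟨⟨hr, hs⟩, rfl, rfl⟩
      exact ⟨M.schema.repo[r], r, by simp [hr], s, hs, ⟨rfl, rfl⟩, rfl, rfl⟩
  | cell r s i =>
    simp only [reduceCtorEq, false_and, false_or, or_false, AVar.cell.injEq, and_false,
      exists_false, SysVar, avTy, initVal]
    constructor
    · rintro ⟨R, r', hR, s', hs, σ, j, hj, ⟨rfl, rfl, rfl⟩, rfl, rfl⟩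
      exact ⟨⟨hs, R, hR, (List.getElem?_eq_some_iff.1 hj).1⟩, (cellTy_eq hR hj).symm, rfl⟩
    · rintro ⟨⟨hs, R, hR, hi⟩, rfl, rfl⟩
      have hj := List.getElem?_eq_getElem hi
      exact ⟨R, r, hR, s, hs, _, i, hj, ⟨rfl, rfl, rfl⟩, (cellTy_eq hR hj).symm, rfl⟩

theorem mem_toSAS_trans {M : DAB} {S : Setting} {k m : ℕ} {t : Trans} :
    t ∈ (M.toSAS S k m).trans ↔ ∃ c < S.caseSlots k, t = newCaseTr M.schema (S.caseSlots k) c ∨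
      ∃ ρ ∈ M.rules, t ∈ ρ.tr M.schema S.ins (S.caseSlots k) m c := by
  simp [DAB.toSAS]

theorem toSAS_trans_ok {M : DAB} (hM : M.WF) {S : Setting} {k m : ℕ} :
    ∀ t ∈ (M.toSAS S k m).trans, t.OK M.schema := by
  intro t ht
  obtain ⟨c, -, rfl | ⟨ρ, hρ, ht⟩⟩ := mem_toSAS_trans.1 ht
  · exact newCaseTr_ok _ _
  · exact Rule.ok_tr hM.1 (DAB.rules_ok hM ρ hρ) t ht

theorem toSAS_wf {M : DAB} (hM : M.WF) (S : Setting) (k m : ℕ) :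
    (M.toSAS S k m).WF M.schema := by
  constructor
  · refine (Fml.wf_bigAnd _).2 fun φ hφ => ?_
    obtain ⟨⟨a, τ, v⟩, hp, rfl⟩ := List.mem_map.1 hφ
    obtain ⟨-, rfl, rfl⟩ := mem_toSAS_vars.1 hp
    refine ⟨avTy M.schema a, rfl, ?_⟩
    cases a with
    | ctl c b => exact (code_hasTy .idle).1
    | _ => rfl
  · refine (Fml.wf_bigOr _).2 fun φ hφ => ?_
    obtain ⟨t, ht, rfl⟩ := List.mem_map.1 hφ
    exact (toSAS_trans_ok hM t ht).wf_fml fun p hp => (mem_toSAS_vars.1 hp).2.1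

theorem Property.wf_tr {M : DAB} {υ : Property} (hυ : υ.WF M) (nc m : ℕ) :
    (υ.tr M nc m).WF M.schema := by
  refine (Fml.wf_bigOr _).2 fun φ hφ => ?_
  obtain ⟨l, -, rfl⟩ := List.mem_map.1 hφ
  refine (Fml.wf_bigAnd _).2 fun φ hφ => ?_
  obtain ⟨⟨⟨G, c⟩, i⟩, hp, rfl⟩ := List.mem_map.1 hφ
  have hG : G ∈ υ := (List.of_mem_zip (List.fst_mem_of_mem_zipIdx hp)).1
  refine ⟨(ok_isActive c).wf, (Guard.ok_tr (hυ G hG) fun v _ => ?_).wf⟩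
  dsimp only
  split_ifs <;> exact exVar_hasTy _ _

/-! ## Semantics of the translation in a catalog instance -/

/-- The values of the artifact variables. -/
def stateOf {U : Type*} (D : Schema) (β : SVar → U) : AVar → U := fun a => β ⟨.cur a, avTy D a⟩

/-- The tuple of length `n` in slot `s` of the repository relation `r`. -/
def content (w : AVar → Val) (r n s : ℕ) : List Val := (List.range n).map fun a => w (.cell r s a)

/-- The tuples that slot `s` contributes to the repository relation `r`. -/
def slotVal (w : AVar → Val) (r n s : ℕ) : Multiset (List Val) :=
  if w (.occ r s) = some 0 then {content w r n s} else 0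

/-- The repository is stored in the slots. -/
def RepoState (D : Schema) (m : ℕ) (w : AVar → Val) (repo : ℕ → Multiset (List Val)) : Prop :=
  ∀ (r : ℕ) (R : RepoRel), D.repo[r]? = some R →
    repo r = ∑ s ∈ Finset.range m, slotVal w r R.attrs.length s

theorem RepoState.mem_iff {D : Schema} {m : ℕ} {w : AVar → Val}
    {repo : ℕ → Multiset (List Val)} (h : RepoState D m w repo) {r : ℕ} {R : RepoRel}
    (hR : D.repo[r]? = some R) {t : List Val} :
    t ∈ repo r ↔ ∃ s < m, w (.occ r s) = some 0 ∧ content w r R.attrs.length s = t := by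
  rw [h r R hR, Multiset.mem_sum]
  constructor
  · rintro ⟨s, hs, ht⟩
    rw [slotVal] at ht
    split_ifs at ht with ho
    · exact ⟨s, Finset.mem_range.1 hs, ho, (Multiset.mem_singleton.1 ht).symm⟩
    · simp at ht
  · rintro ⟨s, hs, ho, rfl⟩
    exact ⟨s, Finset.mem_range.2 hs, by simp [slotVal, ho]⟩

theorem content_length (w : AVar → Val) (r n s : ℕ) : (content w r n s).length = n := by
  simp [content]

theorem content_getElem? (w : AVar → Val) {r n s a : ℕ} (ha : a < n) :
    (content w r n s)[a]? = some (w (.cell r s a)) := by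
  simp [content, ha]

theorem eq_content_iff {w : AVar → Val} {r n s : ℕ} {t : List Val} (ht : t.length = n) :
    content w r n s = t ↔ ∀ a v, t[a]? = some v → w (.cell r s a) = v := by
  constructor
  · rintro rfl a v hv
    have ha : a < n := by
      rw [← ht]
      exact (List.getElem?_eq_some_iff.1 hv).1
    rw [content_getElem? w ha] at hv
    exact Option.some.inj hv
  · intro h
    refine List.ext_getElem? fun a => ?_
    by_cases ha : a < n
    · rw [content_getElem? w ha, List.getElem?_eq_getElem (ht ▸ ha),
        h a _ (List.getElem?_eq_getElem (ht ▸ ha))]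
    · rw [List.getElem?_eq_none (by rw [content_length]; omega),
        List.getElem?_eq_none (by omega)]

section Instance

variable {D : Schema} {hD : D.WF} {I : CatInst} {hI : I.Valid D} {β : SVar → Val}

theorem sat_rowEq {r s n : ℕ} {us : List STerm} (hus : us.length = n) :
    (I.model hD hI).Sat β (rowEq D r s us) ↔
      content (stateOf D β) r n s = us.map ((I.model hD hI).eval β) := by
  rw [rowEq, TModel.sat_bigAnd, eq_content_iff (by simpa using hus)]
  constructor
  · intro h a v hv
    obtain ⟨u, hu, rfl⟩ : ∃ u, us[a]? = some u ∧ (I.model hD hI).eval β u = v := by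
      simpa using hv
    exact h _ (List.mem_map.2 ⟨(u, a), List.mk_mem_zipIdx_iff_getElem?.2 hu, rfl⟩)
  · intro h φ hφ
    obtain ⟨⟨u, a⟩, hu, rfl⟩ := List.mem_map.1 hφ
    refine h a _ ?_
    simp [List.mk_mem_zipIdx_iff_getElem?.1 hu]

theorem sat_isOcc {r s : ℕ} :
    (I.model hD hI).Sat β (isOcc r s) ↔ stateOf D β (.occ r s) = some 0 := Iff.rfl

theorem sat_relTr_cat (hβ : (I.model hD hI).Sorted β) {m r : ℕ} {R : CatRel}
    (hR : D.cat[r]? = some R) {us : List STerm}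
    (hus : List.Forall₂ (fun u τ => u.HasTy D τ) us R.row) :
    (I.model hD hI).Sat β (relTr D m (.cat r) us) ↔
      us.map ((I.model hD hI).eval β) ∈ I r := by
  cases us with
  | nil => simp [CatRel.row] at hus
  | cons u us =>
    obtain ⟨hu, hus⟩ := List.forall₂_cons.1 hus
    have hsort := (I.model hD hI).sort_eval hβ hu.1
    have hlen := hus.length_eq
    simp only [relTr, TModel.Sat, TModel.sat_bigAnd, List.map_cons]
    have key : (∀ φ ∈ us.zipIdx.map (fun p => Fml.eq p.1 (.app r p.2 u)),
        (I.model hD hI).Sat β φ) ↔ us.map ((I.model hD hI).eval β) =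
          (List.range R.attrs.length).map fun j => I.fn r j ((I.model hD hI).eval β u) := by
      constructor
      · intro h
        refine List.ext_getElem (by simpa using hlen) fun j h₁ h₂ => ?_
        have hj : j < us.length := by simpa using h₁
        have := h _ (List.mem_map.2 ⟨(us[j], j), List.mk_mem_zipIdx_iff_getElem?.2
          (List.getElem?_eq_getElem hj), rfl⟩)
        simpa [TModel.Sat, TModel.eval] using this
      · intro h φ hφ
        obtain ⟨⟨u', j⟩, hp, rfl⟩ := List.mem_map.1 hφ
        have hj := List.mk_mem_zipIdx_iff_getElem?.1 hp
        have hlt : j < R.attrs.length := hlen ▸ (List.getElem?_eq_some_iff.1 hj).1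
        have := congrArg (fun l => l[j]?) h
        simpa [hj, hlt, TModel.Sat, TModel.eval] using this
    rw [key]
    cases hv : (I.model hD hI).eval β u with
    | none =>
      constructor
      · intro h
        exact absurd rfl h.1
      · intro h
        obtain ⟨k, hk⟩ := hI.row_eq hR h
        simp at hk
    | some k =>
      rw [hv] at hsort
      have hmem := hI.row_mem hD hR (CatInst.sort_cat hR hsort)
      constructor
      · rintro ⟨-, h⟩
        rw [h]
        exact hmem
      · intro h
        refine ⟨by simp [TModel.eval], ?_⟩
        obtain ⟨k', hk'⟩ := hI.row_eq hR h
        obtain ⟨h₁, h₂⟩ := List.cons.inj hk'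
        rw [h₂, ← h₁]

theorem sat_relTr_repo {m r : ℕ} {R : RepoRel} (hR : D.repo[r]? = some R)
    {repo : ℕ → Multiset (List Val)} (hrepo : RepoState D m (stateOf D β) repo)
    {us : List STerm} (hus : us.length = R.attrs.length) :
    (I.model hD hI).Sat β (relTr D m (.repo r) us) ↔
      us.map ((I.model hD hI).eval β) ∈ repo r := by
  rw [hrepo.mem_iff hR, relTr, TModel.sat_bigOr]
  constructor
  · rintro ⟨φ, hφ, h⟩
    obtain ⟨s, hs, rfl⟩ := List.mem_map.1 hφ
    exact ⟨s, List.mem_range.1 hs, h.1, (sat_rowEq hus).1 h.2⟩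
  · rintro ⟨s, hs, h₁, h₂⟩
    exact ⟨_, List.mem_map.2 ⟨s, List.mem_range.2 hs, rfl⟩, h₁, (sat_rowEq hus).2 h₂⟩

/-- `ev` gives the values of the translations of terms whose variables are in `V`. -/
def EvOK (A : TModel D) (β : SVar → A.U) (nb : ℕ) (V : Set Var) (f : Term → STerm)
    (ev : Term → A.U) : Prop :=
  ∀ t τ, t.ty D nb = some τ → (∀ v ∈ t.vars, v ∈ V) → A.eval β (f t) = ev t

theorem EvOK.map {A : TModel D} {β : SVar → A.U} {nb : ℕ} {V : Set Var} {f : Term → STerm}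
    {ev : Term → A.U} (h : EvOK A β nb V f ev) {ts : List Term} {τs : List Ty}
    (hts : List.Forall₂ (fun t τ => t.ty D nb = some τ) ts τs)
    (hV : ∀ t ∈ ts, ∀ v ∈ t.vars, v ∈ V) : (ts.map f).map (A.eval β) = ts.map ev := by
  rw [List.map_map]
  refine List.map_congr_left fun t ht => ?_
  obtain ⟨i, hi⟩ := List.mem_iff_getElem?.1 ht
  obtain ⟨τ, -, hτ⟩ := forall₂_getElem? hts hi
  exact h t τ hτ (hV t ht)

theorem EvOK.map_typedIn {A : TModel D} {β : SVar → A.U} {vs : List Var} {f : Term → STerm}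
    {ev : Term → A.U} (h : EvOK A β 0 {v | v ∈ vs} f ev) {ts : List Term} {τs : List Ty}
    (hts : List.Forall₂ (fun t τ => Term.TypedIn D vs t τ) ts τs) :
    (ts.map f).map (A.eval β) = ts.map ev := by
  refine h.map (hts.imp fun _ _ h => h.1) fun t ht => ?_
  obtain ⟨i, hi⟩ := List.mem_iff_getElem?.1 ht
  obtain ⟨τ, -, htyped⟩ := forall₂_getElem? hts hi
  exact htyped.2

/-- The variables of case slot `c` hold the case data `e`. -/
structure CaseRel (D : Schema) (nb : ℕ) (mems : List (ℕ × Var)) (c : ℕ) (w : AVar → Val)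
    (e : CaseEntry) : Prop where
  vars : ∀ i < D.cvars.length, w (.cvar c i) = e.vars i
  ctl : ∀ b < nb, w (.ctl c b) = some (e.ctl b).code
  mem : ∀ p ∈ mems, w (.mem c p.1 p.2) = e.mem p.1 p.2

theorem EvOK.tr {nb nb' c id : ℕ} {mems : List (ℕ × Var)} {e : CaseEntry} (hnb : nb' ≤ nb)
    (he : CaseRel D nb mems c (stateOf D β) e) (hid : stateOf D β (.self c) = some id) {V : Set Var}
    {ρ : Var → STerm} {σ : Var → Val} (hρ : ∀ v ∈ V, (I.model hD hI).eval β (ρ v) = σ v) :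
    EvOK (I.model hD hI) β nb' V (Term.tr D c ρ) (Term.eval id e σ) := by
  intro t τ ht hV
  cases t with
  | self => exact hid
  | cvar i =>
    simp only [Term.ty] at ht
    exact he.vars i (List.getElem?_eq_some_iff.1 ht).1
  | ctl b =>
    simp only [Term.ty] at ht
    split_ifs at ht with hb
    exact he.ctl b (hb.trans_le hnb)
  | var v => exact hρ v (hV v (by simp [Term.vars]))
  | const σ k => cases k <;> rfl

theorem Cond.sat_tr {V : Set Var} {f : Term → STerm} {ev : Term → Val}
    (hev : EvOK (I.model hD hI) β 0 V f ev) {φ : Cond} (hφ : φ.WF D) :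
    (I.model hD hI).Sat β (φ.tr f) ↔ φ.Holds ev := by
  induction φ with
  | eq a b =>
    obtain ⟨ha, hb, τ, ha', hb'⟩ := hφ
    simp only [Cond.tr, TModel.Sat, Cond.Holds]
    rw [hev a τ ha' (by simp [ha]), hev b τ hb' (by simp [hb])]
  | not φ ih => exact not_congr (ih hφ)
  | and φ ψ ih₁ ih₂ => exact and_congr (ih₁ hφ.1) (ih₂ hφ.2)

theorem sat_signed {A : TModel D} {β : SVar → A.U} {pos : Bool} {φ : Fml} :
    A.Sat β (signed pos φ) ↔ (pos = true ↔ A.Sat β φ) := by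
  cases pos <;> simp [signed, TModel.Sat]

theorem Lit.sat_tr (hβ : (I.model hD hI).Sorted β) {nb m : ℕ} {V : Set Var} {f : Term → STerm}
    {ev : Term → Val} {repo : ℕ → Multiset (List Val)} (hf : TrOK D nb V f)
    (hev : EvOK (I.model hD hI) β nb V f ev) (hrepo : RepoState D m (stateOf D β) repo) {l : Lit}
    (hl : l.WF D nb) (hV : ∀ v ∈ l.vars, v ∈ V) :
    (I.model hD hI).Sat β (l.tr D m f) ↔ l.Holds I repo ev := by
  cases l with
  | eq pos a b =>
    obtain ⟨τ, ha, hb⟩ := hl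
    rw [Lit.tr, sat_signed, Lit.Holds, TModel.Sat,
      hev a τ ha fun v hv => hV v (List.mem_append_left _ hv),
      hev b τ hb fun v hv => hV v (List.mem_append_right _ hv)]
  | rel pos R ts =>
    obtain ⟨τs, hR, hts⟩ := hl
    have hts := forall₂_of_map_eq hts
    have hV' : ∀ t ∈ ts, ∀ v ∈ t.vars, v ∈ V := fun t ht v hv =>
      hV v (List.mem_flatMap.2 ⟨t, ht, hv⟩)
    rw [Lit.tr, sat_signed]
    cases R with
    | cat r =>
      obtain ⟨R, hR', rfl⟩ := Option.map_eq_some_iff.1 hR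
      rw [sat_relTr_cat hβ hR' (hf.forall₂ hts hV'), hev.map hts hV', Lit.Holds]
    | repo r =>
      obtain ⟨R, hR', rfl⟩ := Option.map_eq_some_iff.1 hR
      rw [sat_relTr_repo hR' hrepo (by simpa using hts.length_eq), hev.map hts hV', Lit.Holds]

theorem sat_ucqTr (hβ : (I.model hD hI).Sorted β) {nb m : ℕ} {V : Set Var} {f : Term → STerm}
    {ev : Term → Val} {repo : ℕ → Multiset (List Val)} (hf : TrOK D nb V f)
    (hev : EvOK (I.model hD hI) β nb V f ev) (hrepo : RepoState D m (stateOf D β) repo)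
    {B : List CQ} (hB : ∀ Q ∈ B, ∀ l ∈ Q, l.WF D nb ∧ ∀ v ∈ l.vars, v ∈ V) :
    (I.model hD hI).Sat β (ucqTr D m f B) ↔ UCQHolds I repo ev B := by
  have h : ∀ Q ∈ B, (I.model hD hI).Sat β (.bigAnd (Q.map (Lit.tr D m f))) ↔
      ∀ l ∈ Q, l.Holds I repo ev := by
    intro Q hQ
    rw [TModel.sat_bigAnd, List.forall_mem_map]
    exact forall₂_congr fun l hl =>
      Lit.sat_tr hβ hf hev hrepo (hB Q hQ l hl).1 (hB Q hQ l hl).2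
  rw [ucqTr, TModel.sat_bigOr, UCQHolds]
  constructor
  · rintro ⟨φ, hφ, hs⟩
    obtain ⟨Q, hQ, rfl⟩ := List.mem_map.1 hφ
    exact ⟨Q, hQ, (h Q hQ).1 hs⟩
  · rintro ⟨Q, hQ, hs⟩
    exact ⟨_, List.mem_map.2 ⟨Q, hQ, rfl⟩, (h Q hQ).2 hs⟩

theorem Ite.result_length {vs : List Var} {τs : List Ty} {b : Ite}
    (hb : b.WF D vs τs) (repo : ℕ → Multiset (List Val)) (ev : Term → Val) :
    (b.result I repo ev).length = τs.length := by
  induction b with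
  | leaf us => simpa [Ite.result] using hb.length_eq
  | ite ψ yes no ih₁ ih₂ =>
    rw [Ite.result]
    split_ifs
    exacts [ih₁ hb.2.1, ih₂ hb.2.2]

theorem Ite.eval_tr (hβ : (I.model hD hI).Sorted β) {m a : ℕ} {vs : List Var} {f : Term → STerm}
    {ev : Term → Val} {repo : ℕ → Multiset (List Val)} (hf : TrOK D 0 {v | v ∈ vs} f)
    (hev : EvOK (I.model hD hI) β 0 {v | v ∈ vs} f ev)
    (hrepo : RepoState D m (stateOf D β) repo) {τs : List Ty} (ha : a < τs.length) {b : Ite}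
    (hb : b.WF D vs τs) :
    (b.result I repo ev)[a]? = some ((b.tr D m f a).eval (I.model hD hI) β) := by
  induction b with
  | leaf us =>
    have hmap := hev.map_typedIn (storable_forall₂ hb)
    have hlt : a < us.length := hb.length_eq ▸ ha
    rw [Ite.result, ← hmap]
    simp [Ite.tr, CTerm.eval, List.getD_eq_getElem?_getD, hlt]
  | ite ψ yes no ih₁ ih₂ =>
    have hs := sat_ucqTr hβ hf hev hrepo (B := ψ) fun Q hQ l hl =>
      ⟨(hb.1 Q hQ l hl).1, (hb.1 Q hQ l hl).2.2⟩
    rw [Ite.result, Ite.tr, CTerm.eval]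
    by_cases h : UCQHolds I repo ev ψ
    · rw [if_pos h, if_pos (hs.2 h), ih₁ hb.2.1]
    · rw [if_neg h, if_neg fun h' => h (hs.1 h'), ih₂ hb.2.2]

theorem sat_agreeTr {r s : ℕ} {R : RepoRel} (hR : D.repo[r]? = some R) {us : List STerm}
    (hus : us.length = R.attrs.length) :
    (I.model hD hI).Sat β (agreeTr D r s R.key us) ↔
      agree R.key (content (stateOf D β) r R.attrs.length s)
        (us.map ((I.model hD hI).eval β)) = true := by
  rw [agreeTr, TModel.sat_bigAnd, List.forall_mem_map, agree, List.all_eq_true]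
  refine forall₂_congr fun p hp => ?_
  have hlt := hD.repo_key R (List.mem_of_getElem? hR) p hp
  have hlt' : p < us.length := hus ▸ hlt
  rw [content_getElem? _ hlt, beq_iff_eq, List.getElem?_map, List.getElem?_eq_getElem hlt',
    Option.map_some, Option.some.injEq, List.getD_eq_getElem?_getD, List.getElem?_eq_getElem hlt']
  exact Iff.rfl

end Instance

/-! ## Semantics of updates -/

section Update

variable {D : Schema} {A : TModel D} {β : SVar → A.U}

/-- The values of the artifact variables after an update. -/
noncomputable def nextSt (A : TModel D) (β : SVar → A.U) (upd : List (AVar × CTerm)) :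
    AVar → A.U :=
  fun a => (nextC D upd a).eval A β

theorem nextSt_of_forall_ne {upd : List (AVar × CTerm)} {a : AVar} (h : ∀ p ∈ upd, p.1 ≠ a) :
    nextSt A β upd a = stateOf D β a := by
  rw [nextSt, nextC, lookup_eq_none_of_forall h]
  rfl

theorem nextSt_of_mem {upd : List (AVar × CTerm)} {a : AVar} {C : CTerm} (h : (a, C) ∈ upd)
    (huniq : ∀ C', (a, C') ∈ upd → C' = C) : nextSt A β upd a = C.eval A β := by
  rw [nextSt, nextC, lookup_eq_some_of_mem h huniq, Option.getD_some]

theorem nextSt_append_left {l₁ l₂ : List (AVar × CTerm)} {a : AVar} (h : ∀ p ∈ l₂, p.1 ≠ a) :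
    nextSt A β (l₁ ++ l₂) a = nextSt A β l₁ a := by
  simp [nextSt, nextC, List.lookup_append, lookup_eq_none_of_forall h]

theorem nextSt_append_right {l₁ l₂ : List (AVar × CTerm)} {a : AVar} (h : ∀ p ∈ l₁, p.1 ≠ a) :
    nextSt A β (l₁ ++ l₂) a = nextSt A β l₂ a := by
  simp [nextSt, nextC, List.lookup_append, lookup_eq_none_of_forall h]

theorem lookup_flatMap {X Y Z : Type*} [BEq X] [LawfulBEq X] {L : List Z} {F : Z → List (X × Y)}
    {i : Z} {a : X} (hi : i ∈ L) (h : ∀ j ∈ L, j ≠ i → ∀ p ∈ F j, p.1 ≠ a) :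
    (L.flatMap F).lookup a = (F i).lookup a := by
  induction L with
  | nil => simp at hi
  | cons j L ih =>
    rw [List.flatMap_cons, List.lookup_append]
    by_cases hL : i ∈ L
    · rw [ih hL fun j' hj' => h j' (List.mem_cons_of_mem _ hj')]
      by_cases hj : j = i
      · rw [hj, Option.or_self]
      · rw [lookup_eq_none_of_forall (h j List.mem_cons_self hj), Option.none_or]
    · obtain rfl : i = j := (List.mem_cons.1 hi).resolve_right hL
      rw [lookup_eq_none_of_forall (l := L.flatMap F), Option.or_none]
      intro p hp
      obtain ⟨j', hj', hp⟩ := List.mem_flatMap.1 hp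
      exact h j' (List.mem_cons_of_mem _ hj') (fun e => hL (e ▸ hj')) p hp

theorem nextSt_flatMap {L : List ℕ} {F : ℕ → List (AVar × CTerm)} {i : ℕ} {a : AVar}
    (hi : i ∈ L) (h : ∀ j ∈ L, j ≠ i → ∀ p ∈ F j, p.1 ≠ a) :
    nextSt A β (L.flatMap F) a = nextSt A β (F i) a := by
  rw [nextSt, nextC, lookup_flatMap hi h]
  rfl

theorem lookup_map_key {X Y X' Y' : Type*} [BEq X] [LawfulBEq X] [BEq X'] [LawfulBEq X']
    {k : X → X'} (hk : Function.Injective k) (g : Y → Y') (l : List (X × Y)) (a : X) :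
    (l.map fun p => (k p.1, g p.2)).lookup (k a) = (l.lookup a).map g := by
  induction l with
  | nil => rfl
  | cons p l ih =>
    rw [List.map_cons, List.lookup_cons, List.lookup_cons, ih]
    by_cases h : a = p.1
    · simp [h]
    · simp [beq_eq_false_iff_ne.2 h, beq_eq_false_iff_ne.2 fun e => h (hk e)]

theorem nextSt_setsTr {c i : ℕ} {f : Term → STerm} {ev : Term → A.U} {x : ℕ → A.U}
    {ss : List (ℕ × Term)} (hx : stateOf D β (.cvar c i) = x i)
    (hev : ∀ p ∈ ss, A.eval β (f p.2) = ev p.2) :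
    nextSt A β (setsTr c f ss) (.cvar c i) = ((ss.lookup i).map ev).getD (x i) := by
  have h := lookup_map_key (k := AVar.cvar c) (fun _ _ h => (AVar.cvar.inj h).2)
    (fun t => CTerm.tm (f t)) ss i
  rw [nextSt, nextC, setsTr, h]
  cases hl : ss.lookup i with
  | none => exact hx
  | some t => exact hev _ (mem_of_lookup_eq_some hl)

theorem keys_setsTr {c : ℕ} {f : Term → STerm} {ss : List (ℕ × Term)} :
    ∀ p ∈ setsTr c f ss, ∃ i, p.1 = .cvar c i := by
  intro p hp
  obtain ⟨q, -, rfl⟩ := List.mem_map.1 hp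
  exact ⟨q.1, rfl⟩

/-- The repository slot that a variable belongs to. -/
def AVar.slotOf : AVar → Option (ℕ × ℕ)
  | .occ r s => some (r, s)
  | .cell r s _ => some (r, s)
  | _ => none

theorem slotOf_setsTr {c : ℕ} {f : Term → STerm} {ss : List (ℕ × Term)} :
    ∀ p ∈ setsTr c f ss, p.1.slotOf = none := by
  intro p hp
  obtain ⟨i, hi⟩ := keys_setsTr p hp
  rw [hi]
  rfl

theorem slotOf_fillSlot {r s : ℕ} {us : List STerm} :
    ∀ p ∈ fillSlot r s us, p.1.slotOf = some (r, s) := by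
  intro p hp
  rcases List.mem_cons.1 hp with rfl | hp
  · rfl
  · obtain ⟨q, -, rfl⟩ := List.mem_map.1 hp
    rfl

theorem slotOf_clearSlot {r s n : ℕ} {φ : Fml} :
    ∀ p ∈ clearSlot D r s n φ, p.1.slotOf = some (r, s) := by
  intro p hp
  rcases List.mem_cons.1 hp with rfl | hp
  · rfl
  · obtain ⟨q, -, rfl⟩ := List.mem_map.1 hp
    rfl

theorem ne_of_slotOf_ne {a b : AVar} (h : a.slotOf ≠ b.slotOf) : a ≠ b := fun e => h (e ▸ rfl)

end Update

theorem slotVal_congr {w w' : AVar → Val} {r s : ℕ} (n : ℕ)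
    (h : ∀ a : AVar, a.slotOf = some (r, s) → w' a = w a) : slotVal w' r n s = slotVal w r n s := by
  rw [slotVal, slotVal, h (.occ r s) rfl, content, content]
  simp only [h (.cell r s _) rfl]

theorem RepoState.update {D : Schema} {m : ℕ} {w w' : AVar → Val}
    {repo : ℕ → Multiset (List Val)} (h : RepoState D m w repo) {r : ℕ} {R : RepoRel}
    (hR : D.repo[r]? = some R)
    (hframe : ∀ r' s a, r' ≠ r → a.slotOf = some (r', s) → w' a = w a)
    {X : Multiset (List Val)}
    (hX : X = ∑ s ∈ Finset.range m, slotVal w' r R.attrs.length s) :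
    RepoState D m w' (Function.update repo r X) := by
  intro r' R' hR'
  by_cases hr : r' = r
  · subst hr
    obtain rfl : R = R' := Option.some.inj (hR.symm.trans hR')
    rw [Function.update_self, hX]
  · rw [Function.update_of_ne hr, h r' R' hR']
    exact Finset.sum_congr rfl fun s _ => (slotVal_congr _ fun a => hframe r' s a hr).symm

theorem RepoState.congr {D : Schema} {m : ℕ} {w w' : AVar → Val}
    {repo : ℕ → Multiset (List Val)} (h : RepoState D m w repo)
    (hframe : ∀ a : AVar, a.slotOf ≠ none → w' a = w a) : RepoState D m w' repo := by
  intro r R hR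
  rw [h r R hR]
  exact Finset.sum_congr rfl fun s _ => (slotVal_congr _ fun a ha => hframe a (by simp [ha])).symm

theorem sum_range_of_slot {m s : ℕ} {f g : ℕ → Multiset (List Val)} (hs : s < m) (hg : g s = 0)
    (h : ∀ s' < m, s' ≠ s → f s' = g s') :
    ∑ s' ∈ Finset.range m, f s' = f s + ∑ s' ∈ Finset.range m, g s' := by
  have hmem := Finset.mem_range.2 hs
  rw [← Finset.add_sum_erase _ f hmem, ← Finset.add_sum_erase _ g hmem, hg, zero_add]
  congr 1
  refine Finset.sum_congr rfl fun s' hs' => ?_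
  obtain ⟨h₁, h₂⟩ := Finset.mem_erase.1 hs'
  exact h s' (Finset.mem_range.1 h₂) h₁

theorem exists_free_slot {w : AVar → Val} {r n m : ℕ}
    (h : (∑ s ∈ Finset.range m, slotVal w r n s).card < m) : ∃ s < m, w (.occ r s) ≠ some 0 := by
  by_contra hc
  push Not at hc
  rw [Multiset.card_sum, Finset.sum_congr rfl (g := fun _ => 1)] at h
  · simp at h
  · intro s hs
    simp [slotVal, hc s (Finset.mem_range.1 hs)]

section Effects

variable {D : Schema} {hD : D.WF} {I : CatInst} {hI : I.Valid D} {β : SVar → Val}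

theorem slotVal_fillSlot {r s n : ℕ} {us : List STerm} (hn : us.length = n)
    {l : List (AVar × CTerm)} (hl : ∀ p ∈ l, p.1.slotOf ≠ some (r, s)) :
    slotVal (nextSt (I.model hD hI) β (fillSlot r s us ++ l)) r n s =
      {us.map ((I.model hD hI).eval β)} := by
  have hne : ∀ a : AVar, a.slotOf = some (r, s) →
      nextSt (I.model hD hI) β (fillSlot r s us ++ l) a =
        nextSt (I.model hD hI) β (fillSlot r s us) a := fun a ha =>
    nextSt_append_left fun p hp => ne_of_slotOf_ne (ha ▸ hl p hp)
  rw [slotVal_congr n hne, slotVal, if_pos]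
  · congr 1
    rw [eq_content_iff (by simpa using hn)]
    intro a v hv
    obtain ⟨u, hu, rfl⟩ : ∃ u, us[a]? = some u ∧ (I.model hD hI).eval β u = v := by
      simpa using hv
    refine nextSt_of_mem (C := .tm u) (List.mem_cons_of_mem _ (List.mem_map.2
      ⟨(u, a), List.mk_mem_zipIdx_iff_getElem?.2 hu, rfl⟩)) fun C' hC' => ?_
    simp only [fillSlot, List.mem_cons, Prod.mk.injEq, reduceCtorEq, false_and, List.mem_map,
      Prod.exists, List.mk_mem_zipIdx_iff_getElem?, AVar.cell.injEq, false_or] at hC'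
    obtain ⟨u', a', hu', ⟨-, -, rfl⟩, rfl⟩ := hC'
    rw [hu] at hu'
    rw [Option.some.inj hu']
  · simp [nextSt, nextC, fillSlot, CTerm.eval, TModel.eval]

open Classical in
theorem slotVal_clearSlot {r s n : ℕ} {φ : Fml} :
    slotVal (nextSt (I.model hD hI) β (clearSlot D r s n φ)) r n s =
      if (I.model hD hI).Sat β φ then 0 else slotVal (stateOf D β) r n s := by
  have hocc : nextSt (I.model hD hI) β (clearSlot D r s n φ) (.occ r s) =
      if (I.model hD hI).Sat β φ then none else stateOf D β (.occ r s) := by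
    simp only [nextSt, nextC, clearSlot, List.lookup_cons_self, Option.getD_some]
    rfl
  rw [slotVal, hocc]
  by_cases h : (I.model hD hI).Sat β φ
  · simp [h]
  · simp only [h, if_false, slotVal]
    congr 2
    refine (eq_content_iff (content_length _ _ _ _)).2 fun a v hv => ?_
    have ha : a < n := by
      rw [← content_length (stateOf D β) r n s]
      exact (List.getElem?_eq_some_iff.1 hv).1
    rw [content_getElem? _ ha] at hv
    rw [nextSt_of_mem (C := .ite φ (.tm (.const (cellTy D r a) none)) (.tm (cellT D r s a)))]
    · rw [← Option.some.inj hv, CTerm.eval, if_neg h]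
      rfl
    · exact List.mem_cons_of_mem _ (List.mem_map.2 ⟨a, List.mem_range.2 ha, rfl⟩)
    · intro C' hC'
      simp only [clearSlot, List.mem_cons, Prod.mk.injEq, reduceCtorEq, false_and, List.mem_map,
        AVar.cell.injEq, false_or] at hC'
      obtain ⟨a', -, ⟨-, -, rfl⟩, rfl⟩ := hC'
      rfl

/-- The variables that effects on the case in slot `c` may change. -/
def AVar.IsData (c : ℕ) : AVar → Prop
  | .cvar c' _ => c' = c
  | .occ _ _ => True
  | .cell _ _ _ => True
  | _ => False

theorem AVar.isData_of_slotOf {c : ℕ} {a : AVar} {x : ℕ × ℕ} (h : a.slotOf = some x) :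
    a.IsData c := by
  cases a <;> simp_all [AVar.slotOf, AVar.IsData]

theorem isData_setsTr {c : ℕ} {f : Term → STerm} {ss : List (ℕ × Term)} :
    ∀ p ∈ setsTr c f ss, p.1.IsData c := by
  intro p hp
  obtain ⟨i, hi⟩ := keys_setsTr p hp
  rw [hi]
  exact rfl

/-- The update `upd` is an effect on the case in slot `c`, and the values after it represent the
given new case variables and the given new repository. -/
structure EffMatch (D : Schema) (m c : ℕ) (upd : List (AVar × CTerm)) (w' : AVar → Val)
    (x' : ℕ → Val) (repo' : ℕ → Multiset (List Val)) : Prop where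
  vars : ∀ i < D.cvars.length, w' (.cvar c i) = x' i
  repo : RepoState D m w' repo'
  keys : ∀ p ∈ upd, p.1.IsData c

section

variable {m c id : ℕ} {e : CaseEntry} {repo : ℕ → Multiset (List Val)} {head : List Var}
  {ρ : Var → STerm} {σ : Var → Val}

theorem SetsWF.eval {f : Term → STerm} {ev : Term → Val}
    (hev : EvOK (I.model hD hI) β 0 {v | v ∈ head} f ev) {ss : List (ℕ × Term)}
    (hss : SetsWF D head ss) : ∀ p ∈ ss, (I.model hD hI).eval β (f p.2) = ev p.2 := by
  intro p hp
  obtain ⟨τ, -, hs⟩ := hss.2 p hp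
  exact hev _ τ hs.1.1 hs.1.2

theorem nextSt_sets {f : Term → STerm} {ev : Term → Val}
    (hev : EvOK (I.model hD hI) β 0 {v | v ∈ head} f ev) {ss : List (ℕ × Term)}
    (hss : SetsWF D head ss) {x : ℕ → Val}
    (hx : ∀ i < D.cvars.length, stateOf D β (.cvar c i) = x i) {l₁ l₂ : List (AVar × CTerm)}
    (h₁ : ∀ p ∈ l₁, p.1.slotOf ≠ none) (h₂ : ∀ p ∈ l₂, p.1.slotOf ≠ none) {i : ℕ}
    (hi : i < D.cvars.length) :
    nextSt (I.model hD hI) β (l₁ ++ setsTr c f ss ++ l₂) (.cvar c i) = applySets ev ss x i := by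
  rw [nextSt_append_left fun p hp => ne_of_slotOf_ne (b := .cvar c i) (h₂ p hp),
    nextSt_append_right fun p hp => ne_of_slotOf_ne (b := .cvar c i) (h₁ p hp)]
  exact nextSt_setsTr (hx i hi) (hss.eval hev)

theorem effMatch_set {f : Term → STerm} {ev : Term → Val}
    (hev : EvOK (I.model hD hI) β 0 {v | v ∈ head} f ev) {ss : List (ℕ × Term)}
    (hss : SetsWF D head ss) {x : ℕ → Val}
    (hx : ∀ i < D.cvars.length, stateOf D β (.cvar c i) = x i)
    (hrepo : RepoState D m (stateOf D β) repo) :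
    EffMatch D m c (setsTr c f ss) (nextSt (I.model hD hI) β (setsTr c f ss))
      (applySets ev ss x) repo := by
  refine ⟨fun i hi => nextSt_setsTr (hx i hi) (hss.eval hev), hrepo.congr fun a ha => ?_,
    isData_setsTr⟩
  exact nextSt_of_forall_ne fun p hp => ne_of_slotOf_ne (by rw [slotOf_setsTr p hp]; exact ha.symm)

theorem effMatch_insert_multiset {f : Term → STerm} {ev : Term → Val}
    (hev : EvOK (I.model hD hI) β 0 {v | v ∈ head} f ev) {ss : List (ℕ × Term)}
    (hss : SetsWF D head ss) {x : ℕ → Val}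
    (hx : ∀ i < D.cvars.length, stateOf D β (.cvar c i) = x i)
    (hrepo : RepoState D m (stateOf D β) repo) {r s : ℕ} {R : RepoRel}
    (hR : D.repo[r]? = some R) {us : List Term}
    (hus : List.Forall₂ (fun t τ => Term.TypedIn D head t τ) us R.attrs) (hs : s < m)
    (hfree : stateOf D β (.occ r s) ≠ some 0) :
    EffMatch D m c (fillSlot r s (us.map f) ++ setsTr c f ss)
      (nextSt (I.model hD hI) β (fillSlot r s (us.map f) ++ setsTr c f ss))
      (applySets ev ss x)
      (Function.update repo r (insertTuple .multisetIns R.key (us.map ev) (repo r))) := by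
  have hslot : ∀ p ∈ fillSlot r s (us.map f) ++ setsTr c f ss,
      p.1.slotOf = some (r, s) ∨ p.1.slotOf = none := fun p hp =>
    (List.mem_append.1 hp).imp (slotOf_fillSlot p) (slotOf_setsTr p)
  have hne : ∀ a x, a.slotOf = some x → x ≠ (r, s) →
      nextSt (I.model hD hI) β (fillSlot r s (us.map f) ++ setsTr c f ss) a = stateOf D β a := by
    refine fun a x ha hx => nextSt_of_forall_ne fun p hp => ne_of_slotOf_ne ?_
    rw [ha]
    rcases hslot p hp with h | h <;> simp [h, hx.symm]
  refine ⟨fun i hi => ?_, hrepo.update hR ?_ ?_, fun p hp => ?_⟩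
  · have := nextSt_sets (l₂ := []) hev hss hx (l₁ := fillSlot r s (us.map f))
      (fun p hp => by simp [slotOf_fillSlot p hp]) (by simp) hi
    rwa [List.append_nil] at this
  · exact fun r' s' a hr ha => hne a _ ha fun e => hr (Prod.ext_iff.1 e).1
  · rw [sum_range_of_slot (g := slotVal (stateOf D β) r R.attrs.length) hs,
      slotVal_fillSlot (by simpa using hus.length_eq) fun p hp => by simp [slotOf_setsTr p hp],
      hev.map_typedIn hus, ← hrepo r R hR]
    · rfl
    · simp [slotVal, hfree]
    · exact fun s' _ hs' => slotVal_congr _ fun a ha => hne a _ ha fun e => hs' (Prod.ext_iff.1 e).2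
  · rcases List.mem_append.1 hp with hp | hp
    exacts [AVar.isData_of_slotOf (slotOf_fillSlot p hp), isData_setsTr p hp]

theorem filter_sum {p : List Val → Prop} [DecidablePred p] (m : ℕ) (f : ℕ → Multiset (List Val)) :
    ∑ s ∈ Finset.range m, (f s).filter p = (∑ s ∈ Finset.range m, f s).filter p := by
  induction m with
  | zero => simp
  | succ m ih => rw [Finset.sum_range_succ, Finset.sum_range_succ, Multiset.filter_add, ih]

theorem effMatch_insert_set {f : Term → STerm} {ev : Term → Val}
    (hev : EvOK (I.model hD hI) β 0 {v | v ∈ head} f ev) {ss : List (ℕ × Term)}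
    (hss : SetsWF D head ss) {x : ℕ → Val}
    (hx : ∀ i < D.cvars.length, stateOf D β (.cvar c i) = x i)
    (hrepo : RepoState D m (stateOf D β) repo) {r s : ℕ} {R : RepoRel}
    (hR : D.repo[r]? = some R) {us : List Term}
    (hus : List.Forall₂ (fun t τ => Term.TypedIn D head t τ) us R.attrs) (hs : s < m)
    (hslot : stateOf D β (.occ r s) ≠ some 0 ∨
      agree R.key (content (stateOf D β) r R.attrs.length s) (us.map ev) = true)
    {upd : List (AVar × CTerm)}
    (hupd : upd = fillSlot r s (us.map f) ++ setsTr c f ss ++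
      ((List.range m).filter fun s' => s' ≠ s).flatMap fun s' =>
        clearSlot D r s' R.attrs.length (agreeTr D r s' R.key (us.map f))) :
    EffMatch D m c upd (nextSt (I.model hD hI) β upd) (applySets ev ss x)
      (Function.update repo r (insertTuple .setIns R.key (us.map ev) (repo r))) := by
  subst hupd
  set L := ((List.range m).filter fun s' => s' ≠ s).flatMap fun s' =>
        clearSlot D r s' R.attrs.length (agreeTr D r s' R.key (us.map f)) with hL
  have hmemL : ∀ p ∈ L, ∃ s', s' ≠ s ∧ p.1.slotOf = some (r, s') := by
    intro p hp
    obtain ⟨s', hs', hp⟩ := List.mem_flatMap.1 hp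
    exact ⟨s', by simpa using (List.mem_filter.1 hs').2, slotOf_clearSlot p hp⟩
  have hkeys : ∀ p ∈ fillSlot r s (us.map f) ++ setsTr c f ss ++ L,
      (∃ s', p.1.slotOf = some (r, s')) ∨ p.1.slotOf = none := by
    intro p hp
    rcases List.mem_append.1 hp with hp | hp
    · exact (List.mem_append.1 hp).imp (fun h => ⟨s, slotOf_fillSlot p h⟩) (slotOf_setsTr p)
    · obtain ⟨s', -, h⟩ := hmemL p hp
      exact .inl ⟨s', h⟩
  refine ⟨fun i hi => ?_, hrepo.update hR ?_ ?_, fun p hp => ?_⟩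
  · refine nextSt_sets hev hss hx (fun p hp => by simp [slotOf_fillSlot p hp]) (fun p hp => ?_) hi
    obtain ⟨s', -, h⟩ := hmemL p hp
    simp [h]
  · refine fun r' s' a hr ha => nextSt_of_forall_ne fun p hp => ne_of_slotOf_ne ?_
    rw [ha]
    rcases hkeys p hp with ⟨s', h⟩ | h <;> simp [h, hr.symm]
  · rw [sum_range_of_slot (g := fun s' => (slotVal (stateOf D β) r R.attrs.length s').filter
      fun t => agree R.key t (us.map ev) = false) hs, filter_sum, List.append_assoc,
      slotVal_fillSlot (by simpa using hus.length_eq), hev.map_typedIn hus, ← hrepo r R hR]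
    · rfl
    · intro p hp
      rcases List.mem_append.1 hp with hp | hp
      · simp [slotOf_setsTr p hp]
      · obtain ⟨s', hs', h⟩ := hmemL p hp
        simp [h, hs']
    · rw [slotVal]
      split_ifs with ho
      · simp [hslot.resolve_left fun h => h ho, Multiset.filter_singleton]
      · simp
    · intro s' hs' hne
      have hstep : ∀ a : AVar, a.slotOf = some (r, s') →
          nextSt (I.model hD hI) β (fillSlot r s (us.map f) ++ setsTr c f ss ++ L) a =
            nextSt (I.model hD hI) β (clearSlot D r s' R.attrs.length
              (agreeTr D r s' R.key (us.map f))) a := by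
        intro a ha
        rw [nextSt_append_right, hL, nextSt_flatMap (i := s')]
        · simpa using ⟨hs', hne⟩
        · intro j _ hj p hp
          refine ne_of_slotOf_ne ?_
          rw [slotOf_clearSlot p hp, ha]
          simp [hj]
        · intro p hp
          refine ne_of_slotOf_ne ?_
          rw [ha]
          rcases List.mem_append.1 hp with hp | hp
          · simp [slotOf_fillSlot p hp, hne.symm]
          · simp [slotOf_setsTr p hp]
      have hag := sat_agreeTr (hD := hD) (hI := hI) (β := β) (s := s') hR (us := us.map f)
        (by simpa using hus.length_eq)
      rw [hev.map_typedIn hus] at hag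
      rw [slotVal_congr _ hstep, slotVal_clearSlot]
      by_cases h : (I.model hD hI).Sat β (agreeTr D r s' R.key (us.map f))
      · rw [if_pos h, slotVal]
        split_ifs
        · simp [hag.1 h, Multiset.filter_singleton]
        · simp
      · have hf := Bool.eq_false_iff.2 fun h' => h (hag.2 h')
        rw [if_neg h, slotVal]
        split_ifs
        · simp [hf, Multiset.filter_singleton]
        · simp
  · rcases hkeys p hp with ⟨s', h⟩ | h
    · exact AVar.isData_of_slotOf h
    · rcases List.mem_append.1 hp with hp | hp
      · rcases List.mem_append.1 hp with hp | hp
        exacts [AVar.isData_of_slotOf (slotOf_fillSlot p hp), isData_setsTr p hp]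
      · obtain ⟨s', -, h'⟩ := hmemL p hp
        exact AVar.isData_of_slotOf h'

theorem effMatch_delete {f : Term → STerm} {ev : Term → Val}
    (hev : EvOK (I.model hD hI) β 0 {v | v ∈ head} f ev) {ss : List (ℕ × Term)}
    (hss : SetsWF D head ss) {x : ℕ → Val}
    (hx : ∀ i < D.cvars.length, stateOf D β (.cvar c i) = x i)
    (hrepo : RepoState D m (stateOf D β) repo) {r s : ℕ} {R : RepoRel}
    (hR : D.repo[r]? = some R) {us : List Term}
    (hus : List.Forall₂ (fun t τ => Term.TypedIn D head t τ) us R.attrs) (hs : s < m)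
    (hocc : stateOf D β (.occ r s) = some 0)
    (hcont : content (stateOf D β) r R.attrs.length s = us.map ev) :
    EffMatch D m c (clearSlot D r s us.length .tru ++ setsTr c f ss)
      (nextSt (I.model hD hI) β (clearSlot D r s us.length .tru ++ setsTr c f ss))
      (applySets ev ss x) (Function.update repo r ((repo r).erase (us.map ev))) := by
  have hslot : ∀ p ∈ clearSlot D r s us.length .tru ++ setsTr c f ss,
      p.1.slotOf = some (r, s) ∨ p.1.slotOf = none := fun p hp =>
    (List.mem_append.1 hp).imp (slotOf_clearSlot p) (slotOf_setsTr p)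
  have hne : ∀ a x, a.slotOf = some x → x ≠ (r, s) →
      nextSt (I.model hD hI) β (clearSlot D r s us.length .tru ++ setsTr c f ss) a =
        stateOf D β a := by
    refine fun a x ha hx => nextSt_of_forall_ne fun p hp => ne_of_slotOf_ne ?_
    rw [ha]
    rcases hslot p hp with h | h <;> simp [h, hx.symm]
  refine ⟨fun i hi => ?_, hrepo.update hR ?_ ?_, fun p hp => ?_⟩
  · have := nextSt_sets (l₂ := []) hev hss hx (l₁ := clearSlot D r s us.length .tru)
      (fun p hp => by simp [slotOf_clearSlot p hp]) (by simp) hi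
    rwa [List.append_nil] at this
  · exact fun r' s' a hr ha => hne a _ ha fun e => hr (Prod.ext_iff.1 e).1
  · rw [hrepo r R hR, sum_range_of_slot (f := slotVal (stateOf D β) r R.attrs.length)
      (g := slotVal (nextSt (I.model hD hI) β
        (clearSlot D r s us.length .tru ++ setsTr c f ss)) r R.attrs.length) hs]
    · simp [slotVal, hocc, hcont]
    · rw [slotVal_congr (w := nextSt (I.model hD hI) β (clearSlot D r s us.length .tru)),
        ← hus.length_eq, slotVal_clearSlot]
      · exact if_pos trivial
      · exact fun a ha => nextSt_append_left fun p hp => ne_of_slotOf_ne (by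
          simp [slotOf_setsTr p hp, ha])
    · exact fun s' _ hs' => (slotVal_congr _ fun a ha => hne a _ ha fun e =>
        hs' (Prod.ext_iff.1 e).2).symm
  · rcases List.mem_append.1 hp with hp | hp
    exacts [AVar.isData_of_slotOf (slotOf_clearSlot p hp), isData_setsTr p hp]

theorem lookup_zip {X Y : Type*} [BEq X] [LawfulBEq X] {l : List X} (hl : l.Nodup) {l' : List Y}
    {a : ℕ} {x : X} {y : Y} (hx : l[a]? = some x) (hy : l'[a]? = some y) :
    (l.zip l').lookup x = some y := by
  refine lookup_eq_some_of_mem (List.mem_iff_getElem?.2 ⟨a, ?_⟩) fun y' hy' => ?_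
  · simp [List.getElem?_zip_eq_some, hx, hy]
  · obtain ⟨b, hb⟩ := List.mem_iff_getElem?.1 hy'
    obtain ⟨h₁, h₂⟩ := List.getElem?_zip_eq_some.1 hb
    obtain ⟨h₃, h₄⟩ := List.getElem?_eq_some_iff.1 hx
    obtain ⟨h₅, h₆⟩ := List.getElem?_eq_some_iff.1 h₁
    obtain rfl := (hl.getElem_inj_iff).1 (h₆.trans h₄.symm)
    exact Option.some.inj (h₂.symm.trans hy)

theorem effMatch_update (hβ : (I.model hD hI).Sorted β) {nb : ℕ} {mems : List (ℕ × Var)}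
    (he : CaseRel D nb mems c (stateOf D β) e) (hid : stateOf D β (.self c) = some id)
    (hrepo : RepoState D m (stateOf D β) repo)
    (hρ : ∀ v ∈ head, (ρ v).HasTy D v.2)
    (hσ : ∀ v ∈ head, (I.model hD hI).eval β (ρ v) = σ v) {r : ℕ} {R : RepoRel}
    (hR : D.repo[r]? = some R) {vs : List Var} (hty : vs.map Prod.snd = R.attrs) (hvs : vs.Nodup)
    {body : Ite} (hb : body.WF D (head ++ vs) R.attrs) {upd : List (AVar × CTerm)}
    (hupd : upd = (List.range m).flatMap fun s =>
      (List.range vs.length).map fun a => (.cell r s a, .ite (isOcc r s)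
        (body.tr D m (Term.tr D c (bindSlot D r s ρ vs)) a) (.tm (cellT D r s a)))) :
    EffMatch D m c upd (nextSt (I.model hD hI) β upd) e.vars (Function.update repo r
      ((repo r).map fun t => body.result I repo (Term.eval id e (bindTuple σ vs t)))) := by
  have hkeys : ∀ p ∈ upd, ∃ s a, p.1 = .cell r s a := by
    intro p hp
    rw [hupd] at hp
    obtain ⟨s, -, hp⟩ := List.mem_flatMap.1 hp
    obtain ⟨a, -, rfl⟩ := List.mem_map.1 hp
    exact ⟨s, a, rfl⟩
  have hlen : vs.length = R.attrs.length := by rw [← hty, List.length_map]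
  refine ⟨fun i hi => ?_, hrepo.update hR ?_ ?_, fun p hp => ?_⟩
  · rw [nextSt_of_forall_ne]
    · exact he.vars i hi
    · intro p hp h
      obtain ⟨s, a, h'⟩ := hkeys p hp
      simp [h'] at h
  · refine fun r' s' a hr ha => nextSt_of_forall_ne fun p hp => ne_of_slotOf_ne ?_
    obtain ⟨s, b, h⟩ := hkeys p hp
    rw [ha, h]
    simp [AVar.slotOf, hr.symm]
  · rw [hrepo r R hR, ← Multiset.coe_mapAddMonoidHom, map_sum]
    refine Finset.sum_congr rfl fun s hs => ?_
    have hocc : nextSt (I.model hD hI) β upd (.occ r s) = stateOf D β (.occ r s) :=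
      nextSt_of_forall_ne fun p hp h => by
        obtain ⟨s, a, h'⟩ := hkeys p hp
        simp [h'] at h
    rw [slotVal, slotVal, hocc]
    split_ifs with ho
    · rw [Multiset.coe_mapAddMonoidHom, Multiset.map_singleton]
      congr 1
      set t := content (stateOf D β) r R.attrs.length s with ht
      refine ((eq_content_iff (Ite.result_length hb _ _)).2 fun a v hv => ?_).symm
      have ha : a < R.attrs.length := by
        rw [← Ite.result_length (I := I) hb repo (Term.eval id e (bindTuple σ vs t))]
        exact (List.getElem?_eq_some_iff.1 hv).1
      rw [nextSt_of_mem (C := .ite (isOcc r s)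
        (body.tr D m (Term.tr D c (bindSlot D r s ρ vs)) a) (.tm (cellT D r s a)))]
      · rw [CTerm.eval, if_pos (sat_isOcc.2 ho)]
        have hf : TrOK D 0 {v | v ∈ head ++ vs} (Term.tr D c (bindSlot D r s ρ vs)) :=
          TrOK.tr (bindSlot_hasTy hR hvs hty hρ)
        have hev : EvOK (I.model hD hI) β 0 {v | v ∈ head ++ vs}
            (Term.tr D c (bindSlot D r s ρ vs)) (Term.eval id e (bindTuple σ vs t)) := by
          refine EvOK.tr (Nat.zero_le _) he hid fun v hv => ?_
          by_cases h : v ∈ vs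
          · obtain ⟨b, hb'⟩ := List.mem_iff_getElem?.1 h
            have hlt : b < R.attrs.length := hlen ▸ (List.getElem?_eq_some_iff.1 hb').1
            rw [bindSlot_of_mem hvs hb', bindTuple,
              lookup_zip hvs hb' (content_getElem? (stateOf D β) hlt)]
            rfl
          · rw [bindSlot_of_not_mem h, bindTuple, lookup_eq_none_of_forall]
            · exact hσ v ((List.mem_append.1 hv).resolve_right h)
            · intro p hp hpv
              exact h (hpv ▸ (List.of_mem_zip hp).1)
        have := Ite.eval_tr hβ hf hev hrepo ha hb
        exact Option.some.inj (this.symm.trans hv)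
      · rw [hupd]
        exact List.mem_flatMap.2 ⟨s, by simpa using hs, List.mem_map.2 ⟨a, by simpa [hlen], rfl⟩⟩
      · intro C' hC'
        simp only [hupd, List.mem_flatMap, List.mem_map, Prod.mk.injEq, AVar.cell.injEq] at hC'
        obtain ⟨s', -, a', -, ⟨-, rfl, rfl⟩, rfl⟩ := hC'
        rfl
    · simp
  · obtain ⟨s, a, h⟩ := hkeys p hp
    rw [h]
    trivial

theorem Effect.tr_sound (hβ : (I.model hD hI).Sorted β) {nb : ℕ} {mems : List (ℕ × Var)}
    (he : CaseRel D nb mems c (stateOf D β) e) (hid : stateOf D β (.self c) = some id)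
    (hrepo : RepoState D m (stateOf D β) repo)
    (hρ : ∀ v ∈ head, (ρ v).HasTy D v.2)
    (hσ : ∀ v ∈ head, (I.model hD hI).eval β (ρ v) = σ v) {ins : InsertionSemantics} {eff : Effect}
    (heff : eff.WF D head) {t : Trans} (ht : t ∈ eff.tr D ins m c ρ)
    (hg : (I.model hD hI).Sat β t.guard) :
    ∃ x' repo', eff.Apply D ins I id e repo σ x' repo' ∧
      EffMatch D m c t.upd (nextSt (I.model hD hI) β t.upd) x' repo' := by
  have hev : EvOK (I.model hD hI) β 0 {v | v ∈ head} (Term.tr D c ρ) (Term.eval id e σ) :=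
    EvOK.tr (Nat.zero_le _) he hid hσ
  cases eff with
  | set ss =>
    obtain rfl : t = _ := by simpa [Effect.tr] using ht
    exact ⟨_, _, ⟨rfl, rfl⟩, effMatch_set hev heff he.vars hrepo⟩
  | insert r us ss =>
    obtain ⟨⟨R, hR, hus⟩, hss⟩ := heff
    have hus := storable_forall₂ hus
    simp only [Effect.tr, hR, Option.getD_some, List.mem_map, List.mem_range] at ht
    obtain ⟨s, hs, rfl⟩ := ht
    refine ⟨_, _, ⟨rfl, R, hR, rfl⟩, ?_⟩
    cases ins with
    | multisetIns => exact effMatch_insert_multiset hev hss he.vars hrepo hR hus hs hg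
    | setIns =>
      have hg' := hg.imp_right (sat_agreeTr hR (by simpa using hus.length_eq)).1
      rw [hev.map_typedIn hus] at hg'
      exact effMatch_insert_set hev hss he.vars hrepo hR hus hs hg' rfl
  | delete r us ss =>
    obtain ⟨⟨R, hR, hus⟩, hss⟩ := heff
    simp only [Effect.tr, List.mem_map, List.mem_range] at ht
    obtain ⟨s, hs, rfl⟩ := ht
    have hcont := (sat_rowEq (by simpa using hus.length_eq)).1 hg.2
    rw [hev.map_typedIn hus] at hcont
    exact ⟨_, _, ⟨rfl, (hrepo.mem_iff hR).2 ⟨s, hs, hg.1, hcont⟩, rfl⟩,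
      effMatch_delete hev hss he.vars hrepo hR hus hs hg.1 hcont⟩
  | update r vs body =>
    obtain ⟨R, hR, hty, hvs, -, hb⟩ := heff
    obtain rfl : t = _ := by simpa [Effect.tr] using ht
    exact ⟨_, _, ⟨rfl, rfl⟩, effMatch_update hβ he hid hrepo hρ hσ hR hty hvs hb rfl⟩

theorem Effect.tr_complete (hβ : (I.model hD hI).Sorted β) {nb : ℕ} {mems : List (ℕ × Var)}
    (he : CaseRel D nb mems c (stateOf D β) e) (hid : stateOf D β (.self c) = some id)
    (hrepo : RepoState D m (stateOf D β) repo)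
    (hρ : ∀ v ∈ head, (ρ v).HasTy D v.2)
    (hσ : ∀ v ∈ head, (I.model hD hI).eval β (ρ v) = σ v) {ins : InsertionSemantics} {eff : Effect}
    (heff : eff.WF D head) {x' : ℕ → Val} {repo' : ℕ → Multiset (List Val)}
    (happ : eff.Apply D ins I id e repo σ x' repo') (hcard : ∀ r, (repo' r).card ≤ m) :
    ∃ t ∈ eff.tr D ins m c ρ, (I.model hD hI).Sat β t.guard ∧
      EffMatch D m c t.upd (nextSt (I.model hD hI) β t.upd) x' repo' := by
  have hev : EvOK (I.model hD hI) β 0 {v | v ∈ head} (Term.tr D c ρ) (Term.eval id e σ) :=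
    EvOK.tr (Nat.zero_le _) he hid hσ
  cases eff with
  | set ss =>
    obtain ⟨rfl, rfl⟩ := happ
    exact ⟨_, List.mem_singleton.2 rfl, trivial, effMatch_set hev heff he.vars hrepo⟩
  | insert r us ss =>
    obtain ⟨⟨R, hR, hus⟩, hss⟩ := heff
    have hus := storable_forall₂ hus
    obtain ⟨rfl, R', hR', rfl⟩ := happ
    obtain rfl : R = R' := Option.some.inj (hR.symm.trans hR')
    have hcard := hcard r
    rw [Function.update_self] at hcard
    simp only [Effect.tr, hR, Option.getD_some, List.mem_map, List.mem_range,
      exists_exists_and_eq_and]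
    cases ins with
    | multisetIns =>
      obtain ⟨s, hs, hfree⟩ := exists_free_slot (w := stateOf D β) (r := r) (m := m)
        (n := R.attrs.length) (by
          rw [insertTuple, Multiset.card_cons, hrepo r R hR] at hcard
          omega)
      exact ⟨s, hs, hfree, effMatch_insert_multiset hev hss he.vars hrepo hR hus hs hfree⟩
    | setIns =>
      have hag : ∀ s, (I.model hD hI).Sat β (agreeTr D r s R.key (us.map (Term.tr D c ρ))) ↔
          agree R.key (content (stateOf D β) r R.attrs.length s)
            (us.map (Term.eval id e σ)) = true := by
        intro s
        rw [sat_agreeTr hR (by simpa using hus.length_eq), hev.map_typedIn hus]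
      obtain ⟨s, hs, h⟩ : ∃ s < m, stateOf D β (.occ r s) ≠ some 0 ∨
          agree R.key (content (stateOf D β) r R.attrs.length s)
            (us.map (Term.eval id e σ)) = true := by
        by_contra! hc
        rw [insertTuple, Multiset.card_cons, Multiset.filter_eq_self.2, hrepo r R hR] at hcard
        · obtain ⟨s, hs, hfree⟩ := exists_free_slot hcard
          exact hfree (hc s hs).1
        · intro t ht
          obtain ⟨s, hs, -, rfl⟩ := (hrepo.mem_iff hR).1 ht
          exact Bool.eq_false_iff.2 (hc s hs).2
      exact ⟨s, hs, h.imp_right (hag s).2,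
        effMatch_insert_set hev hss he.vars hrepo hR hus hs h rfl⟩
  | delete r us ss =>
    obtain ⟨⟨R, hR, hus⟩, hss⟩ := heff
    obtain ⟨rfl, hmem, rfl⟩ := happ
    obtain ⟨s, hs, hocc, hcont⟩ := (hrepo.mem_iff hR).1 hmem
    refine ⟨_, List.mem_map.2 ⟨s, List.mem_range.2 hs, rfl⟩, ⟨hocc, ?_⟩,
      effMatch_delete hev hss he.vars hrepo hR hus hs hocc hcont⟩
    rw [sat_rowEq (by simpa using hus.length_eq), hcont, hev.map_typedIn hus]
  | update r vs body =>
    obtain ⟨R, hR, hty, hvs, -, hb⟩ := heff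
    obtain ⟨rfl, rfl⟩ := happ
    exact ⟨_, List.mem_singleton.2 rfl, trivial,
      effMatch_update hβ he hid hrepo hρ hσ hR hty hvs hb rfl⟩

end

end Effects

/-! ## Semantics of guards and rules -/

theorem InDom.sort {D : Schema} (hD : D.WF) {I : CatInst} {ids : Finset ℕ} {τ : Ty} {v : Val}
    (h : InDom D I ids τ v) : I.Sort D τ v := by
  cases v with
  | none => cases τ <;> trivial
  | some k =>
    cases τ with
    | ident s =>
      intro hs
      have hne : s ≠ D.ctype := fun e => by simp [e, hD.ctype_new] at hs
      simpa [InDom, hne] using h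
    | enum a n => exact h
    | prim a => exact h

theorem Term.knownTy_of_mem_vars {D : Schema} {nb : ℕ} {t : Term} {τ : Ty}
    (ht : t.ty D nb = some τ) {v : Var} (hv : v ∈ t.vars) : D.knownTy v.2 = true := by
  cases t with
  | var u =>
    obtain rfl : v = u := by simpa [Term.vars] using hv
    simp only [Term.ty] at ht
    split_ifs at ht with h
    exact h
  | _ => simp [Term.vars] at hv

theorem Lit.knownTy_of_mem_vars {D : Schema} {nb : ℕ} {l : Lit} (hl : l.WF D nb) {v : Var}
    (hv : v ∈ l.vars) : D.knownTy v.2 = true := by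
  cases l with
  | eq pos a b =>
    obtain ⟨τ, ha, hb⟩ := hl
    exact (List.mem_append.1 hv).elim (Term.knownTy_of_mem_vars ha) (Term.knownTy_of_mem_vars hb)
  | rel pos R ts =>
    obtain ⟨τs, -, hts⟩ := hl
    obtain ⟨t, ht, hv⟩ := List.mem_flatMap.1 hv
    obtain ⟨i, hi⟩ := List.mem_iff_getElem?.1 ht
    obtain ⟨τ, -, hτ⟩ := forall₂_getElem? (forall₂_of_map_eq hts) hi
    exact Term.knownTy_of_mem_vars hτ hv

theorem Guard.knownTy_of_mem_vars {D : Schema} {nb : ℕ} {G : Guard} (hG : G.WF D nb) {v : Var}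
    (hv : v ∈ G.vars) : D.knownTy v.2 = true := by
  rcases List.mem_append.1 hv with hv | hv
  · exact hG.1 v hv
  · obtain ⟨Q, hQ, hv⟩ := List.mem_flatMap.1 hv
    obtain ⟨l, hl, hv⟩ := List.mem_flatMap.1 hv
    exact Lit.knownTy_of_mem_vars (hG.2 Q hQ l hl) hv

/-- The identifiers in the case slots. -/
def IdsIn (nc : ℕ) (w : AVar → Val) (ids : Finset ℕ) : Prop :=
  ∀ id, id ∈ ids ↔ ∃ c < nc, w (.self c) = some id

/-- Values for the quantified variables, over given values of the current variables. -/
def withEx (α : SVar → Val) (σ : ℕ → Var → Val) : SVar → Val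
  | ⟨.cur a, τ⟩ => α ⟨.cur a, τ⟩
  | ⟨.nxt _, _⟩ => none
  | ⟨.ex tag n, τ⟩ => σ tag (n, τ)

section Guards

variable {D : Schema} {hD : D.WF} {I : CatInst} {hI : I.Valid D} {β : SVar → Val}

theorem sorted_withEx {α : SVar → Val} (hα : (I.model hD hI).Sorted α) {σ : ℕ → Var → Val}
    (hσ : ∀ tag v, I.Sort D v.2 (σ tag v)) : (I.model hD hI).Sorted (withEx α σ) := by
  rintro ⟨a | a | ⟨tag, n⟩, τ⟩
  · exact hα _
  · exact (I.model hD hI).undef_sort τ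
  · exact hσ tag (n, τ)

theorem withEx_of_isCur {α : SVar → Val} {σ : ℕ → Var → Val} {x : SVar} (hx : x.isCur = true) :
    withEx α σ x = α x := by
  obtain ⟨a | a | ⟨tag, n⟩, τ⟩ := x
  · rfl
  · simp [SVar.isCur] at hx
  · simp [SVar.isCur] at hx

theorem sat_caseDom (hβ : (I.model hD hI).Sorted β) {nc : ℕ} {ids : Finset ℕ}
    (hids : IdsIn nc (stateOf D β) ids) {ρ : Var → STerm} {v : Var}
    (hv : D.knownTy v.2 = true) (hty : (ρ v).HasTy D v.2) :
    (I.model hD hI).Sat β (caseDom D nc ρ v) ↔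
      InDom D I ids v.2 ((I.model hD hI).eval β (ρ v)) := by
  have hs := (I.model hD hI).sort_eval hβ hty.1
  rw [caseDom]
  split_ifs with h
  · simp only [TModel.Sat, TModel.sat_bigOr, List.mem_map, List.mem_range,
      exists_exists_and_eq_and, TModel.eval]
    rw [h]
    cases hx : (I.model hD hI).eval β (ρ v) with
    | none => simp [InDom]
    | some k =>
      simp only [InDom, if_true, hids k, reduceCtorEq, false_or]
      exact exists_congr fun c => and_congr_right fun _ => eq_comm
  · refine iff_of_true trivial ?_
    generalize (I.model hD hI).eval β (ρ v) = x at hs ⊢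
    cases x with
    | none => simp [InDom]
    | some k =>
      generalize v.2 = τ at *
      cases τ with
      | ident s =>
        have hne : s ≠ D.ctype := fun e => h (by rw [e])
        have hc : D.isCatId s = true := by simpa [Schema.knownTy, hne] using hv
        simpa [InDom, hne] using hs hc
      | enum a n => exact hs
      | prim a => exact hs

variable {nb nc m c id : ℕ} {mems : List (ℕ × Var)} {ids : Finset ℕ} {e : CaseEntry}
  {repo : ℕ → Multiset (List Val)}

theorem Guard.sat_tr (hβ : (I.model hD hI).Sorted β) (hids : IdsIn nc (stateOf D β) ids)
    (he : CaseRel D nb mems c (stateOf D β) e) (hid : stateOf D β (.self c) = some id)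
    (hrepo : RepoState D m (stateOf D β) repo) {nb' : ℕ} (hnb : nb' ≤ nb) {G : Guard}
    (hG : G.WF D nb') {ρ : Var → STerm} (hρ : ∀ v ∈ G.vars, (ρ v).HasTy D v.2) {σ : Var → Val}
    (hσ : ∀ v ∈ G.vars, (I.model hD hI).eval β (ρ v) = σ v) :
    (I.model hD hI).Sat β (G.tr D nc m c ρ) ↔
      (∀ v ∈ G.vars, InDom D I ids v.2 (σ v)) ∧ UCQHolds I repo (Term.eval id e σ) G.body := by
  rw [Guard.tr, TModel.Sat, TModel.sat_bigAnd, List.forall_mem_map]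
  refine and_congr (forall₂_congr fun v hv => ?_) ?_
  · rw [sat_caseDom hβ hids (Guard.knownTy_of_mem_vars hG hv) (hρ v hv), hσ v hv]
  · exact sat_ucqTr (nb := nb') (V := {v | v ∈ G.vars}) hβ (TrOK.tr hρ) (EvOK.tr hnb he hid hσ)
      hrepo fun Q hQ l hl => ⟨hG.2 Q hQ l hl, fun v hv => Guard.mem_vars_of_body hQ hl hv⟩

open Classical in
theorem Guard.tr_sound (hβ : (I.model hD hI).Sorted β) (hids : IdsIn nc (stateOf D β) ids)
    (he : CaseRel D nb mems c (stateOf D β) e) (hid : stateOf D β (.self c) = some id)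
    (hrepo : RepoState D m (stateOf D β) repo) {nb' : ℕ} (hnb : nb' ≤ nb) {G : Guard}
    (hG : G.WF D nb') {ρ : Var → STerm} (hρ : ∀ v ∈ G.vars, (ρ v).HasTy D v.2)
    (h : (I.model hD hI).Sat β (G.tr D nc m c ρ)) :
    ∃ σ, Assignment D I ids σ ∧ (∀ v ∈ G.vars, (I.model hD hI).eval β (ρ v) = σ v) ∧
      UCQHolds I repo (Term.eval id e σ) G.body := by
  have hσ : ∀ v ∈ G.vars, (I.model hD hI).eval β (ρ v) =
      (fun v => if v ∈ G.vars then (I.model hD hI).eval β (ρ v) else none) v := by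
    intro v hv
    simp [hv]
  obtain ⟨h₁, h₂⟩ := (Guard.sat_tr hβ hids he hid hrepo hnb hG hρ hσ).1 h
  refine ⟨_, fun v => ?_, hσ, h₂⟩
  by_cases hv : v ∈ G.vars
  · exact h₁ v hv
  · simp [hv, InDom]

/-- The variables that the data part of a rule may change. -/
def AVar.IsAct (c : ℕ) (a : AVar) : Prop := a.IsData c ∨ ∃ b v, a = .mem c b v

/-- The update `upd` belongs to the data part of a rule for the case in slot `c`, and the values
after it represent the given new case data and the given new repository. -/
structure ActMatch (D : Schema) (m c : ℕ) (mems : List (ℕ × Var)) (upd : List (AVar × CTerm))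
    (w' : AVar → Val) (x' : ℕ → Val) (mem' : ℕ → Var → Val)
    (repo' : ℕ → Multiset (List Val)) : Prop where
  vars : ∀ i < D.cvars.length, w' (.cvar c i) = x' i
  mem : ∀ p ∈ mems, w' (.mem c p.1 p.2) = mem' p.1 p.2
  repo : RepoState D m w' repo'
  keys : ∀ p ∈ upd, p.1.IsAct c

theorem ActMatch.nil (he : CaseRel D nb mems c (stateOf D β) e)
    (hrepo : RepoState D m (stateOf D β) repo) :
    ActMatch D m c mems [] (nextSt (I.model hD hI) β []) e.vars e.mem repo :=
  ⟨he.vars, he.mem, hrepo, by simp⟩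

theorem EffMatch.actMatch (he : CaseRel D nb mems c (stateOf D β) e)
    {upd : List (AVar × CTerm)} {x' : ℕ → Val} {repo' : ℕ → Multiset (List Val)}
    (h : EffMatch D m c upd (nextSt (I.model hD hI) β upd) x' repo') :
    ActMatch D m c mems upd (nextSt (I.model hD hI) β upd) x' e.mem repo' := by
  refine ⟨h.vars, fun p hp => ?_, h.repo, fun p hp => .inl (h.keys p hp)⟩
  rw [nextSt_of_forall_ne]
  · exact he.mem p hp
  · intro q hq hqp
    have := h.keys q hq
    rw [hqp] at this
    exact this

theorem actMatch_bind (he : CaseRel D nb mems c (stateOf D β) e)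
    (hrepo : RepoState D m (stateOf D β) repo) {b : ℕ} {head : List Var} {σ : Var → Val}
    (hσ : ∀ v ∈ head, (I.model hD hI).eval β (exVar 0 v) = σ v) {upd : List (AVar × CTerm)}
    (hupd : upd = head.map fun v => (.mem c b v, .tm (exVar 0 v))) :
    ActMatch D m c mems upd (nextSt (I.model hD hI) β upd) e.vars
      (Function.update e.mem b fun v => if v ∈ head then σ v else e.mem b v) repo := by
  have hkeys : ∀ p ∈ upd, ∃ v ∈ head, p = (.mem c b v, .tm (exVar 0 v)) := by
    intro p hp
    rw [hupd] at hp
    obtain ⟨v, hv, rfl⟩ := List.mem_map.1 hp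
    exact ⟨v, hv, rfl⟩
  refine ⟨fun i hi => ?_, fun p hp => ?_, hrepo.congr fun a ha => ?_, fun p hp => ?_⟩
  · rw [nextSt_of_forall_ne]
    · exact he.vars i hi
    · intro p hp
      obtain ⟨v, -, rfl⟩ := hkeys p hp
      simp
  · obtain ⟨b', v⟩ := p
    by_cases h : b' = b ∧ v ∈ head
    · obtain ⟨rfl, hv⟩ := h
      rw [Function.update_self, if_pos hv, nextSt_of_mem (C := .tm (exVar 0 v))]
      · exact hσ v hv
      · rw [hupd]
        exact List.mem_map.2 ⟨v, hv, rfl⟩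
      · intro C' hC'
        obtain ⟨v', -, h⟩ := hkeys _ hC'
        simp only [Prod.mk.injEq, AVar.mem.injEq, true_and] at h
        rw [h.2, h.1]
    · rw [nextSt_of_forall_ne, he.mem _ hp]
      · by_cases hb : b' = b
        · subst hb
          simp only [true_and] at h
          simp [h]
        · rw [Function.update_of_ne hb]
      · intro p hp hpv
        obtain ⟨v', hv', rfl⟩ := hkeys p hp
        simp only [AVar.mem.injEq, true_and] at hpv
        exact h ⟨hpv.1.symm, hpv.2 ▸ hv'⟩
  · refine nextSt_of_forall_ne fun p hp hpa => ha ?_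
    obtain ⟨v, -, rfl⟩ := hkeys p hp
    rw [← hpa]
    rfl
  · obtain ⟨v, -, rfl⟩ := hkeys p hp
    exact .inr ⟨b, v, rfl⟩

theorem Act.tr_sound (hβ : (I.model hD hI).Sorted β) {s : Snapshot}
    (hids : IdsIn nc (stateOf D β) s.ids)
    (he : CaseRel D nb mems c (stateOf D β) (s.entry id))
    (hid : stateOf D β (.self c) = some id) (hrepo : RepoState D m (stateOf D β) s.repo)
    {L : List Rule}
    (hL : ∀ b (g : Guard), (∃ ρ ∈ L, ρ.act = .bind b g) → ∀ v ∈ g.head, (b, v) ∈ mems)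
    {ins : InsertionSemantics} {act : Act} (hact : act.OK D L) {t : Trans}
    (ht : t ∈ act.tr D ins nc m c) (hg : (I.model hD hI).Sat β t.guard) :
    ∃ x' mem' repo', act.Apply D ins I s id x' mem' repo' ∧
      ActMatch D m c mems t.upd (nextSt (I.model hD hI) β t.upd) x' mem' repo' := by
  cases act with
  | skip =>
    obtain rfl : t = _ := by simpa [Act.tr] using ht
    exact ⟨_, _, _, ⟨rfl, rfl, rfl⟩, .nil he hrepo⟩
  | test φ =>
    obtain rfl : t = _ := by simpa [Act.tr] using ht
    refine ⟨_, _, _, ⟨?_, rfl, rfl, rfl⟩, .nil he hrepo⟩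
    exact (Cond.sat_tr (V := ∅) (EvOK.tr (Nat.zero_le _) he hid (by simp)) hact).1 hg
  | exec u =>
    simp only [Act.tr, List.mem_map] at ht
    obtain ⟨t, ht, rfl⟩ := ht
    obtain ⟨σ, hσ, hσ', hu⟩ := Guard.tr_sound hβ hids he hid hrepo (Nat.zero_le _) hact.1
      (fun v _ => exVar_hasTy 0 v) hg.1
    obtain ⟨x', repo', happ, hm⟩ := Effect.tr_sound hβ he hid hrepo (fun v _ => exVar_hasTy 0 v)
      (fun v hv => hσ' v (List.mem_append_left _ hv)) hact.2 ht hg.2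
    exact ⟨x', _, repo', ⟨σ, hσ, hu, happ, rfl⟩, hm.actMatch he⟩
  | bind b g =>
    obtain rfl : t = _ := by simpa [Act.tr] using ht
    obtain ⟨σ, hσ, hσ', hu⟩ := Guard.tr_sound hβ hids he hid hrepo (Nat.zero_le _) hact
      (fun v _ => exVar_hasTy 0 v) hg
    exact ⟨_, _, _, ⟨σ, hσ, hu, rfl, rfl, rfl⟩, actMatch_bind he hrepo
      (fun v hv => hσ' v (List.mem_append_left _ hv)) rfl⟩
  | release b ss =>
    obtain rfl : t = _ := by simpa [Act.tr] using ht
    obtain ⟨g, hbind, -, hss⟩ := hact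
    refine ⟨_, _, _, ⟨rfl, rfl, rfl⟩, EffMatch.actMatch he ?_⟩
    refine effMatch_set (head := g.head) (EvOK.tr (Nat.zero_le _) he hid fun v hv => ?_) hss
      he.vars hrepo
    exact he.mem _ (hL b g hbind v hv)

theorem Act.tr_complete {α : SVar → Val} (hα : (I.model hD hI).Sorted α) {s : Snapshot}
    (hids : IdsIn nc (stateOf D α) s.ids)
    (he : CaseRel D nb mems c (stateOf D α) (s.entry id))
    (hid : stateOf D α (.self c) = some id) (hrepo : RepoState D m (stateOf D α) s.repo)
    {L : List Rule}
    (hL : ∀ b (g : Guard), (∃ ρ ∈ L, ρ.act = .bind b g) → ∀ v ∈ g.head, (b, v) ∈ mems)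
    {ins : InsertionSemantics} {act : Act} (hact : act.OK D L) {x' : ℕ → Val}
    {mem' : ℕ → Var → Val} {repo' : ℕ → Multiset (List Val)}
    (happ : act.Apply D ins I s id x' mem' repo') (hcard : ∀ r, (repo' r).card ≤ m) :
    ∃ t ∈ act.tr D ins nc m c, ∃ σ : ℕ → Var → Val, (∀ tag v, I.Sort D v.2 (σ tag v)) ∧
      (I.model hD hI).Sat (withEx α σ) t.guard ∧
      ActMatch D m c mems t.upd (nextSt (I.model hD hI) (withEx α σ) t.upd) x' mem' repo' := by
  have hnone : ∀ (_ : ℕ) (v : Var), I.Sort D v.2 ((fun _ _ => none : ℕ → Var → Val) 0 v) :=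
    fun _ v => (I.model hD hI).undef_sort v.2
  have hsort : ∀ σ : Var → Val, Assignment D I s.ids σ → ∀ (_ : ℕ) (v : Var),
      I.Sort D v.2 (σ v) := fun σ hσ _ v => (hσ v).sort hD
  cases act with
  | skip =>
    obtain ⟨rfl, rfl, rfl⟩ := happ
    exact ⟨_, List.mem_singleton.2 rfl, fun _ _ => none, hnone, trivial,
      ActMatch.nil (nb := nb) (β := withEx α fun _ _ => none) he hrepo⟩
  | test φ =>
    obtain ⟨hφ, rfl, rfl, rfl⟩ := happ
    refine ⟨_, List.mem_singleton.2 rfl, fun _ _ => none, hnone, ?_,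
      ActMatch.nil (nb := nb) (β := withEx α fun _ _ => none) he hrepo⟩
    exact (Cond.sat_tr (V := ∅) (EvOK.tr (β := withEx α fun _ _ => none) (Nat.zero_le _) he hid
      (by simp)) hact).2 hφ
  | exec u =>
    obtain ⟨σ, hσ, hu, heff, rfl⟩ := happ
    have hβ := sorted_withEx (hD := hD) (hI := hI) hα (hsort σ hσ)
    obtain ⟨t, ht, hg, hm⟩ := Effect.tr_complete (head := u.pre.head) (ρ := exVar 0) (c := c) hβ
      he hid hrepo (fun v _ => exVar_hasTy 0 v) (fun v _ => rfl) hact.2 heff hcard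
    refine ⟨_, List.mem_map.2 ⟨t, ht, rfl⟩, fun _ => σ, hsort σ hσ, ⟨?_, hg⟩,
      EffMatch.actMatch (nb := nb) (β := withEx α fun _ => σ) he hm⟩
    exact (Guard.sat_tr hβ hids he hid hrepo (Nat.zero_le _) hact.1
      (fun v _ => exVar_hasTy 0 v) fun v _ => rfl).2 ⟨fun v _ => hσ v, hu⟩
  | bind b g =>
    obtain ⟨σ, hσ, hu, rfl, rfl, rfl⟩ := happ
    have hβ := sorted_withEx (hD := hD) (hI := hI) hα (hsort σ hσ)
    refine ⟨_, List.mem_singleton.2 rfl, fun _ => σ, hsort σ hσ, ?_,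
      actMatch_bind (nb := nb) (β := withEx α fun _ => σ) he hrepo (fun v _ => rfl) rfl⟩
    exact (Guard.sat_tr hβ hids he hid hrepo (Nat.zero_le _) hact
      (fun v _ => exVar_hasTy 0 v) fun v _ => rfl).2 ⟨fun v _ => hσ v, hu⟩
  | release b ss =>
    obtain ⟨rfl, rfl, rfl⟩ := happ
    obtain ⟨g, hbind, -, hss⟩ := hact
    refine ⟨_, List.mem_singleton.2 rfl, fun _ _ => none, hnone, trivial,
      EffMatch.actMatch (nb := nb) (β := withEx α fun _ _ => none) he ?_⟩
    refine effMatch_set (head := g.head) (β := withEx α fun _ _ => none)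
      (EvOK.tr (β := withEx α fun _ _ => none) (Nat.zero_le _) he hid fun v hv => ?_) hss he.vars
      hrepo
    exact he.mem _ (hL b g hbind v hv)

theorem LState.code_injective : Function.Injective LState.code := by
  intro p q h
  cases p <;> cases q <;> simp_all [LState.code]

/-- The variables that a rule for the case in slot `c` may change. -/
def AVar.IsRule (c : ℕ) (a : AVar) : Prop := a.IsAct c ∨ ∃ b, a = .ctl c b

/-- The update of a rule: the states of `post`, and the update of its data part. -/
def ruleUpd (c : ℕ) (post : List (ℕ × LState)) (upd : List (AVar × CTerm)) :
    List (AVar × CTerm) :=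
  post.map (fun p => (.ctl c p.1, .tm (.const lifeTy (some p.2.code)))) ++ upd

theorem ActMatch.rule (he : CaseRel D nb mems c (stateOf D β) e) {upd : List (AVar × CTerm)}
    {x' : ℕ → Val} {mem' : ℕ → Var → Val} {repo' : ℕ → Multiset (List Val)}
    (h : ActMatch D m c mems upd (nextSt (I.model hD hI) β upd) x' mem' repo')
    (post : List (ℕ × LState)) :
    CaseRel D nb mems c (nextSt (I.model hD hI) β (ruleUpd c post upd))
      ⟨x', fun b => (post.lookup b).getD (e.ctl b), mem'⟩ ∧
    RepoState D m (nextSt (I.model hD hI) β (ruleUpd c post upd)) repo' ∧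
    ∀ p ∈ ruleUpd c post upd, p.1.IsRule c := by
  have hne : ∀ a : AVar, (∀ b, a ≠ .ctl c b) →
      nextSt (I.model hD hI) β (ruleUpd c post upd) a = nextSt (I.model hD hI) β upd a := by
    refine fun a ha => nextSt_append_right fun p hp hpa => ?_
    obtain ⟨q, -, rfl⟩ := List.mem_map.1 hp
    exact ha q.1 hpa.symm
  refine ⟨⟨fun i hi => ?_, fun b hb => ?_, fun p hp => ?_⟩, h.repo.congr fun a ha => ?_,
    fun p hp => ?_⟩
  · rw [hne _ (by simp), h.vars i hi]
  · rw [ruleUpd, nextSt_append_left]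
    · have hk := lookup_map_key (k := AVar.ctl c) (fun _ _ h => (AVar.ctl.inj h).2)
        (fun q : LState => CTerm.tm (.const lifeTy (some q.code))) post b
      rw [nextSt, nextC, hk]
      dsimp only
      cases hl : post.lookup b with
      | none => exact he.ctl b hb
      | some q => rfl
    · intro p hp hpa
      have := h.keys p hp
      rw [hpa] at this
      simp [AVar.IsAct, AVar.IsData] at this
  · rw [hne _ (by simp), h.mem p hp]
  · refine hne a fun b hb => ha ?_
    rw [hb]
    rfl
  · rcases List.mem_append.1 hp with hp | hp
    · obtain ⟨q, -, rfl⟩ := List.mem_map.1 hp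
      exact .inr ⟨q.1, rfl⟩
    · exact .inl (h.keys p hp)

end Guards

/-! ## The simulation -/

/-- The values of the artifact variables represent the snapshot. -/
structure Rel (M : DAB) (nc m : ℕ) (s : Snapshot) (w : AVar → Val) : Prop where
  ids : IdsIn nc w s.ids
  inj : ∀ c < nc, ∀ c' < nc, ∀ id, w (.self c) = some id → w (.self c') = some id → c = c'
  active : ∀ c < nc, ∀ id, w (.self c) = some id →
    CaseRel M.schema M.root.size M.stored c w (s.entry id)
  inactive : ∀ c < nc, w (.self c) = none → CaseRel M.schema M.root.size M.stored c w .fresh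
  repo : RepoState M.schema m w s.repo

theorem CaseRel.congr {D : Schema} {nb c : ℕ} {mems : List (ℕ × Var)} {w w' : AVar → Val}
    {e : CaseEntry} (h : CaseRel D nb mems c w e)
    (hvars : ∀ i < D.cvars.length, w' (.cvar c i) = w (.cvar c i))
    (hctl : ∀ b < nb, w' (.ctl c b) = w (.ctl c b))
    (hmem : ∀ p ∈ mems, w' (.mem c p.1 p.2) = w (.mem c p.1 p.2)) : CaseRel D nb mems c w' e :=
  ⟨fun i hi => (hvars i hi).trans (h.vars i hi), fun b hb => (hctl b hb).trans (h.ctl b hb),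
    fun p hp => (hmem p hp).trans (h.mem p hp)⟩

theorem Rel.congr {M : DAB} {nc m : ℕ} {s : Snapshot} {w w' : AVar → Val} (h : Rel M nc m s w)
    (hw : ∀ a, SysVar M nc m a → w' a = w a) : Rel M nc m s w' := by
  have hself : ∀ c < nc, w' (.self c) = w (.self c) := fun c hc => hw _ hc
  have hcase : ∀ c < nc, ∀ e, CaseRel M.schema M.root.size M.stored c w e →
      CaseRel M.schema M.root.size M.stored c w' e := fun c hc e he =>
    he.congr (fun i hi => hw _ ⟨hc, hi⟩) (fun b hb => hw _ ⟨hc, hb⟩) fun p hp => hw _ ⟨hc, hp⟩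
  refine ⟨fun id => ?_, fun c hc c' hc' id h₁ h₂ => ?_, fun c hc id hid => ?_, fun c hc hid => ?_,
    fun r R hR => ?_⟩
  · rw [h.ids id]
    exact exists_congr fun c => and_congr_right fun hc => by rw [hself c hc]
  · rw [hself c hc] at h₁
    rw [hself c' hc'] at h₂
    exact h.inj c hc c' hc' id h₁ h₂
  · rw [hself c hc] at hid
    exact hcase c hc _ (h.active c hc id hid)
  · rw [hself c hc] at hid
    exact hcase c hc _ (h.inactive c hc hid)
  · rw [h.repo r R hR]
    refine Finset.sum_congr rfl fun s hs => ?_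
    have hs := Finset.mem_range.1 hs
    have ho : w' (.occ r s) = w (.occ r s) := hw _ ⟨(List.getElem?_eq_some_iff.1 hR).1, hs⟩
    have hc : content w' r R.attrs.length s = content w r R.attrs.length s :=
      List.map_congr_left fun a ha => hw _ ⟨hs, R, hR, List.mem_range.1 ha⟩
    rw [slotVal, slotVal, ho, hc]

theorem Rel.progress {M : DAB} {nc m : ℕ} {s : Snapshot} {w w' : AVar → Val}
    (h : Rel M nc m s w) {c id : ℕ} (hc : c < nc) (hid : w (.self c) = some id)
    (hframe : ∀ a : AVar, ¬ a.IsRule c → w' a = w a) {e' : CaseEntry}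
    (hcase : CaseRel M.schema M.root.size M.stored c w' e') {repo' : ℕ → Multiset (List Val)}
    (hrepo : RepoState M.schema m w' repo') :
    Rel M nc m ⟨s.ids, Function.update s.entry id e', repo'⟩ w' := by
  have hself : ∀ c', w' (.self c') = w (.self c') := fun c' =>
    hframe _ (by simp [AVar.IsRule, AVar.IsAct, AVar.IsData])
  have hother : ∀ c', c' ≠ c → ∀ e, CaseRel M.schema M.root.size M.stored c' w e →
      CaseRel M.schema M.root.size M.stored c' w' e := fun c' hc' e he =>
    he.congr (fun i _ => hframe _ (by simp [AVar.IsRule, AVar.IsAct, AVar.IsData, hc']))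
      (fun b _ => hframe _ (by simp [AVar.IsRule, AVar.IsAct, AVar.IsData, hc']))
      fun p _ => hframe _ (by simp [AVar.IsRule, AVar.IsAct, AVar.IsData, hc'])
  refine ⟨fun id' => ?_, ?_, fun c' hc' id' hid' => ?_, fun c' hc' hid' => ?_, hrepo⟩
  · simp only [hself]
    exact h.ids id'
  · simp only [hself]
    exact h.inj
  · rw [hself] at hid'
    by_cases hcc : c' = c
    · subst hcc
      obtain rfl : id = id' := Option.some.inj (hid.symm.trans hid')
      simpa using hcase
    · have hne : id' ≠ id := fun e => hcc (h.inj c' hc' c hc id (e ▸ hid') hid)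
      simp only [Function.update_of_ne hne]
      exact hother c' hcc _ (h.active c' hc' id' hid')
  · rw [hself] at hid'
    have hcc : c' ≠ c := fun e => by simp [e, hid] at hid'
    exact hother c' hcc _ (h.inactive c' hc' hid')

theorem Rel.newCase {M : DAB} {nc m : ℕ} {s : Snapshot} {w w' : AVar → Val}
    (h : Rel M nc m s w) {c id : ℕ} (hc : c < nc) (hfree : w (.self c) = none)
    (hid : id ∉ s.ids) (hself : w' (.self c) = some id)
    (hframe : ∀ a : AVar, a ≠ .self c → w' a = w a) :
    Rel M nc m ⟨insert id s.ids, Function.update s.entry id .fresh, s.repo⟩ w' := by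
  have hcase : ∀ c' e, CaseRel M.schema M.root.size M.stored c' w e →
      CaseRel M.schema M.root.size M.stored c' w' e := fun c' e he =>
    he.congr (fun i _ => hframe _ (by simp)) (fun b _ => hframe _ (by simp))
      fun p _ => hframe _ (by simp)
  have hother : ∀ c', c' ≠ c → w' (.self c') = w (.self c') := fun c' hc' =>
    hframe _ (by simpa using hc')
  have hold : ∀ c' < nc, c' ≠ c → ∀ id', w' (.self c') = some id' → id' ≠ id := by
    intro c' hc' hcc id' hid' e
    rw [hother c' hcc] at hid'
    exact hid ((h.ids id).2 ⟨c', hc', e ▸ hid'⟩)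
  refine ⟨fun id' => ?_, fun c₁ h₁ c₂ h₂ id' e₁ e₂ => ?_, fun c' hc' id' hid' => ?_,
    fun c' hc' hid' => ?_, h.repo.congr fun a ha => hframe a ?_⟩
  · simp only [Finset.mem_insert, h.ids id']
    constructor
    · rintro (rfl | ⟨c', hc', h'⟩)
      · exact ⟨c, hc, hself⟩
      · refine ⟨c', hc', ?_⟩
        rw [hother c' fun e => by simp [e, hfree] at h']
        exact h'
    · rintro ⟨c', hc', h'⟩
      by_cases hcc : c' = c
      · subst hcc
        exact .inl (Option.some.inj (h'.symm.trans hself))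
      · exact .inr ⟨c', hc', hother c' hcc ▸ h'⟩
  · by_cases hc₁ : c₁ = c
    · by_cases hc₂ : c₂ = c
      · rw [hc₁, hc₂]
      · rw [hc₁, hself] at e₁
        exact absurd (Option.some.inj e₁).symm (hold c₂ h₂ hc₂ id' e₂)
    · by_cases hc₂ : c₂ = c
      · rw [hc₂, hself] at e₂
        exact absurd (Option.some.inj e₂).symm (hold c₁ h₁ hc₁ id' e₁)
      · rw [hother c₁ hc₁] at e₁
        rw [hother c₂ hc₂] at e₂
        exact h.inj c₁ h₁ c₂ h₂ id' e₁ e₂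
  · by_cases hcc : c' = c
    · subst hcc
      obtain rfl : id = id' := Option.some.inj (hself.symm.trans hid')
      simp only [Function.update_self]
      exact hcase _ _ (h.inactive _ hc hfree)
    · simp only [Function.update_of_ne (hold c' hc' hcc id' hid')]
      rw [hother c' hcc] at hid'
      exact hcase _ _ (h.active c' hc' id' hid')
  · have hcc : c' ≠ c := fun e => by simp [e, hself] at hid'
    rw [hother c' hcc] at hid'
    exact hcase _ _ (h.inactive c' hc' hid')
  · exact fun e => ha (by rw [e]; rfl)

theorem Rel.card_lt {M : DAB} {nc m : ℕ} {s : Snapshot} {w : AVar → Val}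
    (h : Rel M nc m s w) {c : ℕ} (hc : c < nc) (hfree : w (.self c) = none) : s.ids.card < nc := by
  have hsub : s.ids ⊆ ((Finset.range nc).erase c).image fun c => (w (.self c)).getD 0 := by
    intro id hid
    obtain ⟨c', hc', h'⟩ := (h.ids id).1 hid
    refine Finset.mem_image.2 ⟨c', Finset.mem_erase.2 ⟨?_, Finset.mem_range.2 hc'⟩, by simp [h']⟩
    rintro rfl
    simp [hfree] at h'
  have h₁ := Finset.card_le_card hsub
  have h₂ := Finset.card_image_le (s := (Finset.range nc).erase c)
    (f := fun c => (w (.self c)).getD 0)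
  rw [Finset.card_erase_of_mem (Finset.mem_range.2 hc), Finset.card_range] at h₂
  omega

theorem Rel.exists_free {M : DAB} {nc m : ℕ} {s : Snapshot} {w : AVar → Val}
    (h : Rel M nc m s w) (hcard : s.ids.card < nc) : ∃ c < nc, w (.self c) = none := by
  by_contra! hc
  have hsome : ∀ c < nc, w (.self c) = some ((w (.self c)).getD 0) := by
    intro c hlt
    obtain ⟨id, hid⟩ := Option.ne_none_iff_exists'.1 (hc c hlt)
    simp [hid]
  have := Finset.card_le_card_of_injOn (s := Finset.range nc) (t := s.ids)
    (fun c => (w (.self c)).getD 0)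
    (fun c hlt => (h.ids _).2 ⟨c, by simpa using hlt, hsome c (by simpa using hlt)⟩) (by
      intro c₁ h₁ c₂ h₂ e
      have h₁ : c₁ < nc := by simpa using h₁
      have h₂ : c₂ < nc := by simpa using h₂
      refine h.inj c₁ h₁ c₂ h₂ _ (hsome c₁ h₁) ?_
      have e : (w (.self c₁)).getD 0 = (w (.self c₂)).getD 0 := e
      rw [e]
      exact hsome c₂ h₂)
  rw [Finset.card_range] at this
  omega

theorem Setting.caseSlots_le (S : Setting) (k : ℕ) {N : ℕ} (hN : S.caseLimit = some N) :
    S.caseSlots k ≤ N := by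
  simp [Setting.caseSlots, hN]

theorem Setting.lt_caseSlots {S : Setting} {k n : ℕ} (hk : n < k)
    (hN : ∀ N, S.caseLimit = some N → n < N) : n < S.caseSlots k := by
  rw [Setting.caseSlots]
  cases h : S.caseLimit with
  | none => exact hk
  | some N => exact lt_min (hN N h) hk

theorem sat_isActive {D : Schema} {hD : D.WF} {I : CatInst} {hI : I.Valid D} {β : SVar → Val}
    {c : ℕ} : (I.model hD hI).Sat β (isActive D c) ↔ stateOf D β (.self c) ≠ none := Iff.rfl

section Steps

variable {M : DAB} (hM : M.WF) {S : Setting} {k m : ℕ} {I : CatInst} {hI : I.Valid M.schema}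

theorem sat_transFml {β : SVar → Val} :
    (I.model hM.1 hI).Sat β (M.toSAS S k m).transFml ↔
      ∃ t ∈ (M.toSAS S k m).trans, (I.model hM.1 hI).Sat β t.guard ∧
        ∀ a, SysVar M (S.caseSlots k) m a →
          stateOf M.schema (primed β) a = nextSt (I.model hM.1 hI) β t.upd a := by
  have key : ∀ t : Trans, (I.model hM.1 hI).Sat β (t.fml (M.toSAS S k m).vars) ↔
      (I.model hM.1 hI).Sat β t.guard ∧ ∀ a, SysVar M (S.caseSlots k) m a →
          stateOf M.schema (primed β) a = nextSt (I.model hM.1 hI) β t.upd a := by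
    intro t
    rw [Trans.fml, TModel.Sat, TModel.sat_bigAnd, List.forall_mem_map]
    refine and_congr_right fun _ => ⟨fun h a ha => ?_, fun h p hp => ?_⟩
    · exact (CTerm.sat_eqF _ _ _ _).1 (h _ (mem_toSAS_vars.2 ⟨ha, rfl, rfl⟩))
    · obtain ⟨a, τ, v⟩ := p
      obtain ⟨ha, rfl, -⟩ := mem_toSAS_vars.1 hp
      exact (CTerm.sat_eqF _ _ _ _).2 (h a ha)
  rw [SAS.transFml, TModel.sat_bigOr]
  constructor
  · rintro ⟨φ, hφ, h⟩
    obtain ⟨t, ht, rfl⟩ := List.mem_map.1 hφ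
    exact ⟨t, ht, (key t).1 h⟩
  · rintro ⟨t, ht, h⟩
    exact ⟨_, List.mem_map.2 ⟨t, ht, rfl⟩, (key t).2 h⟩

theorem DAB.stored_of_bind (b : ℕ) (g : Guard) (h : ∃ ρ ∈ M.rules, ρ.act = .bind b g) :
    ∀ v ∈ g.head, (b, v) ∈ M.stored := fun _ hv => mem_stored h hv

/-- Transitions of the artifact system are steps of the DAB. -/
theorem exists_step {β : SVar → Val} (hβ : (I.model hM.1 hI).Sorted β) {s : Snapshot}
    (hrel : Rel M (S.caseSlots k) m s (stateOf M.schema β))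
    (h : (I.model hM.1 hI).Sat β (M.toSAS S k m).transFml) :
    ∃ s', Step M S I s s' ∧ Rel M (S.caseSlots k) m s' (stateOf M.schema (primed β)) := by
  obtain ⟨t, ht, hg, hnext⟩ := (sat_transFml hM).1 h
  obtain ⟨c, hc, rfl | ⟨ρ, hρ, ht⟩⟩ := mem_toSAS_trans.1 ht
  · obtain ⟨h₁, h₂, h₃⟩ := hg
    have hfree : stateOf M.schema β (.self c) = none := by
      by_contra hne
      exact h₁ hne
    obtain ⟨id, hid⟩ := Option.ne_none_iff_exists'.1 h₂
    have hnew : id ∉ s.ids := by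
      intro hmem
      obtain ⟨c', hc', h'⟩ := (hrel.ids id).1 hmem
      rw [TModel.sat_bigAnd] at h₃
      exact h₃ _ (List.mem_map.2 ⟨c', List.mem_range.2 hc', rfl⟩) (hid.trans h'.symm)
    refine ⟨_, .newCase s id hnew fun N hN => ?_,
      (hrel.newCase hc hfree hnew (w' := nextSt (I.model hM.1 hI) β _) ?_ ?_).congr hnext⟩
    · exact (hrel.card_lt hc hfree).trans_le (S.caseSlots_le k hN)
    · rw [← hid]
      simp [nextSt, nextC, newCaseTr, CTerm.eval]
    · intro a ha
      refine nextSt_of_forall_ne fun p hp => ?_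
      obtain rfl : p = _ := by simpa [newCaseTr] using hp
      exact ha.symm
  · have hok := DAB.rules_ok hM ρ hρ
    simp only [Rule.tr, List.mem_map] at ht
    obtain ⟨t, ht', rfl⟩ := ht
    obtain ⟨⟨h₁, h₂⟩, h₃⟩ := hg
    obtain ⟨id, hid⟩ := Option.ne_none_iff_exists'.1 (sat_isActive.1 h₁)
    have he := hrel.active c hc id hid
    obtain ⟨x', mem', repo', happ, hm⟩ := Act.tr_sound hβ hrel.ids he hid hrel.repo
      DAB.stored_of_bind hok.2.2 ht' h₃
    obtain ⟨hcase, hrepo, hkeys⟩ := hm.rule he ρ.post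
    refine ⟨_, .progress s id ((hrel.ids id).2 ⟨c, hc, hid⟩) ρ hρ (fun p hp => ?_) x' mem' repo'
      happ, (hrel.progress hc hid (fun a ha => ?_) hcase hrepo).congr hnext⟩
    · rw [TModel.sat_bigAnd, List.forall_mem_map] at h₂
      have := (he.ctl p.1 (hok.1 p hp)).symm.trans (h₂ p hp)
      exact LState.code_injective (Option.some.inj this)
    · exact nextSt_of_forall_ne fun p hp e => ha (e ▸ hkeys p hp)

open Classical in
/-- An assignment that makes a transition. -/
theorem exists_transition {α : SVar → Val} (hα : (I.model hM.1 hI).Sorted α) {t : Trans}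
    (ht : t ∈ (M.toSAS S k m).trans) {σ : ℕ → Var → Val}
    (hσ : ∀ tag v, I.Sort M.schema v.2 (σ tag v))
    (hg : (I.model hM.1 hI).Sat (withEx α σ) t.guard) :
    ∃ β, (I.model hM.1 hI).Sorted β ∧ (∀ x, x.isCur = true → β x = α x) ∧
      (I.model hM.1 hI).Sat β (M.toSAS S k m).transFml ∧
      stateOf M.schema (primed β) = nextSt (I.model hM.1 hI) (withEx α σ) t.upd := by
  have hok := toSAS_trans_ok hM t ht
  have hβ₀ := sorted_withEx hα hσ
  let β : SVar → Val := fun x => match x with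
    | ⟨.nxt a, τ⟩ => if τ = avTy M.schema a then nextSt (I.model hM.1 hI) (withEx α σ) t.upd a
        else none
    | x => withEx α σ x
  have hnow : AgreeNow β (withEx α σ) := by
    rintro ⟨a | a | ⟨tag, n⟩, τ⟩ h
    · rfl
    · exact absurd rfl (h a)
    · rfl
  have hstate : stateOf M.schema (primed β) = nextSt (I.model hM.1 hI) (withEx α σ) t.upd := by
    funext a
    simp [stateOf, primed, SName.prime, β]
  refine ⟨β, ?_, ?_, (sat_transFml hM).2 ⟨t, ht, (hok.1.sat_congr hnow).2 hg, fun a _ => ?_⟩, hstate⟩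
  · rintro ⟨a | a | ⟨tag, n⟩, τ⟩
    · exact hβ₀ ⟨.cur a, τ⟩
    · show I.Sort M.schema τ (if τ = avTy M.schema a then
        nextSt (I.model hM.1 hI) (withEx α σ) t.upd a else none)
      split_ifs with h
      · rw [h]
        exact (hok.nextC a).sort_eval hβ₀
      · exact (I.model hM.1 hI).undef_sort τ
    · exact hβ₀ ⟨.ex tag n, τ⟩
  · rintro ⟨a | a | ⟨tag, n⟩, τ⟩ h
    · rfl
    · simp [SVar.isCur] at h
    · simp [SVar.isCur] at h
  · rw [hstate]
    exact ((hok.nextC a).eval_congr (A := I.model hM.1 hI) hnow).symm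

/-- Steps of the DAB that respect the bounds are transitions of the artifact system. -/
theorem Step.exists_transition {α : SVar → Val} (hα : (I.model hM.1 hI).Sorted α)
    {s s' : Snapshot} (hrel : Rel M (S.caseSlots k) m s (stateOf M.schema α))
    (hstep : Step M S I s s') (hcase : s'.ids.card ≤ k) (hrepo : ∀ r, (s'.repo r).card ≤ m) :
    ∃ β, (I.model hM.1 hI).Sorted β ∧ (∀ x, x.isCur = true → β x = α x) ∧
      (I.model hM.1 hI).Sat β (M.toSAS S k m).transFml ∧
      Rel M (S.caseSlots k) m s' (stateOf M.schema (primed β)) := by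
  cases hstep with
  | newCase id fresh limit =>
    dsimp only at hcase
    rw [Finset.card_insert_of_notMem fresh] at hcase
    obtain ⟨c, hc, hfree⟩ := hrel.exists_free (Setting.lt_caseSlots hcase limit)
    have hσ : ∀ (_ : ℕ) (v : Var), I.Sort M.schema v.2
        (if v = (0, .ident M.schema.ctype) then some id else none) := by
      intro _ v
      split_ifs with h
      · rw [h]
        intro h'
        simp [hM.1.ctype_new] at h'
      · exact (I.model hM.1 hI).undef_sort v.2
    have hg : (I.model hM.1 hI).Sat (withEx α fun _ v =>
        if v = (0, .ident M.schema.ctype) then some id else none)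
        (newCaseTr M.schema (S.caseSlots k) c).guard := by
      refine ⟨fun h => h hfree, ?_, ?_⟩
      · simp [TModel.Sat, TModel.eval, exVar, withEx]
      · rw [TModel.sat_bigAnd, List.forall_mem_map]
        intro c' hc' h
        refine fresh ((hrel.ids id).2 ⟨c', List.mem_range.1 hc', ?_⟩)
        have h' : (if ((0, .ident M.schema.ctype) : Var) = (0, .ident M.schema.ctype) then some id
          else none) = stateOf M.schema α (.self c') := h
        rw [if_pos rfl] at h'
        exact h'.symm
    obtain ⟨β, h₁, h₂, h₃, h₄⟩ := DataAwareBPMN.exists_transition hM (S := S) (k := k) (m := m) hα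
      (mem_toSAS_trans.2 ⟨c, hc, .inl rfl⟩) hσ hg
    refine ⟨β, h₁, h₂, h₃, ?_⟩
    rw [h₄]
    refine hrel.newCase hc hfree fresh ?_ fun a ha => ?_
    · simp [nextSt, nextC, newCaseTr, CTerm.eval, TModel.eval, exVar, withEx]
    · refine nextSt_of_forall_ne fun p hp => ?_
      obtain rfl : p = _ := by simpa [newCaseTr] using hp
      exact ha.symm
  | progress id hid ρ hρ control x' mem' repo' data =>
    have hok := DAB.rules_ok hM ρ hρ
    obtain ⟨c, hc, hid⟩ := (hrel.ids id).1 hid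
    have he := hrel.active c hc id hid
    obtain ⟨t, ht, σ, hσ, hg, hm⟩ := Act.tr_complete hα hrel.ids he hid hrel.repo
      DAB.stored_of_bind hok.2.2 data hrepo
    obtain ⟨hcase', hrepo', hkeys⟩ := ActMatch.rule (β := withEx α σ) he hm ρ.post
    obtain ⟨β, h₁, h₂, h₃, h₄⟩ := DataAwareBPMN.exists_transition hM (S := S) (k := k) (m := m) hα
      (mem_toSAS_trans.2 ⟨c, hc, .inr ⟨ρ, hρ, List.mem_map.2 ⟨t, ht, rfl⟩⟩⟩) hσ (by
        refine ⟨⟨?_, ?_⟩, hg⟩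
        · refine sat_isActive.2 fun h => ?_
          have : stateOf M.schema α (.self c) = none := h
          simp [hid] at this
        · rw [TModel.sat_bigAnd, List.forall_mem_map]
          intro p hp
          have := he.ctl p.1 (hok.1 p hp)
          rw [control p hp] at this
          exact this)
    refine ⟨β, h₁, h₂, h₃, ?_⟩
    rw [h₄]
    exact hrel.progress hc hid (fun a ha =>
      nextSt_of_forall_ne fun p hp (e : p.1 = a) => ha (e ▸ hkeys p hp)) hcase' hrepo'

end Steps

/-! ## Properties, initial states and unsafety -/

theorem mem_slotLists {n i : ℕ} {l : List ℕ} :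
    l ∈ slotLists n i ↔ l.length = i ∧ ∀ c ∈ l, c < n := by
  induction i generalizing l with
  | zero =>
    simp only [slotLists, List.mem_singleton, List.length_eq_zero_iff]
    constructor
    · rintro rfl
      simp
    · exact fun h => h.1
  | succ i ih =>
    simp only [slotLists, List.mem_flatMap, List.mem_map, List.mem_range, ih]
    cases l with
    | nil => simp
    | cons c l =>
      simp only [List.cons.injEq, List.length_cons, Nat.add_right_cancel_iff, List.mem_cons,
        forall_eq_or_imp]
      constructor
      · rintro ⟨l', ⟨h₁, h₂⟩, c', hc', rfl, rfl⟩
        exact ⟨h₁, hc', h₂⟩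
      · rintro ⟨h₁, hc, h₂⟩
        exact ⟨l, ⟨h₁, h₂⟩, c, hc, rfl, rfl⟩

section Final

variable {M : DAB} (hM : M.WF) {S : Setting} {k m : ℕ} {I : CatInst} {hI : I.Valid M.schema}

theorem sat_property {nc : ℕ} {β : SVar → Val} {υ : Property} :
    (I.model hM.1 hI).Sat β (υ.tr M nc m) ↔
      ∃ c : Fin υ.length → ℕ, (∀ i, c i < nc) ∧ Function.Injective c ∧
        ∀ i, (I.model hM.1 hI).Sat β (isActive M.schema (c i)) ∧
          (I.model hM.1 hI).Sat β (υ[i].tr M.schema nc m (c i)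
            fun v => if v ∈ υ[i].head then exVar 0 v else exVar (i + 1) v) := by
  rw [Property.tr, TModel.sat_bigOr]
  constructor
  · rintro ⟨φ, hφ, h⟩
    obtain ⟨l, hl, rfl⟩ := List.mem_map.1 hφ
    obtain ⟨hl, hnodup⟩ := List.mem_filter.1 hl
    obtain ⟨hlen, hlt⟩ := mem_slotLists.1 hl
    have hnodup : l.Nodup := by simpa using hnodup
    refine ⟨fun i => l[i.1]'(by rw [hlen]; exact i.2), fun i => hlt _ (List.getElem_mem _), fun i j hij => ?_,
      fun i => ?_⟩
    · exact Fin.ext ((hnodup.getElem_inj_iff).1 hij)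
    · rw [TModel.sat_bigAnd, List.forall_mem_map] at h
      have hi : i.1 < l.length := by
        rw [hlen]
        exact i.2
      exact h ((υ[i], l[i.1]), i.1) (List.mk_mem_zipIdx_iff_getElem?.2 (by
        rw [List.getElem?_zip_eq_some]
        exact ⟨by simp, by simp [hi]⟩))
  · rintro ⟨c, hlt, hinj, h⟩
    refine ⟨_, List.mem_map.2 ⟨List.ofFn c, List.mem_filter.2 ⟨mem_slotLists.2 ⟨by simp, ?_⟩, ?_⟩,
      rfl⟩, ?_⟩
    · simpa [List.mem_ofFn] using hlt
    · simpa using List.nodup_ofFn.2 hinj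
    · rw [TModel.sat_bigAnd, List.forall_mem_map]
      rintro ⟨⟨G, c'⟩, i⟩ hp
      obtain ⟨h₁, h₂⟩ := List.getElem?_zip_eq_some.1 (List.mk_mem_zipIdx_iff_getElem?.1 hp)
      obtain ⟨hi, rfl⟩ := List.getElem?_eq_some_iff.1 h₁
      obtain ⟨hi', rfl⟩ := List.getElem?_eq_some_iff.1 h₂
      simpa [TModel.Sat] using h ⟨i, hi⟩

open Classical in
theorem Rel.property_iff {nc : ℕ} {υ : Property} (hυ : υ.WF M) {s : Snapshot} {α : SVar → Val}
    (hα : (I.model hM.1 hI).Sorted α) (hrel : Rel M nc m s (stateOf M.schema α)) :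
    (∃ β, (I.model hM.1 hI).Sorted β ∧ (∀ x, x.isCur = true → β x = α x) ∧
      (I.model hM.1 hI).Sat β (υ.tr M nc m)) ↔ υ.Holds M I s := by
  have hty : ∀ (G : Guard) (i : ℕ), ∀ v ∈ G.vars,
      ((fun v => if v ∈ G.head then exVar 0 v else exVar (i + 1) v) v).HasTy M.schema v.2 := by
    intro G i v _
    dsimp only
    split_ifs <;> exact exVar_hasTy _ _
  constructor
  · rintro ⟨β, hβ, hcur, h⟩
    obtain ⟨c, hlt, hinj, h⟩ := (sat_property hM).1 h
    have hstate : stateOf M.schema β = stateOf M.schema α := funext fun a => hcur _ rfl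
    rw [← hstate] at hrel
    have hid : ∀ i, ∃ id, stateOf M.schema β (.self (c i)) = some id := fun i =>
      Option.ne_none_iff_exists'.1 (sat_isActive.1 (h i).1)
    choose id hid using hid
    have hgd : ∀ i : Fin υ.length, ∃ σ, Assignment M.schema I s.ids σ ∧
        (∀ v ∈ υ[i].vars, (I.model hM.1 hI).eval β
          (if v ∈ υ[i].head then exVar 0 v else exVar (i.1 + 1) v) = σ v) ∧
        UCQHolds I s.repo (Term.eval (id i) (s.entry (id i)) σ) υ[i].body := fun i =>
      Guard.tr_sound hβ hrel.ids (hrel.active _ (hlt i) _ (hid i)) (hid i) hrel.repo le_rfl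
        (hυ _ (List.getElem_mem _)) (hty _ _) (h i).2
    choose σ' hσ' hval hucq using hgd
    have hhead : ∀ i : Fin υ.length, ∀ v ∈ υ[i].head, σ' i v = β ⟨.ex 0 v.1, v.2⟩ := by
      intro i v hv
      rw [← hval i v (List.mem_append_left _ hv), if_pos hv]
      rfl
    refine ⟨fun v => if ∃ i : Fin υ.length, v ∈ υ[i].head then β ⟨.ex 0 v.1, v.2⟩ else none, id,
      fun v => ?_, fun i j hij => ?_, fun i => ⟨(hrel.ids _).2 ⟨c i, hlt i, hid i⟩, σ' i, hσ' i,
        fun v hv => ?_, hucq i⟩⟩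
    · dsimp only
      split_ifs with hv
      · obtain ⟨i, hv⟩ := hv
        rw [← hhead i v hv]
        exact hσ' i v
      · simp [InDom]
    · exact hinj (hrel.inj _ (hlt i) _ (hlt j) _ (hid i) (hij ▸ hid j))
    · dsimp only
      rw [if_pos ⟨i, hv⟩, hhead i v hv]
  · rintro ⟨σ, id, hσ, hinj, h⟩
    have hslot : ∀ i, ∃ c < nc, stateOf M.schema α (.self c) = some (id i) := fun i =>
      (hrel.ids _).1 (h i).1
    choose c hlt hid using hslot
    choose σ' hσ' hhead hucq using fun i => (h i).2
    let τ : ℕ → Var → Val := fun tag => match tag with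
      | 0 => σ
      | i + 1 => if hi : i < υ.length then σ' ⟨i, hi⟩ else fun _ => none
    have hτ : ∀ tag v, I.Sort M.schema v.2 (τ tag v) := by
      rintro (_ | i) v
      · exact (hσ v).sort hM.1
      · by_cases hi : i < υ.length
        · simp only [τ, hi, dif_pos]
          exact (hσ' ⟨i, hi⟩ v).sort hM.1
        · simp only [τ, hi, dif_neg, not_false_eq_true]
          exact (I.model hM.1 hI).undef_sort v.2
    have hβ := sorted_withEx (hD := hM.1) (hI := hI) hα hτ
    refine ⟨withEx α τ, hβ, fun x hx => withEx_of_isCur hx, (sat_property hM).2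
      ⟨c, hlt, fun i j hij => ?_, fun i => ⟨?_, ?_⟩⟩⟩
    · exact hinj (Option.some.inj ((hid i).symm.trans (hij ▸ hid j)))
    · refine sat_isActive.2 fun h => ?_
      have : stateOf M.schema α (.self (c i)) = none := h
      simp [hid i] at this
    · refine (Guard.sat_tr (β := withEx α τ) (id := id i) (σ := σ' i) hβ hrel.ids
        (hrel.active _ (hlt i) _ (hid i)) (hid i) hrel.repo le_rfl (hυ _ (List.getElem_mem _))
        (hty _ _) fun v _ => ?_).2 ⟨fun v _ => hσ' i v, hucq i⟩
      dsimp only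
      split_ifs with hv
      · exact (hhead i v hv).symm
      · show τ (i + 1) v = σ' i v
        simp [τ]

theorem sat_initial {α : SVar → Val} :
    (I.model hM.1 hI).Sat α (M.toSAS S k m).initial ↔
      ∀ a, SysVar M (S.caseSlots k) m a → stateOf M.schema α a = initVal a := by
  have hconst : ∀ a τ, (I.model hM.1 hI).eval α (.const τ (initVal a)) = initVal a := by
    intro a τ
    cases initVal a <;> rfl
  rw [SAS.initial, TModel.sat_bigAnd, List.forall_mem_map]
  constructor
  · intro h a ha
    exact (h _ (mem_toSAS_vars.2 ⟨ha, rfl, rfl⟩)).trans (hconst a _)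
  · rintro h ⟨a, τ, v⟩ hp
    obtain ⟨ha, rfl, rfl⟩ := mem_toSAS_vars.1 hp
    exact (h a ha).trans (hconst a _).symm

theorem Rel.initial (M : DAB) (nc m : ℕ) : Rel M nc m .initial initVal := by
  refine ⟨fun id => ?_, fun c _ c' _ id h => ?_, fun c _ id h => ?_,
    fun c _ _ => ⟨fun i _ => rfl, fun b _ => rfl, fun p _ => rfl⟩, fun r R _ => ?_⟩
  · simp [Snapshot.initial, initVal]
  · simp [initVal] at h
  · simp [initVal] at h
  · simp [Snapshot.initial, slotVal, initVal]

theorem exists_initial :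
    ∃ α : SVar → Val, (I.model hM.1 hI).Sorted α ∧ stateOf M.schema α = initVal := by
  refine ⟨fun x => match x with
    | ⟨.cur a, τ⟩ => if τ = avTy M.schema a then initVal a else none
    | _ => none, ?_, ?_⟩
  · rintro ⟨a | a | ⟨tag, n⟩, τ⟩
    · dsimp only
      split_ifs with h
      · cases a with
        | ctl c b =>
          rw [h]
          exact (I.model hM.1 hI).cst_sort _ _ (constOk_enum LState.idle.code_lt)
        | _ => exact (I.model hM.1 hI).undef_sort τ
      · exact (I.model hM.1 hI).undef_sort τ
    · exact (I.model hM.1 hI).undef_sort τ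
    · exact (I.model hM.1 hI).undef_sort τ
  · funext a
    simp [stateOf]

theorem exists_reachable {υ : Property} (hυ : υ.WF M) {n : ℕ} {α : SVar → Val}
    (hα : (I.model hM.1 hI).Sorted α) {s : Snapshot}
    (hrel : Rel M (S.caseSlots k) m s (stateOf M.schema α))
    (h : (M.toSAS S k m).ReachesIn (υ.tr M (S.caseSlots k) m) (I.model hM.1 hI) n α) :
    ∃ s', Relation.ReflTransGen (Step M S I) s s' ∧ υ.Holds M I s' := by
  induction n generalizing α s with
  | zero => exact ⟨s, .refl, (hrel.property_iff hM hυ hα).1 h⟩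
  | succ n ih =>
    obtain ⟨β, hβ, hcur, htr, h⟩ := h
    have hstate : stateOf M.schema β = stateOf M.schema α := funext fun a => hcur _ rfl
    rw [← hstate] at hrel
    obtain ⟨s', hstep, hrel'⟩ := exists_step hM hβ hrel htr
    obtain ⟨s'', hs, hυ'⟩ := ih hβ.primed hrel' h
    exact ⟨s'', .head hstep hs, hυ'⟩

theorem exists_reachesIn {υ : Property} (hυ : υ.WF M) (hcase : CaseBounded M S k)
    (hrepo : RepoBounded M S m) {s s' : Snapshot} (hs : Reachable M S I s)
    (hss : Relation.ReflTransGen (Step M S I) s s') (hs' : υ.Holds M I s') {α : SVar → Val}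
    (hα : (I.model hM.1 hI).Sorted α) (hrel : Rel M (S.caseSlots k) m s (stateOf M.schema α)) :
    ∃ n, (M.toSAS S k m).ReachesIn (υ.tr M (S.caseSlots k) m) (I.model hM.1 hI) n α := by
  induction hss using Relation.ReflTransGen.head_induction_on generalizing α with
  | refl => exact ⟨0, (hrel.property_iff hM hυ hα).2 hs'⟩
  | head hstep _ ih =>
    have hr := hs.tail hstep
    obtain ⟨β, hβ, hcur, htr, hrel'⟩ := hstep.exists_transition hM hα hrel (hcase I hI _ hr)
      (hrepo I hI _ hr)
    obtain ⟨n, h⟩ := ih hr hβ.primed hrel'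
    exact ⟨n + 1, β, hβ, hcur, htr, h⟩

theorem dab_reaches_iff {υ : Property} (hυ : υ.WF M) (hcase : CaseBounded M S k)
    (hrepo : RepoBounded M S m) :
    Unsafe M S υ ↔ ∃ (I : CatInst) (hI : I.Valid M.schema) (α : SVar → Val) (n : ℕ),
      (I.model hM.1 hI).Sorted α ∧ (I.model hM.1 hI).Sat α (M.toSAS S k m).initial ∧
      (M.toSAS S k m).ReachesIn (υ.tr M (S.caseSlots k) m) (I.model hM.1 hI) n α := by
  constructor
  · rintro ⟨I, hI, s, hs, hυs⟩
    obtain ⟨α, hα, hstate⟩ := exists_initial hM (hI := hI)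
    obtain ⟨n, h⟩ := exists_reachesIn hM (hI := hI) hυ hcase hrepo .refl hs hυs hα
      (hstate ▸ Rel.initial M _ m)
    exact ⟨I, hI, α, n, hα, (sat_initial hM).2 fun a _ => congrFun hstate a, h⟩
  · rintro ⟨I, hI, α, n, hα, hinit, h⟩
    obtain ⟨s, hs, hυs⟩ := exists_reachable hM hυ hα
      ((Rel.initial M _ m).congr ((sat_initial hM).1 hinit)) h
    exact ⟨I, hI, s, hs, hυs⟩

end Final

end DataAwareBPMN

open DataAwareBPMN in
/-- For a case-bounded, repo-bounded, acyclic DAB and a property over it, under either insertion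
semantics: the executable satisfiability test and quantifier elimination are correct, and with
these or any other correct ones `BackReach` terminates, answering yes iff the DAB is unsafe. -/
theorem backReach_terminates_case_repo_bounded_acyclic
    (M : DAB) (S : Setting) (k m : ℕ) (υ : Property)
    (hM : M.WF) (hυ : υ.WF M)
    (hcase : CaseBounded M S k) (hrepo : RepoBounded M S m) (hacyclic : M.Acyclic) :
    (refBackend M.schema).Correct M.schema ∧
    ∀ be : Backend, be.Correct M.schema →
      ∃ b : Bool, (∃ n, backReach be M S k m υ n = some b) ∧ (b = true ↔ Unsafe M S υ) := by
  refine ⟨refBackend_correct hM.1 hacyclic, fun be hbe => ?_⟩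
  obtain ⟨b, hb, h⟩ := SAS.search_correct_catInst hacyclic hM.1 (toSAS_wf hM S k m) hbe
    (Property.wf_tr hυ (S.caseSlots k) m)
  exact ⟨b, hb, h.trans (dab_reaches_iff hM hυ hcase hrepo).symm⟩
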